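/- Let G and H be one-ended centerless right-angled Artin groups (i.e. G ≅ G_Γ and H ≅ G_Λ for finite simple graphs Γ, Λ that are connected, have at least two vertices, and have no vertex adjacent to every other vertex). Let G ↷ (X,μ) and H ↷ (Y,ν) be free irreducible measure-preserving actions on standard probability spaces. If the actions are stably orbit equivalent, then they are conjugate: there exist a group isomorphism α : G → H and a measure space isomorphism F : X → Y with F(gx) = α(g)F(x) for every g ∈ G and a.e. x ∈ X. -/

import Mathlib

open MeasureTheory
open scoped ENNReal Pointwise symmDiff

namespace OEPaper

/- ## Right-angled Artin groups and graph combinatorics -/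

/-- The commutation relations defining the right-angled Artin group of a graph. -/
def raagRels {V : Type} (Γ : SimpleGraph V) : Set (FreeGroup V) :=
  {r | ∃ u v : V, Γ.Adj u v ∧
    r = FreeGroup.of u * FreeGroup.of v * (FreeGroup.of u)⁻¹ * (FreeGroup.of v)⁻¹}

/-- The right-angled Artin group of a simple graph `Γ`. -/
abbrev RAAG {V : Type} (Γ : SimpleGraph V) : Type := PresentedGroup (raagRels Γ)

/-- The standard generator of `RAAG Γ` associated to a vertex. -/
def gen {V : Type} (Γ : SimpleGraph V) (v : V) : RAAG Γ := PresentedGroup.of v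

/-- The standard subgroup associated to (the full subgraph spanned by) a set of vertices. -/
def standardSub {V : Type} (Γ : SimpleGraph V) (S : Set V) : Subgroup (RAAG Γ) :=
  Subgroup.closure (gen Γ '' S)

/-- Conjugate of a subgroup. -/
def conjSub {G : Type} [Group G] (g : G) (P : Subgroup G) : Subgroup G :=
  Subgroup.map (MulAut.conj g).toMonoidHom P

/-- Parabolic subgroups: conjugates of standard subgroups. -/
def IsParabolic {V : Type} (Γ : SimpleGraph V) (P : Subgroup (RAAG Γ)) : Prop :=
  ∃ (g : RAAG Γ) (S : Set V), P = conjSub g (standardSub Γ S)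

/-- The "orthogonal" of a set of vertices: vertices outside `S` adjacent to every vertex of `S`. -/
def perp {V : Type} (Γ : SimpleGraph V) (S : Set V) : Set V :=
  {v : V | v ∉ S ∧ ∀ u ∈ S, Γ.Adj v u}

/-- `S` spans a join subgraph of `Γ`. -/
def IsJoin {V : Type} (Γ : SimpleGraph V) (S : Set V) : Prop :=
  ∃ S₁ S₂ : Set V, S₁.Nonempty ∧ S₂.Nonempty ∧ S₁ ∪ S₂ = S ∧ ∀ u ∈ S₁, ∀ v ∈ S₂, Γ.Adj u v

/-- `S` spans a maximal join subgraph of `Γ`. -/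
def IsMaxJoin {V : Type} (Γ : SimpleGraph V) (S : Set V) : Prop :=
  IsJoin Γ S ∧ ∀ T : Set V, IsJoin Γ T → S ⊆ T → S = T

/-- Join parabolic subgroups. -/
def IsJoinParabolic {V : Type} (Γ : SimpleGraph V) (P : Subgroup (RAAG Γ)) : Prop :=
  ∃ (g : RAAG Γ) (S : Set V), IsJoin Γ S ∧ P = conjSub g (standardSub Γ S)

/-- Maximal join parabolic subgroups. -/
def IsMaxJoinParabolic {V : Type} (Γ : SimpleGraph V) (P : Subgroup (RAAG Γ)) : Prop :=
  ∃ (g : RAAG Γ) (S : Set V), IsMaxJoin Γ S ∧ P = conjSub g (standardSub Γ S)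

/-- The center of a subgroup `P`, as a subset of the ambient group. -/
def subCenter {G : Type} [Group G] (P : Subgroup G) : Set G :=
  {x : G | x ∈ P ∧ ∀ y ∈ P, x * y = y * x}

/-- The commutation graph of a subset `S` of a group. -/
def chainCommGraph {G : Type} [Group G] (S : Set G) : SimpleGraph S :=
  SimpleGraph.fromRel fun a b => Commute (a : G) (b : G)

/-- A generating set is chain-commuting if its commutation graph is connected. -/
def IsChainCommuting {G : Type} [Group G] (S : Set G) : Prop :=
  (chainCommGraph S).Connected

/-- Amenability: existence of a finitely additive left-invariant probability
measure defined on all subsets. -/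
def IsAmenable (G : Type) [Group G] : Prop :=
  ∃ m : Set G → ℝ, m Set.univ = 1 ∧ (∀ A : Set G, 0 ≤ m A) ∧
    (∀ A B : Set G, Disjoint A B → m (A ∪ B) = m A + m B) ∧
    ∀ (g : G) (A : Set G), m ((g * ·) '' A) = m A

/-- ICC groups: every nontrivial element has an infinite conjugacy class. -/
def IsICC (G : Type) [Group G] : Prop :=
  ∀ g : G, g ≠ 1 → {h : G | ∃ c : G, c * g * c⁻¹ = h}.Infinite

/-- The root-conjugation property. -/
def RootConjugationProperty (H : Type) [Group H] : Prop :=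
  ∀ (h₁ h₂ : H) (k : ℕ), 0 < k → Commute h₁ (h₂ ^ k) → Commute h₁ h₂

/- ## Measured dynamics -/

/-- Measure-preserving action by measurable automorphisms. -/
def PmpAction (G : Type) [Group G] (X : Type) [MeasurableSpace X] [MulAction G X]
    (μ : Measure X) : Prop :=
  ∀ g : G, MeasurePreserving (fun x : X => g • x) μ μ

/-- Essentially free action. -/
def FreeAction (G : Type) [Group G] (X : Type) [MeasurableSpace X] [MulAction G X]
    (μ : Measure X) : Prop :=
  ∀ g : G, g ≠ 1 → μ {x : X | g • x = x} = 0

/-- Ergodic action of a group. -/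
def ErgodicAction (G : Type) [Group G] (X : Type) [MeasurableSpace X] [MulAction G X]
    (μ : Measure X) : Prop :=
  ∀ A : Set X, MeasurableSet A → (∀ g : G, (fun x : X => g • x) ⁻¹' A = A) →
    μ A = 0 ∨ μ A = 1

/-- Ergodicity of the action of a subgroup. -/
def ErgodicSubgroup (G : Type) [Group G] (A : Subgroup G) (X : Type) [MeasurableSpace X]
    [MulAction G X] (μ : Measure X) : Prop :=
  ∀ s : Set X, MeasurableSet s → (∀ a ∈ A, (fun x : X => a • x) ⁻¹' s = s) →
    μ s = 0 ∨ μ s = 1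

/-- Irreducible action of a right-angled Artin group: for some identification of the group
with a `RAAG Δ`, every standard generator acts ergodically. -/
def IrreducibleAction (G : Type) [Group G] (X : Type) [MeasurableSpace X] [MulAction G X]
    (μ : Measure X) : Prop :=
  ∃ (n : ℕ) (Δ : SimpleGraph (Fin n)) (e : RAAG Δ ≃* G),
    ∀ v : Fin n, Ergodic (fun x : X => e (gen Δ v) • x) μ

/-- A measure space isomorphism (mod null sets): a measurable measure-preserving map
admitting an a.e. two-sided measurable inverse. -/
def MeasIso {A : Type} {B : Type} [MeasurableSpace A] [MeasurableSpace B]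
    (μ : Measure A) (ν : Measure B) (F : A → B) : Prop :=
  Measurable F ∧ MeasurePreserving F μ ν ∧
    ∃ F' : B → A, Measurable F' ∧ (∀ᵐ a ∂μ, F' (F a) = a) ∧ ∀ᵐ b ∂ν, F (F' b) = b

/-- Conjugacy of two actions through a given group isomorphism. -/
def ConjugateVia (G : Type) [Group G] (X : Type) [MeasurableSpace X] [MulAction G X]
    (H : Type) [Group H] (Y : Type) [MeasurableSpace Y] [MulAction H Y]
    (μ : Measure X) (ν : Measure Y) (α : G ≃* H) : Prop :=
  ∃ F : X → Y, MeasIso μ ν F ∧ ∀ g : G, ∀ᵐ x ∂μ, F (g • x) = α g • F x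

/-- Conjugacy of two actions. -/
def ConjugateActions (G : Type) [Group G] (X : Type) [MeasurableSpace X] [MulAction G X]
    (H : Type) [Group H] (Y : Type) [MeasurableSpace Y] [MulAction H Y]
    (μ : Measure X) (ν : Measure Y) : Prop :=
  ∃ α : G ≃* H, ConjugateVia G X H Y μ ν α

/-- Orbit equivalence of two actions. -/
def OrbitEquivalent (G : Type) [Group G] (X : Type) [MeasurableSpace X] [MulAction G X]
    (H : Type) [Group H] (Y : Type) [MeasurableSpace Y] [MulAction H Y]
    (μ : Measure X) (ν : Measure Y) : Prop :=
  ∃ F : X → Y, MeasIso μ ν F ∧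
    ∀ᵐ x ∂μ, F '' MulAction.orbit G x = MulAction.orbit H (F x)

/-- Measurable cocycle for an action, with values in a (discrete) group `H`. -/
def IsCocycle (G : Type) [Group G] (X : Type) [MeasurableSpace X] [MulAction G X]
    (H : Type) [Group H] (μ : Measure X) (c : G → X → H) : Prop :=
  (∀ (g : G) (h : H), MeasurableSet {x : X | c g x = h}) ∧
    ∀ g g' : G, ∀ᵐ x ∂μ, c (g * g') x = c g (g' • x) * c g' x

/-- Cohomology of cocycles. -/
def Cohomologous (G : Type) [Group G] (X : Type) [MeasurableSpace X] [MulAction G X]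
    (H : Type) [Group H] (μ : Measure X) (c c' : G → X → H) : Prop :=
  ∃ φ : X → H, (∀ h : H, MeasurableSet {x : X | φ x = h}) ∧
    ∀ g : G, ∀ᵐ x ∂μ, c' g x = φ (g • x) * c g x * (φ x)⁻¹

/-- A stable orbit equivalence between two actions: a measure-scaling Borel isomorphism
between positive measure subsets, matching orbits. -/
structure StableOE (G : Type) [Group G] (X : Type) [MeasurableSpace X] [MulAction G X]
    (H : Type) [Group H] (Y : Type) [MeasurableSpace Y] [MulAction H Y]
    (μ : Measure X) (ν : Measure Y) where
  U : Set X
  V : Set Y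
  measU : MeasurableSet U
  measV : MeasurableSet V
  posU : 0 < μ U
  posV : 0 < ν V
  toFun : X → Y
  invFun : Y → X
  meas_toFun : Measurable toFun
  meas_invFun : Measurable invFun
  maps : Set.MapsTo toFun U V
  maps_inv : Set.MapsTo invFun V U
  left_inv : ∀ x ∈ U, invFun (toFun x) = x
  right_inv : ∀ y ∈ V, toFun (invFun y) = y
  pushforward : ∀ B : Set Y, B ⊆ V → MeasurableSet B →
    (μ U)⁻¹ * μ (U ∩ toFun ⁻¹' B) = (ν V)⁻¹ * ν B
  orbit_eq : ∀ᵐ x ∂μ, x ∈ U →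
    toFun '' (MulAction.orbit G x ∩ U) = MulAction.orbit H (toFun x) ∩ V

namespace StableOE

variable {G : Type} [Group G] {X : Type} [MeasurableSpace X] [MulAction G X]
  {H : Type} [Group H] {Y : Type} [MeasurableSpace Y] [MulAction H Y]
  {μ : Measure X} {ν : Measure Y}

/-- The compression constant of a stable orbit equivalence. -/
noncomputable def kappa (f : StableOE G X H Y μ ν) : ℝ≥0∞ := ν f.V / μ f.U

/-- `c` is an SOE cocycle associated to the stable orbit equivalence `f`. -/
def IsSOECocycle (f : StableOE G X H Y μ ν) (c : G → X → H) : Prop :=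
  IsCocycle G X H μ c ∧
    ∃ p : X → X, Measurable p ∧
      (∀ᵐ x ∂μ, p x ∈ f.U ∧ p x ∈ MulAction.orbit G x) ∧
      ∀ g : G, ∀ᵐ x ∂μ, f.toFun (p (g • x)) = c g x • f.toFun (p x)

end StableOE

/-- Mildly mixing action. -/
def MildlyMixing (H : Type) [Group H] (Y : Type) [MeasurableSpace Y] [MulAction H Y]
    (ν : Measure Y) : Prop :=
  ∀ A : Set Y, MeasurableSet A → ν A ≠ 0 → ν A ≠ ν Set.univ →
    ∀ u : ℕ → H, Function.Injective u →
      0 < Filter.atTop.liminf fun n => ν (((u n • ·) '' A) ∆ A)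

/- ## Virtual conjugacy -/

/-- `(Z, qact, ρ)` together with `π : X → Z` is a model for the quotient of the action
`G ↷ (X, μ)` by the normal subgroup `F`, with the induced `G ⧸ F`-action. -/
def IsQuotientModel {G : Type} [Group G] (F : Subgroup G) [F.Normal]
    {X : Type} [MeasurableSpace X] [MulAction G X] (μ : Measure X)
    {Z : Type} [MeasurableSpace Z] (qact : G ⧸ F →* Equiv.Perm Z) (ρ : Measure Z)
    (π : X → Z) : Prop :=
  Measurable π ∧ Measure.map π μ = ρ ∧
    (∀ (g : G) (x : X), π (g • x) = qact (QuotientGroup.mk g) (π x)) ∧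
    ∀ x y : X, π x = π y ↔ ∃ f ∈ F, f • x = y

/-- The action `act : Q →* Perm Z` on `(Z, ρ)` is (isomorphic to) the action induced from the
action `act' : K →* Perm X'` of the finite-index subgroup `K` on `(X', μ')`. -/
def InducedFrom {Q : Type} [Group Q] (K : Subgroup Q)
    {Z : Type} [MeasurableSpace Z] (act : Q →* Equiv.Perm Z) (ρ : Measure Z)
    {X' : Type} [MeasurableSpace X'] (act' : ↥K →* Equiv.Perm X') (μ' : Measure X') : Prop :=
  letI : MeasurableSpace (Q ⧸ K) := ⊤
  ∃ σ : Q ⧸ K → Q, (∀ k : Q ⧸ K, (QuotientGroup.mk (σ k) : Q ⧸ K) = k) ∧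
    ∃ Φ : X' × (Q ⧸ K) → Z,
      MeasIso (Measure.sum fun k : Q ⧸ K =>
        (K.index : ℝ≥0∞)⁻¹ • Measure.map (fun x' : X' => (x', k)) μ') ρ Φ ∧
      ∀ (g : Q) (k : Q ⧸ K) (h : ↥K), (h : Q) = (σ (g • k))⁻¹ * g * σ k →
        ∀ᵐ x' ∂μ', Φ (act' h x', g • k) = act g (Φ (x', k))

/-- Data witnessing that two probability measure-preserving actions are virtually
conjugate. -/
structure VirtualConjugacyData
    (G₁ : Type) [Group G₁] (X₁ : Type) [MeasurableSpace X₁] [MulAction G₁ X₁] (μ₁ : Measure X₁)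
    (G₂ : Type) [Group G₂] (X₂ : Type) [MeasurableSpace X₂] [MulAction G₂ X₂] (μ₂ : Measure X₂) :
    Type 1 where
  F₁ : Subgroup G₁
  F₂ : Subgroup G₂
  normal₁ : F₁.Normal
  normal₂ : F₂.Normal
  finite₁ : Finite F₁
  finite₂ : Finite F₂
  K₁ : Subgroup (G₁ ⧸ F₁)
  K₂ : Subgroup (G₂ ⧸ F₂)
  finiteIndex₁ : K₁.FiniteIndex
  finiteIndex₂ : K₂.FiniteIndex
  X'₁ : Type
  X'₂ : Type
  mX'₁ : MeasurableSpace X'₁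
  mX'₂ : MeasurableSpace X'₂
  μ'₁ : Measure X'₁
  μ'₂ : Measure X'₂
  prob₁ : IsProbabilityMeasure μ'₁
  prob₂ : IsProbabilityMeasure μ'₂
  act₁ : ↥K₁ →* Equiv.Perm X'₁
  act₂ : ↥K₂ →* Equiv.Perm X'₂
  pmp₁ : ∀ k : ↥K₁, MeasurePreserving (act₁ k) μ'₁ μ'₁
  pmp₂ : ∀ k : ↥K₂, MeasurePreserving (act₂ k) μ'₂ μ'₂
  θ : ↥K₁ ≃* ↥K₂
  conjF : X'₁ → X'₂
  conjF_iso : MeasIso μ'₁ μ'₂ conjF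
  conjF_equivariant : ∀ k : ↥K₁, ∀ᵐ x ∂μ'₁, conjF (act₁ k x) = act₂ (θ k) (conjF x)
  Z₁ : Type
  Z₂ : Type
  mZ₁ : MeasurableSpace Z₁
  mZ₂ : MeasurableSpace Z₂
  ρ₁ : Measure Z₁
  ρ₂ : Measure Z₂
  qact₁ : G₁ ⧸ F₁ →* Equiv.Perm Z₁
  qact₂ : G₂ ⧸ F₂ →* Equiv.Perm Z₂
  qpmp₁ : ∀ g, MeasurePreserving (qact₁ g) ρ₁ ρ₁
  qpmp₂ : ∀ g, MeasurePreserving (qact₂ g) ρ₂ ρ₂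
  π₁ : X₁ → Z₁
  π₂ : X₂ → Z₂
  quot₁ : IsQuotientModel F₁ μ₁ qact₁ ρ₁ π₁
  quot₂ : IsQuotientModel F₂ μ₂ qact₂ ρ₂ π₂
  ind₁ : InducedFrom K₁ qact₁ ρ₁ act₁ μ'₁
  ind₂ : InducedFrom K₂ qact₂ ρ₂ act₂ μ'₂

/- ## Bernoulli actions -/

/-- The Bernoulli shift action of `G` on `G → A`. -/
instance bernoulliAction (G A : Type) [Group G] : MulAction G (G → A) where
  smul g x := fun h => x (g⁻¹ * h)
  one_smul x := funext fun h => by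
    show x (1⁻¹ * h) = x h
    rw [inv_one, one_mul]
  mul_smul g g' x := funext fun h => by
    show x ((g * g')⁻¹ * h) = x (g'⁻¹ * (g⁻¹ * h))
    rw [mul_inv_rev, mul_assoc]

/-- `μ` is the product (Bernoulli) measure on `G → A` with base `μ₀`:
it gives the product value to every cylinder set. -/
def IsBernoulliMeasure (G : Type) [Group G] {A : Type} [MeasurableSpace A]
    (μ₀ : Measure A) (μ : Measure (G → A)) : Prop :=
  ∀ (s : Finset G) (B : G → Set A), (∀ g : G, MeasurableSet (B g)) →
    μ {x : G → A | ∀ g ∈ s, x g ∈ B g} = ∏ g ∈ s, μ₀ (B g)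


/-- `𝓕`-ergodicity: every subgroup in the collection `𝓕` acts ergodically. -/
def FErgodic (G : Type) [Group G] (𝓕 : Set (Subgroup G)) (X : Type) [MeasurableSpace X]
    [MulAction G X] (μ : Measure X) : Prop :=
  ∀ A ∈ 𝓕, ErgodicSubgroup G A X μ

/-- Strong cocycle-rigidity of the pair `(G, 𝓕)`. -/
def StronglyCocycleRigid (G : Type) [Group G] (𝓕 : Set (Subgroup G)) : Prop :=
  ∀ (X : Type) [MeasurableSpace X] [StandardBorelSpace X] (μ : Measure X)
    (Y : Type) [MeasurableSpace Y] [StandardBorelSpace Y] (ν : Measure Y)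
    [IsProbabilityMeasure μ] [IsProbabilityMeasure ν]
    [MulAction G X] [MulAction G Y],
    PmpAction G X μ → FreeAction G X μ → ErgodicAction G X μ → FErgodic G 𝓕 X μ →
    PmpAction G Y ν → FreeAction G Y ν → ErgodicAction G Y ν → FErgodic G 𝓕 Y ν →
    ∀ f : StableOE G X G Y μ ν, ∀ c : G → X → G, f.IsSOECocycle c →
      ∃ α : G ≃* G, Cohomologous G X G μ c fun g _ => α g

set_option linter.unusedSectionVars false

section RaagBasics

variable {V : Type} {Γ : SimpleGraph V}

lemma gen_commute {u v : V} (h : Γ.Adj u v) : Commute (gen Γ u) (gen Γ v) := by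
  have h1 : (PresentedGroup.mk (raagRels Γ))
      (FreeGroup.of u * FreeGroup.of v * (FreeGroup.of u)⁻¹ * (FreeGroup.of v)⁻¹) = 1 :=
    PresentedGroup.one_of_mem ⟨u, v, h, rfl⟩
  simp only [map_mul, map_inv] at h1
  have h2 := mul_inv_eq_one.1 h1
  exact mul_inv_eq_iff_eq_mul.1 h2

/-- The universal property of a right-angled Artin group. -/
def raagLift {G : Type*} [Group G] (f : V → G)
    (h : ∀ u v, Γ.Adj u v → Commute (f u) (f v)) : RAAG Γ →* G :=
  PresentedGroup.toGroup (f := f) (by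
    rintro r ⟨u, v, huv, rfl⟩
    simp only [map_mul, map_inv, FreeGroup.lift_apply_of]
    rw [(h u v huv).eq]; group)

@[simp] lemma raagLift_gen {G : Type*} [Group G] (f : V → G)
    (h : ∀ u v, Γ.Adj u v → Commute (f u) (f v)) (v : V) :
    raagLift f h (gen Γ v) = f v :=
  PresentedGroup.toGroup.of _

lemma raag_hom_ext {G : Type*} [Group G] {φ ψ : RAAG Γ →* G}
    (h : ∀ v, φ (gen Γ v) = ψ (gen Γ v)) : φ = ψ :=
  PresentedGroup.ext h

lemma closure_range_gen : Subgroup.closure (Set.range (gen Γ)) = ⊤ :=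
  PresentedGroup.closure_range_of _

lemma raag_induction {p : RAAG Γ → Prop} (g : RAAG Γ) (one : p 1)
    (mul_gen : ∀ g v, p g → p (g * gen Γ v))
    (mul_gen_inv : ∀ g v, p g → p (g * (gen Γ v)⁻¹)) : p g := by
  have hg : g ∈ Subgroup.closure (Set.range (gen Γ)) := by
    rw [closure_range_gen]; trivial
  induction hg using Subgroup.closure_induction_right with
  | one => exact one
  | mul_right x _ y hy hx => obtain ⟨v, rfl⟩ := hy; exact mul_gen _ _ hx
  | mul_inv_cancel x _ y hy hx => obtain ⟨v, rfl⟩ := hy; exact mul_gen_inv _ _ hx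

instance countable_raag [Countable V] : Countable (RAAG Γ) :=
  (PresentedGroup.mk_surjective (raagRels Γ)).countable

lemma gen_mem_standardSub {S : Set V} {v : V} (h : v ∈ S) : gen Γ v ∈ standardSub Γ S :=
  Subgroup.subset_closure ⟨v, h, rfl⟩

lemma standardSub_mono {S T : Set V} (h : S ⊆ T) : standardSub Γ S ≤ standardSub Γ T :=
  Subgroup.closure_mono (Set.image_mono h)

lemma standardSub_univ : standardSub Γ Set.univ = ⊤ := by
  rw [standardSub, Set.image_univ, closure_range_gen]

lemma standardSub_empty : standardSub Γ ∅ = ⊥ := by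
  simp [standardSub]

lemma standardSub_induction {S : Set V} {p : RAAG Γ → Prop} {g : RAAG Γ}
    (hg : g ∈ standardSub Γ S) (one : p 1) (mul_gen : ∀ g, ∀ v ∈ S, p g → p (g * gen Γ v))
    (mul_gen_inv : ∀ g, ∀ v ∈ S, p g → p (g * (gen Γ v)⁻¹)) : p g := by
  induction hg using Subgroup.closure_induction_right with
  | one => exact one
  | mul_right x _ y hy hx => obtain ⟨v, hv, rfl⟩ := hy; exact mul_gen _ _ hv hx
  | mul_inv_cancel x _ y hy hx => obtain ⟨v, hv, rfl⟩ := hy; exact mul_gen_inv _ _ hv hx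

lemma standardSub_le_iff {S : Set V} {K : Subgroup (RAAG Γ)} :
    standardSub Γ S ≤ K ↔ ∀ v ∈ S, gen Γ v ∈ K := by
  rw [standardSub, Subgroup.closure_le]
  exact ⟨fun h v hv => h ⟨v, hv, rfl⟩, by rintro h _ ⟨v, hv, rfl⟩; exact h v hv⟩

open Classical in
/-- The retraction of a right-angled Artin group onto a standard subgroup. -/
noncomputable def retr (Γ : SimpleGraph V) (S : Set V) : RAAG Γ →* RAAG Γ :=
  raagLift (fun v => if v ∈ S then gen Γ v else 1) (by
    intro u v h
    split_ifs
    · exact gen_commute h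
    · exact Commute.one_right _
    · exact Commute.one_left _
    · exact Commute.one_left _)

lemma retr_gen_of_mem {S : Set V} {v : V} (h : v ∈ S) : retr Γ S (gen Γ v) = gen Γ v := by
  simp [retr, h]

lemma retr_gen_of_notMem {S : Set V} {v : V} (h : v ∉ S) : retr Γ S (gen Γ v) = 1 := by
  simp [retr, h]

lemma retr_of_mem {S : Set V} {g : RAAG Γ} (hg : g ∈ standardSub Γ S) : retr Γ S g = g := by
  have : standardSub Γ S ≤ (retr Γ S).eqLocus (MonoidHom.id _) :=
    standardSub_le_iff.2 fun v hv => retr_gen_of_mem hv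
  exact this hg

lemma retr_mem_inter {S T : Set V} {g : RAAG Γ} (hg : g ∈ standardSub Γ T) :
    retr Γ S g ∈ standardSub Γ (S ∩ T) := by
  have : standardSub Γ T ≤ (standardSub Γ (S ∩ T)).comap (retr Γ S) := by
    refine standardSub_le_iff.2 fun v hv => ?_
    rw [Subgroup.mem_comap]
    by_cases h : v ∈ S
    · rw [retr_gen_of_mem h]; exact gen_mem_standardSub ⟨h, hv⟩
    · rw [retr_gen_of_notMem h]; exact one_mem _
  exact this hg

lemma retr_mem (S : Set V) (g : RAAG Γ) : retr Γ S g ∈ standardSub Γ S := by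
  have := retr_mem_inter (S := S) (T := Set.univ) (g := g) (by rw [standardSub_univ]; trivial)
  rwa [Set.inter_univ] at this

/-- The link of a vertex. -/
def lk (Γ : SimpleGraph V) (v : V) : Set V := {u | Γ.Adj v u}

lemma lk_subset_compl (v : V) : lk Γ v ⊆ ({v}ᶜ : Set V) := by
  rintro u hu rfl
  exact Γ.loopless.irrefl _ hu

lemma commute_gen_of_mem_lk {v : V} {g : RAAG Γ} (hg : g ∈ standardSub Γ (lk Γ v)) :
    Commute (gen Γ v) g := by
  have : standardSub Γ (lk Γ v) ≤ Subgroup.centralizer {gen Γ v} :=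
    standardSub_le_iff.2 fun u hu => by
      rw [Subgroup.mem_centralizer_singleton_iff]
      exact (gen_commute hu).symm.eq
  exact ((Subgroup.mem_centralizer_singleton_iff.1 (this hg)).symm)

end RaagBasics

section Splitting

variable {V : Type} {Γ : SimpleGraph V}

/-- Cosets of the standard subgroup of the link of `v`. -/
abbrev LinkCoset (Γ : SimpleGraph V) (v : V) : Type := RAAG Γ ⧸ standardSub Γ (lk Γ v)

/-- The permutation of link cosets given by left multiplication. -/
def cosetPerm (Γ : SimpleGraph V) (v : V) : RAAG Γ →* Equiv.Perm (LinkCoset Γ v) :=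
  MulAction.toPermHom _ _

@[simp] lemma cosetPerm_apply (v : V) (g : RAAG Γ) (c : LinkCoset Γ v) :
    cosetPerm Γ v g c = g • c := rfl

/-- The automorphism of the free group on link cosets given by left multiplication. -/
def freeAct (Γ : SimpleGraph V) (v : V) : RAAG Γ →* MulAut (FreeGroup (LinkCoset Γ v)) where
  toFun g := FreeGroup.freeGroupCongr (cosetPerm Γ v g)
  map_one' := by
    rw [map_one]; exact FreeGroup.freeGroupCongr_refl
  map_mul' g h := by
    rw [map_mul]
    exact (FreeGroup.freeGroupCongr_trans _ _).symm

@[simp] lemma freeAct_of (v : V) (g : RAAG Γ) (c : LinkCoset Γ v) :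
    freeAct Γ v g (FreeGroup.of c) = FreeGroup.of (g • c) := by
  simp [freeAct, FreeGroup.freeGroupCongr]

open Classical in
/-- The splitting of a right-angled Artin group as a semidirect product with a free kernel. -/
noncomputable def spl (Γ : SimpleGraph V) (v : V) :
    RAAG Γ →* FreeGroup (LinkCoset Γ v) ⋊[freeAct Γ v] RAAG Γ :=
  raagLift (fun u => if u = v then
      SemidirectProduct.inl (FreeGroup.of ((1 : RAAG Γ) : LinkCoset Γ v))
    else SemidirectProduct.inr (gen Γ u)) (by
    have key : ∀ u, Γ.Adj v u → Commute
        (SemidirectProduct.inl (FreeGroup.of ((1 : RAAG Γ) : LinkCoset Γ v)) :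
          FreeGroup (LinkCoset Γ v) ⋊[freeAct Γ v] RAAG Γ) (SemidirectProduct.inr (gen Γ u)) := by
      intro u hu
      have h1 : gen Γ u • ((1 : RAAG Γ) : LinkCoset Γ v) = ((1 : RAAG Γ) : LinkCoset Γ v) := by
        change ((gen Γ u * 1 : RAAG Γ) : LinkCoset Γ v) = _
        rw [QuotientGroup.eq]
        simpa using inv_mem (gen_mem_standardSub (Γ := Γ) (S := lk Γ v) hu)
      have h2 := SemidirectProduct.inl_aut (φ := freeAct Γ v) (gen Γ u)
        (FreeGroup.of ((1 : RAAG Γ) : LinkCoset Γ v))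
      rw [freeAct_of, h1, map_inv] at h2
      exact eq_mul_inv_iff_mul_eq.1 h2
    intro u w h
    by_cases hu : u = v <;> by_cases hw : w = v
    · subst hu; subst hw; exact (Γ.loopless.irrefl _ h).elim
    · subst hu; simp only [if_true, hw, if_false]; exact key _ h
    · subst hw; simp only [if_true, hu, if_false]; exact (key _ h.symm).symm
    · simp only [hu, hw, if_false]
      exact (gen_commute h).map _)

lemma spl_gen_self (v : V) : spl Γ v (gen Γ v) =
    SemidirectProduct.inl (FreeGroup.of ((1 : RAAG Γ) : LinkCoset Γ v)) := by
  simp [spl]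

lemma spl_gen_of_ne {u v : V} (h : u ≠ v) : spl Γ v (gen Γ u) =
    SemidirectProduct.inr (gen Γ u) := by
  simp [spl, h]

lemma spl_right (v : V) (g : RAAG Γ) : (spl Γ v g).right = retr Γ {v}ᶜ g := by
  have : SemidirectProduct.rightHom.comp (spl Γ v) = retr Γ {v}ᶜ := by
    refine raag_hom_ext fun u => ?_
    by_cases h : u = v
    · subst h
      simp [spl_gen_self, retr_gen_of_notMem]
    · rw [retr_gen_of_mem (by simpa using h)]
      simp [spl_gen_of_ne h]
  exact DFunLike.congr_fun this g

lemma spl_of_mem {v : V} {g : RAAG Γ} (hg : g ∈ standardSub Γ {v}ᶜ) :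
    spl Γ v g = SemidirectProduct.inr g := by
  have : standardSub Γ {v}ᶜ ≤ (spl Γ v).eqLocus SemidirectProduct.inr :=
    standardSub_le_iff.2 fun u hu => spl_gen_of_ne (by simpa using hu)
  exact this hg

/-- The conjugates of `v` indexed by link cosets. -/
noncomputable def unsplLetter (Γ : SimpleGraph V) (v : V) (c : LinkCoset Γ v) : RAAG Γ :=
  Quotient.liftOn' c (fun g => retr Γ {v}ᶜ g * gen Γ v * (retr Γ {v}ᶜ g)⁻¹) (by
    intro a b hab
    rw [QuotientGroup.leftRel_apply] at hab
    have h1 : retr Γ {v}ᶜ (a⁻¹ * b) = a⁻¹ * b :=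
      retr_of_mem (standardSub_mono (lk_subset_compl v) hab)
    have h2 : retr Γ {v}ᶜ b = retr Γ {v}ᶜ a * (a⁻¹ * b) := by
      rw [← h1, ← map_mul]; congr 1; group
    have h3 := (commute_gen_of_mem_lk hab).eq
    simp only [h2]
    rw [mul_assoc (retr Γ {v}ᶜ a) (a⁻¹ * b) (gen Γ v), ← h3]
    group)

/-- A left inverse of the splitting. -/
noncomputable def unspl (Γ : SimpleGraph V) (v : V) :
    FreeGroup (LinkCoset Γ v) ⋊[freeAct Γ v] RAAG Γ →* RAAG Γ :=
  SemidirectProduct.lift (FreeGroup.lift (unsplLetter Γ v)) (retr Γ {v}ᶜ) (by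
    intro g
    refine FreeGroup.ext_hom _ _ fun c => ?_
    induction c using QuotientGroup.induction_on with
    | H a =>
      simp only [MonoidHom.comp_apply, MulEquiv.coe_toMonoidHom, freeAct_of,
        FreeGroup.lift_apply_of, MulAut.conj_apply]
      change retr Γ {v}ᶜ (g * a) * gen Γ v * (retr Γ {v}ᶜ (g * a))⁻¹ =
        retr Γ {v}ᶜ g * (retr Γ {v}ᶜ a * gen Γ v * (retr Γ {v}ᶜ a)⁻¹) * (retr Γ {v}ᶜ g)⁻¹
      rw [map_mul]; group)

lemma unspl_spl (v : V) (g : RAAG Γ) : unspl Γ v (spl Γ v g) = g := by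
  have : (unspl Γ v).comp (spl Γ v) = MonoidHom.id _ := by
    refine raag_hom_ext fun u => ?_
    by_cases h : u = v
    · subst h
      simp only [MonoidHom.comp_apply, spl_gen_self, unspl, SemidirectProduct.lift_inl,
        FreeGroup.lift_apply_of, MonoidHom.id_apply]
      change retr Γ _ 1 * gen Γ u * (retr Γ _ 1)⁻¹ = _
      simp
    · simp only [MonoidHom.comp_apply, spl_gen_of_ne h, unspl, SemidirectProduct.lift_inr,
        MonoidHom.id_apply]
      exact retr_gen_of_mem (by simpa using h)
  exact DFunLike.congr_fun this g

lemma spl_injective (v : V) : Function.Injective (spl Γ v) :=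
  Function.LeftInverse.injective (unspl_spl v)

end Splitting

section FreeGroupNorm

open Classical in
lemma norm_map_le {α β : Type*} (f : α → β) (x : FreeGroup α) :
    (FreeGroup.map f x).norm ≤ x.norm := by
  conv_lhs => rw [← FreeGroup.mk_toWord (x := x), FreeGroup.map.mk]
  exact FreeGroup.norm_mk_le.trans (by simp [FreeGroup.norm])

open Classical in
lemma toWord_map_of_injective {α β : Type*} {f : α → β} (hf : Function.Injective f)
    (x : FreeGroup α) :
    (FreeGroup.map f x).toWord = x.toWord.map fun a => (f a.1, a.2) := by
  conv_lhs => rw [← FreeGroup.mk_toWord (x := x), FreeGroup.map.mk, FreeGroup.toWord_mk]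
  refine FreeGroup.IsReduced.reduce_eq ?_
  have h := FreeGroup.isReduced_toWord (x := x)
  rw [FreeGroup.IsReduced] at h ⊢
  rw [List.isChain_map]
  exact h.imp fun a b hab h1 => hab (hf h1)

/-- The word norm of an element of a free group. -/
noncomputable def wordNorm {α : Type*} (x : FreeGroup α) : ℕ := open Classical in x.norm

lemma wordNorm_map_le {α β : Type*} (f : α → β) (x : FreeGroup α) :
    wordNorm (FreeGroup.map f x) ≤ wordNorm x := norm_map_le f x

lemma wordNorm_map_of_injective {α β : Type*} {f : α → β} (hf : Function.Injective f)
    (x : FreeGroup α) : wordNorm (FreeGroup.map f x) = wordNorm x := by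
  simp [wordNorm, FreeGroup.norm, toWord_map_of_injective hf]

lemma wordNorm_eq_zero {α : Type*} {x : FreeGroup α} : wordNorm x = 0 ↔ x = 1 :=
  open Classical in FreeGroup.norm_eq_zero

lemma wordNorm_inv {α : Type*} (x : FreeGroup α) : wordNorm x⁻¹ = wordNorm x :=
  open Classical in FreeGroup.norm_inv_eq

lemma wordNorm_mul_le {α : Type*} (x y : FreeGroup α) :
    wordNorm (x * y) ≤ wordNorm x + wordNorm y :=
  open Classical in FreeGroup.norm_mul_le x y

lemma wordNorm_of {α : Type*} (a : α) : wordNorm (FreeGroup.of a) = 1 :=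
  open Classical in FreeGroup.norm_of a

/-- The first letter of a reduced word. -/
noncomputable def firstLetter {α : Type*} (x : FreeGroup α) : Option (α × Bool) :=
  open Classical in x.toWord.head?

lemma firstLetter_map {α β : Type*} {f : α → β} (hf : Function.Injective f)
    (x : FreeGroup α) :
    firstLetter (FreeGroup.map f x) = (firstLetter x).map fun a => (f a.1, a.2) := by
  simp [firstLetter, toWord_map_of_injective hf]

open Classical in
lemma toWord_letter_mul {α : Type*} (a : α × Bool) (x : FreeGroup α)
    (h : firstLetter x ≠ some (a.1, !a.2)) :
    (FreeGroup.mk [a] * x).toWord = a :: x.toWord := by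
  conv_lhs => rw [← FreeGroup.mk_toWord (x := x), FreeGroup.mul_mk, FreeGroup.toWord_mk]
  refine FreeGroup.IsReduced.reduce_eq (List.isChain_append.2
    ⟨List.isChain_singleton _, FreeGroup.isReduced_toWord, ?_⟩)
  rintro b hb c hc h1
  simp only [List.getLast?_singleton, Option.mem_def, Option.some.injEq] at hb
  subst hb
  simp only [firstLetter, ne_eq] at h
  rw [Option.mem_def] at hc
  rw [hc] at h
  obtain ⟨c1, c2⟩ := c
  obtain ⟨a1, a2⟩ := a
  simp only [Option.some.injEq, Prod.mk.injEq, not_and] at h h1 ⊢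
  have := h h1.symm
  cases a2 <;> cases c2 <;> simp_all

lemma firstLetter_letter_mul {α : Type*} (a : α × Bool) (x : FreeGroup α)
    (h : firstLetter x ≠ some (a.1, !a.2)) :
    firstLetter (FreeGroup.mk [a] * x) = some a := by
  simp [firstLetter, toWord_letter_mul a x h]

open Classical in
lemma exists_letter_shortening {α : Type*} (g : FreeGroup α) (hg : g ≠ 1) :
    ∃ s : FreeGroup α, ∀ (f : FreeGroup α) (R : ℕ), wordNorm f ≤ R → wordNorm (g⁻¹ * f) ≤ R →
      wordNorm f < R ∨ wordNorm (s⁻¹ * f) < R := by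
  simp only [wordNorm]
  have hne : g.toWord ≠ [] := by simpa [FreeGroup.toWord_eq_nil_iff] using hg
  obtain ⟨a, l, hal⟩ := List.exists_cons_of_ne_nil hne
  refine ⟨FreeGroup.mk [a], fun f R h1 h2 => ?_⟩
  by_cases hf : firstLetter f = some a
  · right
    obtain ⟨l', hl'⟩ : ∃ l', f.toWord = a :: l' := by
      rw [firstLetter, List.head?_eq_some_iff] at hf; exact hf
    have hfm : f = FreeGroup.mk [a] * FreeGroup.mk l' := by
      rw [FreeGroup.mul_mk, List.singleton_append, ← hl', FreeGroup.mk_toWord]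
    have hle : ((FreeGroup.mk [a])⁻¹ * f).norm ≤ l'.length := by
      rw [hfm, inv_mul_cancel_left]; exact FreeGroup.norm_mk_le
    have : f.norm = l'.length + 1 := by simp [FreeGroup.norm, hl']
    omega
  · left
    have hgt : (g⁻¹ * f).toWord = FreeGroup.invRev g.toWord ++ f.toWord := by
      have : g⁻¹ * f = FreeGroup.mk (FreeGroup.invRev g.toWord ++ f.toWord) := by
        rw [← FreeGroup.mul_mk, ← FreeGroup.toWord_inv, FreeGroup.mk_toWord, FreeGroup.mk_toWord]
      rw [this, FreeGroup.toWord_mk]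
      refine FreeGroup.IsReduced.reduce_eq (List.isChain_append.2
        ⟨?_, FreeGroup.isReduced_toWord, ?_⟩)
      · rw [← FreeGroup.toWord_inv]; exact FreeGroup.isReduced_toWord
      · intro b hb c hc h3
        rw [hal] at hb
        simp only [FreeGroup.invRev, List.map_cons, List.reverse_cons,
          List.getLast?_append, List.getLast?_singleton, Option.some_or, Option.mem_def,
          Option.some.injEq] at hb
        subst hb
        rw [Option.mem_def] at hc
        have : c ≠ a := by
          rintro rfl; exact hf hc
        obtain ⟨c1, c2⟩ := c
        obtain ⟨a1, a2⟩ := a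
        simp only at h3 ⊢
        subst h3
        cases a2 <;> cases c2 <;> simp_all
    have : (g⁻¹ * f).norm = g.toWord.length + f.norm := by
      simp [FreeGroup.norm, hgt, FreeGroup.invRev]
    rw [hal] at this
    simp only [List.length_cons] at this
    omega

end FreeGroupNorm

section VertexLength

variable {V : Type} {Γ : SimpleGraph V}

/-- The number of occurrences of `v^{±1}` in a shortest word: the length of the free part. -/
noncomputable def vlen (Γ : SimpleGraph V) (v : V) (h : RAAG Γ) : ℕ :=
  wordNorm (spl Γ v h).left

lemma freeAct_eq_map (v : V) (g : RAAG Γ) (x : FreeGroup (LinkCoset Γ v)) :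
    freeAct Γ v g x = FreeGroup.map (g • ·) x := rfl

lemma smul_linkCoset_injective (v : V) (g : RAAG Γ) :
    Function.Injective (fun c : LinkCoset Γ v => g • c) := MulAction.injective g

lemma wordNorm_freeAct (v : V) (g : RAAG Γ) (x : FreeGroup (LinkCoset Γ v)) :
    wordNorm (freeAct Γ v g x) = wordNorm x :=
  wordNorm_map_of_injective (smul_linkCoset_injective v g) x

lemma vlen_eq_zero {v : V} {h : RAAG Γ} : vlen Γ v h = 0 ↔ h ∈ standardSub Γ {v}ᶜ := by
  constructor
  · intro h0
    rw [vlen, wordNorm_eq_zero] at h0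
    have : retr Γ {v}ᶜ h = h := by
      apply spl_injective v
      rw [spl_of_mem (retr_mem _ _)]
      refine SemidirectProduct.ext ?_ ?_
      · rw [h0]; rfl
      · rw [spl_right]; rfl
    rw [← this]; exact retr_mem _ _
  · intro hh
    rw [vlen, spl_of_mem hh, wordNorm_eq_zero]; rfl

lemma vlen_mul_right {v : V} {h p : RAAG Γ} (hp : p ∈ standardSub Γ {v}ᶜ) :
    vlen Γ v (h * p) = vlen Γ v h := by
  simp [vlen, spl_of_mem hp]

lemma vlen_mul_left {v : V} {h p : RAAG Γ} (hp : p ∈ standardSub Γ {v}ᶜ) :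
    vlen Γ v (p * h) = vlen Γ v h := by
  simp [vlen, spl_of_mem hp, wordNorm_freeAct]

lemma vlen_inv (v : V) (h : RAAG Γ) : vlen Γ v h⁻¹ = vlen Γ v h := by
  rw [vlen, map_inv, SemidirectProduct.inv_left, wordNorm_freeAct, wordNorm_inv, vlen]

lemma vlen_mul_le (v : V) (g h : RAAG Γ) : vlen Γ v (g * h) ≤ vlen Γ v g + vlen Γ v h := by
  simp only [vlen, map_mul, SemidirectProduct.mul_left]
  exact (wordNorm_mul_le _ _).trans (by rw [wordNorm_freeAct])

lemma vlen_gen_self (v : V) : vlen Γ v (gen Γ v) = 1 := by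
  simp [vlen, spl_gen_self, wordNorm_of]

/-- The map on link cosets induced by the retraction. -/
noncomputable def linkRetr (Γ : SimpleGraph V) (v : V) (c : LinkCoset Γ v) : LinkCoset Γ v :=
  Quotient.liftOn' c (fun g => ((retr Γ {v}ᶜ g : RAAG Γ) : LinkCoset Γ v)) (by
    intro a b hab
    rw [QuotientGroup.leftRel_apply] at hab
    rw [QuotientGroup.eq, ← map_inv, ← map_mul,
      retr_of_mem (standardSub_mono (lk_subset_compl v) hab)]
    exact hab)

lemma spl_unspl_left (v : V) (f : FreeGroup (LinkCoset Γ v)) :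
    spl Γ v (unspl Γ v (SemidirectProduct.inl f)) =
      SemidirectProduct.inl (FreeGroup.map (linkRetr Γ v) f) := by
  have : ((spl Γ v).comp (unspl Γ v)).comp SemidirectProduct.inl =
      SemidirectProduct.inl.comp (FreeGroup.map (linkRetr Γ v)) := by
    refine FreeGroup.ext_hom _ _ fun c => ?_
    induction c using QuotientGroup.induction_on with
    | H a =>
      simp only [MonoidHom.comp_apply, unspl, SemidirectProduct.lift_inl,
        FreeGroup.lift_apply_of, FreeGroup.map.of]
      change spl Γ v (retr Γ {v}ᶜ a * gen Γ v * (retr Γ {v}ᶜ a)⁻¹) = _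
      rw [map_mul, map_mul, map_inv, spl_of_mem (retr_mem _ _), spl_gen_self, ← map_inv,
        ← SemidirectProduct.inl_aut, freeAct_of]
      congr 2
      change ((retr Γ {v}ᶜ a * 1 : RAAG Γ) : LinkCoset Γ v) = _
      rw [mul_one]; rfl
  exact DFunLike.congr_fun this f

lemma map_linkRetr_spl (v : V) (h : RAAG Γ) :
    FreeGroup.map (linkRetr Γ v) (spl Γ v h).left = (spl Γ v h).left := by
  have h1 : spl Γ v (unspl Γ v (SemidirectProduct.inl (spl Γ v h).left *
      SemidirectProduct.inr (spl Γ v h).right)) = spl Γ v h := by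
    rw [SemidirectProduct.inl_left_mul_inr_right, unspl_spl]
  rw [map_mul, map_mul, spl_unspl_left] at h1
  have h2 := congrArg SemidirectProduct.left h1
  have h3 : (spl Γ v (unspl Γ v (SemidirectProduct.inr (spl Γ v h).right))).left = 1 := by
    rw [unspl, SemidirectProduct.lift_inr, spl_of_mem (retr_mem _ _)]; rfl
  simpa only [SemidirectProduct.mul_left, SemidirectProduct.left_inl, h3, map_one, mul_one] using h2

/-- Two distinct balls of the same radius in the tree are separated: their intersection lies in
smaller balls. -/
lemma vlen_ball_separation {v : V} {t : RAAG Γ} (ht : t ∉ standardSub Γ {v}ᶜ) :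
    ∃ s : RAAG Γ, ∀ (h : RAAG Γ) (R : ℕ), vlen Γ v h ≤ R → vlen Γ v (t⁻¹ * h) ≤ R →
      vlen Γ v h < R ∨ vlen Γ v (s⁻¹ * h) < R := by
  have hg : (spl Γ v t).left ≠ 1 := by
    intro h
    apply ht
    rw [← vlen_eq_zero, vlen, wordNorm_eq_zero, h]
  obtain ⟨s, hs⟩ := exists_letter_shortening _ hg
  refine ⟨unspl Γ v (SemidirectProduct.inl s), fun h R h1 h2 => ?_⟩
  have e1 : vlen Γ v (t⁻¹ * h) = wordNorm ((spl Γ v t).left⁻¹ * (spl Γ v h).left) := by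
    rw [vlen, map_mul, map_inv, SemidirectProduct.mul_left, SemidirectProduct.inv_left,
      SemidirectProduct.inv_right, ← map_mul, wordNorm_freeAct]
  rw [e1] at h2
  rcases hs _ R h1 h2 with h3 | h3
  · exact Or.inl h3
  · right
    refine lt_of_le_of_lt ?_ h3
    rw [vlen, map_mul, map_inv, spl_unspl_left, SemidirectProduct.mul_left,
      SemidirectProduct.inv_left]
    simp only [SemidirectProduct.left_inl, SemidirectProduct.right_inl, inv_one, map_one,
      SemidirectProduct.inv_right, MulAut.one_apply]
    conv_lhs => rw [← map_linkRetr_spl v h, ← map_inv, ← map_mul]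
    exact wordNorm_map_le _ _

end VertexLength

section LinkCocycle

variable {V : Type} {Γ : SimpleGraph V}

/-- Translation of finitely supported functions on link cosets. -/
noncomputable def finsuppAct (Γ : SimpleGraph V) (v : V) (g : RAAG Γ) :
    (LinkCoset Γ v →₀ ℤ) →+ (LinkCoset Γ v →₀ ℤ) :=
  Finsupp.mapDomain.addMonoidHom (g • ·)

lemma finsuppAct_apply_smul (v : V) (g : RAAG Γ) (f : LinkCoset Γ v →₀ ℤ) (c : LinkCoset Γ v) :
    finsuppAct Γ v g f (g • c) = f c :=
  Finsupp.mapDomain_apply (smul_linkCoset_injective v g) f c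

lemma finsuppAct_apply (v : V) (g : RAAG Γ) (f : LinkCoset Γ v →₀ ℤ) (c : LinkCoset Γ v) :
    finsuppAct Γ v g f c = f (g⁻¹ • c) := by
  conv_lhs => rw [← smul_inv_smul g c, finsuppAct_apply_smul]

lemma finsuppAct_mul (v : V) (g h : RAAG Γ) (f : LinkCoset Γ v →₀ ℤ) :
    finsuppAct Γ v (g * h) f = finsuppAct Γ v g (finsuppAct Γ v h f) := by
  ext c; simp [finsuppAct_apply, mul_smul]

lemma finsuppAct_one (v : V) (f : LinkCoset Γ v →₀ ℤ) : finsuppAct Γ v 1 f = f := by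
  ext c; simp [finsuppAct_apply]

lemma finsuppAct_single (v : V) (g h : RAAG Γ) (n : ℤ) :
    finsuppAct Γ v g (Finsupp.single ((h : RAAG Γ) : LinkCoset Γ v) n) =
      Finsupp.single ((g * h : RAAG Γ) : LinkCoset Γ v) n :=
  Finsupp.mapDomain_single

/-- Affine permutations of the finitely supported functions. -/
noncomputable def affinePerm (Γ : SimpleGraph V) (v : V) (a : LinkCoset Γ v →₀ ℤ) (g : RAAG Γ) :
    Equiv.Perm (LinkCoset Γ v →₀ ℤ) where
  toFun f := a + finsuppAct Γ v g f
  invFun f := finsuppAct Γ v g⁻¹ (f - a)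
  left_inv f := by simp [← finsuppAct_mul, finsuppAct_one]
  right_inv f := by simp [← finsuppAct_mul, finsuppAct_one]

open Classical in
/-- The affine action defining the cocycle. -/
noncomputable def affineHom (Γ : SimpleGraph V) (v : V) :
    RAAG Γ →* Equiv.Perm (LinkCoset Γ v →₀ ℤ) :=
  raagLift (fun u => affinePerm Γ v
      (if u = v then Finsupp.single ((1 : RAAG Γ) : LinkCoset Γ v) 1 else 0) (gen Γ u)) (by
    have key : ∀ a b : RAAG Γ, ∀ x y : LinkCoset Γ v →₀ ℤ, Commute a b →
        x + finsuppAct Γ v a y = y + finsuppAct Γ v b x →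
        Commute (affinePerm Γ v x a) (affinePerm Γ v y b) := by
      intro a b x y hab h
      refine Equiv.ext fun f => ?_
      change x + finsuppAct Γ v a (y + finsuppAct Γ v b f) =
        y + finsuppAct Γ v b (x + finsuppAct Γ v a f)
      rw [map_add, map_add, ← finsuppAct_mul, ← finsuppAct_mul, hab.eq, ← add_assoc, h, add_assoc]
    have h1 : ∀ u, Γ.Adj v u → finsuppAct Γ v (gen Γ u)
        (Finsupp.single ((1 : RAAG Γ) : LinkCoset Γ v) 1) =
        Finsupp.single ((1 : RAAG Γ) : LinkCoset Γ v) 1 := by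
      intro u hu
      rw [finsuppAct_single]
      congr 1
      rw [QuotientGroup.eq]
      simpa using gen_mem_standardSub (Γ := Γ) (S := lk Γ v) hu
    intro u w huw
    refine key _ _ _ _ (gen_commute huw) ?_
    by_cases hu : u = v <;> by_cases hw : w = v
    · subst hu; subst hw; exact (Γ.loopless.irrefl _ huw).elim
    · subst hu; simp [hw, h1 _ huw]
    · subst hw; simp [hu, h1 _ huw.symm]
    · simp [hu, hw])

/-- The `ℓ¹`-cocycle on link cosets counting (with sign) the occurrences of `v`. -/
noncomputable def linkCocycle (Γ : SimpleGraph V) (v : V) (g : RAAG Γ) : LinkCoset Γ v →₀ ℤ :=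
  affineHom Γ v g 0

lemma affineHom_apply (v : V) (g : RAAG Γ) (f : LinkCoset Γ v →₀ ℤ) :
    affineHom Γ v g f = linkCocycle Γ v g + finsuppAct Γ v g f := by
  have hgen : ∀ u f', affineHom Γ v (gen Γ u) f' =
      linkCocycle Γ v (gen Γ u) + finsuppAct Γ v (gen Γ u) f' := by
    intro u f'
    simp [linkCocycle, affineHom, affinePerm]
  induction g using raag_induction generalizing f with
  | one => simp [linkCocycle, finsuppAct_one]
  | mul_gen g u ih =>
    rw [linkCocycle, map_mul, Equiv.Perm.mul_apply, Equiv.Perm.mul_apply, ih, ih, hgen, hgen,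
      finsuppAct_mul]
    simp [add_assoc]
  | mul_gen_inv g u ih =>
    have hinv : ∀ f', affineHom Γ v (gen Γ u)⁻¹ f' =
        linkCocycle Γ v (gen Γ u)⁻¹ + finsuppAct Γ v (gen Γ u)⁻¹ f' := by
      have aux : ∀ f', affineHom Γ v (gen Γ u)⁻¹ f' =
          finsuppAct Γ v (gen Γ u)⁻¹ (f' - linkCocycle Γ v (gen Γ u)) := by
        intro f'
        rw [map_inv, Equiv.Perm.inv_eq_iff_eq, hgen, ← finsuppAct_mul]
        simp [finsuppAct_one]
      intro f'
      rw [linkCocycle, aux, aux, map_sub, map_sub]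
      simp only [map_zero]
      abel
    rw [linkCocycle, map_mul, Equiv.Perm.mul_apply, Equiv.Perm.mul_apply, ih, ih, hinv, hinv,
      finsuppAct_mul]
    simp [add_assoc]

lemma linkCocycle_mul (v : V) (g h : RAAG Γ) :
    linkCocycle Γ v (g * h) = linkCocycle Γ v g + finsuppAct Γ v g (linkCocycle Γ v h) := by
  rw [linkCocycle, map_mul, Equiv.Perm.mul_apply, affineHom_apply]; rfl

lemma linkCocycle_one (v : V) : linkCocycle Γ v 1 = 0 := by
  simp [linkCocycle]

lemma linkCocycle_inv (v : V) (g : RAAG Γ) :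
    linkCocycle Γ v g⁻¹ = - finsuppAct Γ v g⁻¹ (linkCocycle Γ v g) := by
  have := linkCocycle_mul v g⁻¹ g
  rw [inv_mul_cancel, linkCocycle_one] at this
  exact (neg_eq_of_add_eq_zero_left this.symm).symm

lemma linkCocycle_gen_self (v : V) :
    linkCocycle Γ v (gen Γ v) = Finsupp.single ((1 : RAAG Γ) : LinkCoset Γ v) 1 := by
  simp [linkCocycle, affineHom, affinePerm]

lemma linkCocycle_gen_of_ne {u v : V} (h : u ≠ v) : linkCocycle Γ v (gen Γ u) = 0 := by
  simp [linkCocycle, affineHom, affinePerm, h]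

/-- The increment of `vlen` along an edge of the tree. -/
noncomputable def edgeWeight (Γ : SimpleGraph V) (v : V) (c : LinkCoset Γ v) : ℤ :=
  Quotient.liftOn' c (fun g => (vlen Γ v (g * gen Γ v) : ℤ) - vlen Γ v g) (by
    intro a b hab
    rw [QuotientGroup.leftRel_apply] at hab
    have hm := standardSub_mono (lk_subset_compl v) hab
    have h1 : b = a * (a⁻¹ * b) := by group
    have h2 : b * gen Γ v = a * gen Γ v * (a⁻¹ * b) := by
      rw [mul_assoc a, (commute_gen_of_mem_lk hab).eq]; group
    rw [h2, vlen_mul_right hm]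
    conv_rhs => rw [h1, vlen_mul_right hm])

lemma edgeWeight_natAbs_le (v : V) (c : LinkCoset Γ v) : (edgeWeight Γ v c).natAbs ≤ 1 := by
  induction c using QuotientGroup.induction_on with
  | H g =>
    change ((vlen Γ v (g * gen Γ v) : ℤ) - vlen Γ v g).natAbs ≤ 1
    have h1 := vlen_mul_le v g (gen Γ v)
    have h2 := vlen_mul_le v (g * gen Γ v) (gen Γ v)⁻¹
    rw [vlen_inv] at h2
    rw [vlen_gen_self] at h1 h2
    rw [mul_inv_cancel_right] at h2
    omega

/-- The linear extension of `edgeWeight`. -/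
noncomputable def edgeSum (Γ : SimpleGraph V) (v : V) : (LinkCoset Γ v →₀ ℤ) →ₗ[ℤ] ℤ :=
  Finsupp.linearCombination ℤ (edgeWeight Γ v)

lemma edgeSum_linkCocycle (v : V) (g : RAAG Γ) :
    edgeSum Γ v (linkCocycle Γ v g) = vlen Γ v g := by
  have h0 : vlen Γ v (1 : RAAG Γ) = 0 := vlen_eq_zero.2 (one_mem _)
  have hs : ∀ h : RAAG Γ, edgeSum Γ v (Finsupp.single ((h : RAAG Γ) : LinkCoset Γ v) 1) =
      (vlen Γ v (h * gen Γ v) : ℤ) - vlen Γ v h := by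
    intro h
    rw [edgeSum, Finsupp.linearCombination_single, one_smul]; rfl
  induction g using raag_induction with
  | one => simp [linkCocycle_one, h0]
  | mul_gen g u ih =>
    rw [linkCocycle_mul, map_add, ih]
    by_cases hu : u = v
    · subst hu
      rw [linkCocycle_gen_self, finsuppAct_single, mul_one, hs]; ring
    · rw [linkCocycle_gen_of_ne hu, map_zero, map_zero, add_zero,
        vlen_mul_right (gen_mem_standardSub (by simpa using hu))]
  | mul_gen_inv g u ih =>
    rw [linkCocycle_mul, map_add, ih, linkCocycle_inv]
    by_cases hu : u = v
    · subst hu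
      rw [linkCocycle_gen_self, finsuppAct_single, mul_one, map_neg, map_neg, finsuppAct_single,
        hs, inv_mul_cancel_right]; ring
    · rw [linkCocycle_gen_of_ne hu, map_zero, neg_zero, map_zero, map_zero, add_zero,
        vlen_mul_right (inv_mem (gen_mem_standardSub (by simpa using hu)))]

/-- The `ℓ¹`-norm. -/
noncomputable def finsuppNorm {E : Type*} (f : E →₀ ℤ) : ℕ := f.sum fun _ z => z.natAbs

lemma vlen_le_finsuppNorm (v : V) (g : RAAG Γ) :
    vlen Γ v g ≤ finsuppNorm (linkCocycle Γ v g) := by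
  have h1 : ((vlen Γ v g : ℕ) : ℤ).natAbs = vlen Γ v g := Int.natAbs_natCast _
  rw [← h1, ← edgeSum_linkCocycle, edgeSum, Finsupp.linearCombination_apply, finsuppNorm,
    Finsupp.sum, Finsupp.sum]
  refine (Finset.le_sum_of_subadditive Int.natAbs (by simp) Int.natAbs_add_le _ _).trans
    (Finset.sum_le_sum fun c _ => ?_)
  rw [smul_eq_mul, Int.natAbs_mul]
  exact (Nat.mul_le_mul_left _ (edgeWeight_natAbs_le v c)).trans (by simp)

end LinkCocycle

section FirstLetter

variable {V : Type} {Γ : SimpleGraph V}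

/-- First letter of the free part. -/
noncomputable def vfirst (Γ : SimpleGraph V) (v : V) (h : RAAG Γ) :
    Option (LinkCoset Γ v × Bool) := firstLetter (spl Γ v h).left

lemma vfirst_mul_right {v : V} {h p : RAAG Γ} (hp : p ∈ standardSub Γ {v}ᶜ) :
    vfirst Γ v (h * p) = vfirst Γ v h := by
  simp [vfirst, spl_of_mem hp]

lemma vfirst_mul_left {v : V} {h p : RAAG Γ} (hp : p ∈ standardSub Γ {v}ᶜ) :
    vfirst Γ v (p * h) = (vfirst Γ v h).map fun a => (p • a.1, a.2) := by
  rw [vfirst, map_mul, spl_of_mem hp, SemidirectProduct.mul_left]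
  simp only [SemidirectProduct.left_inr, SemidirectProduct.right_inr, one_mul, freeAct_eq_map]
  exact firstLetter_map (smul_linkCoset_injective v p) _

lemma vfirst_gen_mul {v : V} {h : RAAG Γ}
    (hh : vfirst Γ v h ≠ some (((1 : RAAG Γ) : LinkCoset Γ v), false)) :
    vfirst Γ v (gen Γ v * h) = some (((1 : RAAG Γ) : LinkCoset Γ v), true) := by
  rw [vfirst, map_mul, spl_gen_self, SemidirectProduct.mul_left]
  simp only [SemidirectProduct.left_inl, SemidirectProduct.right_inl, map_one, MulAut.one_apply]
  exact firstLetter_letter_mul (((1 : RAAG Γ) : LinkCoset Γ v), true) _ hh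

lemma vfirst_gen_inv_mul {v : V} {h : RAAG Γ}
    (hh : vfirst Γ v h ≠ some (((1 : RAAG Γ) : LinkCoset Γ v), true)) :
    vfirst Γ v ((gen Γ v)⁻¹ * h) = some (((1 : RAAG Γ) : LinkCoset Γ v), false) := by
  rw [vfirst, map_mul, map_inv, spl_gen_self, ← map_inv, SemidirectProduct.mul_left]
  simp only [SemidirectProduct.left_inl, SemidirectProduct.right_inl, map_one, MulAut.one_apply]
  exact firstLetter_letter_mul (((1 : RAAG Γ) : LinkCoset Γ v), false) _ hh

end FirstLetter

section Ed

/-- The distance of two extended nonnegative numbers. -/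
noncomputable def ed (a b : ℝ≥0∞) : ℝ≥0∞ := (a - b) + (b - a)

lemma ed_comm (a b : ℝ≥0∞) : ed a b = ed b a := add_comm _ _

@[simp] lemma ed_self (a : ℝ≥0∞) : ed a a = 0 := by simp [ed]

lemma le_add_ed (a b : ℝ≥0∞) : a ≤ b + ed a b := by
  have : a ≤ b + (a - b) := le_add_tsub
  exact this.trans (by gcongr; exact le_self_add)

lemma le_add_ed' (a b : ℝ≥0∞) : a ≤ b + ed b a := by rw [ed_comm]; exact le_add_ed a b

lemma ed_le_add (a b : ℝ≥0∞) : ed a b ≤ a + b := add_le_add tsub_le_self tsub_le_self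

lemma ed_triangle (a b c : ℝ≥0∞) : ed a c ≤ ed a b + ed b c := by
  have h1 : a - c ≤ (a - b) + (b - c) := tsub_le_tsub_add_tsub
  have h2 : c - a ≤ (c - b) + (b - a) := tsub_le_tsub_add_tsub
  calc ed a c ≤ ((a - b) + (b - c)) + ((c - b) + (b - a)) := add_le_add h1 h2
    _ = ed a b + ed b c := by unfold ed; ring

lemma ed_tsum_le {ι : Type*} (f g : ι → ℝ≥0∞) :
    ed (∑' i, f i) (∑' i, g i) ≤ ∑' i, ed (f i) (g i) := by
  have h : ∀ f g : ι → ℝ≥0∞, (∑' i, f i) - ∑' i, g i ≤ ∑' i, (f i - g i) := by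
    intro f g
    rw [tsub_le_iff_left, ← ENNReal.tsum_add]
    exact ENNReal.tsum_le_tsum fun i => le_add_tsub
  unfold ed
  rw [ENNReal.tsum_add]
  exact add_le_add (h f g) (h g f)

lemma ed_mul_left {a : ℝ≥0∞} (ha : a ≠ ∞) (b c : ℝ≥0∞) : ed (a * b) (a * c) = a * ed b c := by
  unfold ed
  rw [mul_add, ENNReal.mul_sub fun _ _ => ha, ENNReal.mul_sub fun _ _ => ha]

lemma ed_mul_right {a : ℝ≥0∞} (ha : a ≠ ∞) (b c : ℝ≥0∞) : ed (b * a) (c * a) = ed b c * a := by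
  rw [mul_comm b, mul_comm c, ed_mul_left ha, mul_comm]

lemma _root_.Measurable.ed {α : Type*} [MeasurableSpace α] {f g : α → ℝ≥0∞}
    (hf : Measurable f) (hg : Measurable g) : Measurable fun x => OEPaper.ed (f x) (g x) :=
  (hf.sub hg).add (hg.sub hf)

lemma ed_lintegral_le {α : Type*} [MeasurableSpace α] {μ : Measure α} {f g : α → ℝ≥0∞}
    (hf : Measurable f) (hg : Measurable g) :
    ed (∫⁻ x, f x ∂μ) (∫⁻ x, g x ∂μ) ≤ ∫⁻ x, ed (f x) (g x) ∂μ := by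
  unfold ed
  rw [lintegral_add_left (f := fun x => f x - g x) (hf.sub hg)]
  exact add_le_add (lintegral_sub_le' g f hg.aemeasurable)
    (lintegral_sub_le' f g hf.aemeasurable)

end Ed

section NoInvariantProbability

variable {V : Type} {Γ : SimpleGraph V}

open Classical in
lemma tsum_ite_le_of_smul {G D : Type*} [Group G] [MulAction G D] (Z : D → ℝ≥0∞) (g : G)
    {ε : ℝ≥0∞} (hZ : ∑' d, ed (Z (g • d)) (Z d) ≤ ε) {A B : D → Prop}
    (hAB : ∀ d, A d → B (g • d)) :
    (∑' d, if A d then Z d else 0) ≤ (∑' d, if B d then Z d else 0) + ε := by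
  calc (∑' d, if A d then Z d else 0)
      ≤ ∑' d, ((if B (g • d) then Z (g • d) else 0) + ed (Z (g • d)) (Z d)) := by
        refine ENNReal.tsum_le_tsum fun d => ?_
        split_ifs with h1 h2
        · exact le_add_ed' _ _
        · exact (h2 (hAB d h1)).elim
        · simp
        · simp
    _ = (∑' d, if B (g • d) then Z (g • d) else 0) + ∑' d, ed (Z (g • d)) (Z d) :=
        ENNReal.tsum_add
    _ ≤ _ := by
        refine add_le_add (le_of_eq ?_) hZ
        exact (MulAction.toPerm g).tsum_eq fun d => if B d then Z d else 0

lemma tsum_ed_smul_inv {G D : Type*} [Group G] [MulAction G D] (Z : D → ℝ≥0∞) (g : G) :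
    ∑' d, ed (Z (g⁻¹ • d)) (Z d) = ∑' d, ed (Z (g • d)) (Z d) := by
  rw [← (MulAction.toPerm g).tsum_eq fun d => ed (Z (g⁻¹ • d)) (Z d)]
  refine tsum_congr fun d => ?_
  simp only [MulAction.toPerm_apply, inv_smul_smul]
  exact ed_comm _ _

/-- `vfirst` as a function on cosets of a standard subgroup not containing `v`. -/
noncomputable def cosetFirst (Γ : SimpleGraph V) (v : V) {U : Set V} (hv : v ∉ U)
    (d : RAAG Γ ⧸ standardSub Γ U) : Option (LinkCoset Γ v × Bool) :=
  Quotient.liftOn' d (vfirst Γ v) (by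
    intro a b hab
    rw [QuotientGroup.leftRel_apply] at hab
    have hm : a⁻¹ * b ∈ standardSub Γ {v}ᶜ := standardSub_mono (by
      intro u hu
      simp only [Set.mem_compl_iff, Set.mem_singleton_iff]
      rintro rfl; exact hv hu) hab
    have h1 : b = a * (a⁻¹ * b) := by group
    rw [h1, vfirst_mul_right hm])

/-- Two non-commuting generators have no almost invariant probabilities on the cosets of a
standard subgroup missing one of them. -/
theorem no_almost_invariant {v v' : V} (hne : v' ≠ v) (hadj : ¬ Γ.Adj v v') {U : Set V}
    (hvU : v ∉ U) (Z : RAAG Γ ⧸ standardSub Γ U → ℝ≥0∞) (hZ : ∑' d, Z d = 1)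
    (h1 : ∑' d, ed (Z (gen Γ v • d)) (Z d) ≤ ENNReal.ofReal (1 / 10))
    (h2 : ∑' d, ed (Z (gen Γ v' • d)) (Z d) ≤ ENNReal.ofReal (1 / 10)) : False := by
  classical
  set ℓ := cosetFirst Γ v hvU with hℓ
  set o : LinkCoset Γ v := ((1 : RAAG Γ) : LinkCoset Γ v) with ho
  set S : (RAAG Γ ⧸ standardSub Γ U → Prop) → ℝ≥0∞ := fun A => ∑' d, if A d then Z d else 0
    with hS
  set Ap := S fun d => ℓ d = some (o, true)
  set Am := S fun d => ℓ d = some (o, false)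
  set A0 := S fun d => ℓ d ≠ some (o, true) ∧ ℓ d ≠ some (o, false)
  set A1 := S fun d => ℓ d = some (o, true) ∨ ℓ d = some (o, false)
  have e1 : Ap + Am = A1 := by
    rw [← ENNReal.tsum_add]
    refine tsum_congr fun d => ?_
    by_cases ha : ℓ d = some (o, true) <;> by_cases hb : ℓ d = some (o, false)
    · rw [ha] at hb; simp at hb
    all_goals simp [ha, hb]
  have e2 : A1 + A0 = 1 := by
    rw [← ENNReal.tsum_add, ← hZ]
    refine tsum_congr fun d => ?_
    by_cases ha : ℓ d = some (o, true) <;> by_cases hb : ℓ d = some (o, false)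
    · rw [ha] at hb; simp at hb
    all_goals simp [ha, hb]
  have i1 : A0 ≤ Ap + ENNReal.ofReal (1 / 10) := by
    refine tsum_ite_le_of_smul Z _ h1 fun d hd => ?_
    induction d using QuotientGroup.induction_on with
    | H a => exact vfirst_gen_mul hd.2
  have i2 : A0 ≤ Am + ENNReal.ofReal (1 / 10) := by
    refine tsum_ite_le_of_smul Z (gen Γ v)⁻¹ ((tsum_ed_smul_inv Z _).trans_le h1) fun d hd => ?_
    induction d using QuotientGroup.induction_on with
    | H a => exact vfirst_gen_inv_mul hd.1
  have i3 : A1 ≤ A0 + ENNReal.ofReal (1 / 10) := by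
    refine tsum_ite_le_of_smul Z (gen Γ v') h2 fun d hd => ?_
    have hv' : gen Γ v' ∈ standardSub Γ {v}ᶜ := gen_mem_standardSub (by simpa using hne)
    have hno : ∀ b b' : Bool, some (gen Γ v' • o, b) ≠ some (o, b') := by
      intro b b' hb
      rw [Option.some.injEq, Prod.mk.injEq] at hb
      have h3 : ((gen Γ v' * 1 : RAAG Γ) : LinkCoset Γ v) = o := hb.1
      rw [ho, QuotientGroup.eq, mul_one, mul_one, inv_mem_iff] at h3
      have h4 := retr_of_mem h3
      rw [retr_gen_of_notMem (by exact hadj)] at h4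
      have h5 := vlen_gen_self (Γ := Γ) v'
      rw [← h4, vlen_eq_zero.2 (one_mem _)] at h5
      exact zero_ne_one h5
    induction d using QuotientGroup.induction_on with
    | H a =>
      change vfirst Γ v (gen Γ v' * a) ≠ _ ∧ vfirst Γ v (gen Γ v' * a) ≠ _
      rw [vfirst_mul_left hv']
      change vfirst Γ v a = _ ∨ vfirst Γ v a = _ at hd
      rcases hd with hd | hd <;> rw [hd] <;> exact ⟨hno _ _, hno _ _⟩
  have f0 : A0 ≠ ∞ := ne_top_of_le_ne_top ENNReal.one_ne_top (e2 ▸ le_add_self)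
  have f1 : A1 ≠ ∞ := ne_top_of_le_ne_top ENNReal.one_ne_top (e2 ▸ le_self_add)
  have fp : Ap ≠ ∞ := ne_top_of_le_ne_top f1 (e1 ▸ le_self_add)
  have fm : Am ≠ ∞ := ne_top_of_le_ne_top f1 (e1 ▸ le_add_self)
  have r1 := congrArg ENNReal.toReal e1
  have r2 := congrArg ENNReal.toReal e2
  rw [ENNReal.toReal_add fp fm] at r1
  rw [ENNReal.toReal_add f1 f0, ENNReal.toReal_one] at r2
  have conv : ∀ {a b : ℝ≥0∞}, b ≠ ∞ → a ≤ b + ENNReal.ofReal (1 / 10) →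
      a.toReal ≤ b.toReal + 1 / 10 := by
    intro a b hb hab
    have := ENNReal.toReal_mono (by finiteness) hab
    rwa [ENNReal.toReal_add hb (by finiteness), ENNReal.toReal_ofReal (by norm_num)] at this
  have r3 := conv fp i1
  have r4 := conv fm i2
  have r5 := conv f0 i3
  linarith

end NoInvariantProbability

section Magnus

variable {B : Type*}

open Classical in
/-- Left multiplication of a noncommutative power series by `1 + b`. -/
noncomputable def mulLetter (b : B) (φ : List B → ℤ) : List B → ℤ
  | [] => φ []
  | a :: w => φ (a :: w) + if a = b then φ w else 0

open Classical in
/-- Left multiplication of a noncommutative power series by `(1 + b)⁻¹`. -/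
noncomputable def divLetter (b : B) (φ : List B → ℤ) : List B → ℤ
  | [] => φ []
  | a :: w => φ (a :: w) - if a = b then divLetter b φ w else 0

/-- Left multiplication by `1 + b` as a permutation. -/
noncomputable def letterPerm (b : B) : Equiv.Perm (List B → ℤ) where
  toFun := mulLetter b
  invFun := divLetter b
  left_inv φ := by
    funext w
    induction w with
    | nil => rfl
    | cons a w ih =>
      rw [divLetter, mulLetter, ih]; ring
  right_inv φ := by
    funext w
    cases w with
    | nil => rfl
    | cons a w => rw [mulLetter, divLetter]; ring

/-- The Magnus action of a free group on noncommutative power series. -/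
noncomputable def magnusAct : FreeGroup B →* Equiv.Perm (List B → ℤ) :=
  FreeGroup.lift letterPerm

/-- The unit series. -/
def unitSeries : List B → ℤ
  | [] => 1
  | _ :: _ => 0

/-- The Magnus expansion. -/
noncomputable def magnus (f : FreeGroup B) : List B → ℤ := magnusAct f unitSeries

lemma magnusAct_of (b : B) (φ : List B → ℤ) : magnusAct (FreeGroup.of b) φ = mulLetter b φ := by
  simp [magnusAct, letterPerm]

lemma magnusAct_of_inv (b : B) (φ : List B → ℤ) :
    magnusAct (FreeGroup.of b)⁻¹ φ = divLetter b φ := by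
  rw [map_inv, magnusAct, FreeGroup.lift_apply_of]; rfl

lemma magnusAct_mul (f g : FreeGroup B) (φ : List B → ℤ) :
    magnusAct (f * g) φ = magnusAct f (magnusAct g φ) := by
  rw [map_mul, Equiv.Perm.mul_apply]

lemma freeGroup_induction_left {p : FreeGroup B → Prop} (f : FreeGroup B) (one : p 1)
    (of_mul : ∀ b f, p f → p (FreeGroup.of b * f))
    (inv_mul : ∀ b f, p f → p ((FreeGroup.of b)⁻¹ * f)) : p f := by
  have hf : f ∈ Subgroup.closure (Set.range (FreeGroup.of : B → FreeGroup B)) := by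
    rw [FreeGroup.closure_range_of]; trivial
  induction hf using Subgroup.closure_induction_left with
  | one => exact one
  | mul_left x hx y _ hy => obtain ⟨b, rfl⟩ := hx; exact of_mul _ _ hy
  | inv_mul_cancel x hx y _ hy => obtain ⟨b, rfl⟩ := hx; exact inv_mul _ _ hy

/-- The product of noncommutative power series. -/
def conv : (List B → ℤ) → (List B → ℤ) → List B → ℤ
  | φ, ψ, [] => φ [] * ψ []
  | φ, ψ, a :: w => φ [] * ψ (a :: w) + conv (fun u => φ (a :: u)) ψ w

lemma conv_add_left (φ φ' ψ : List B → ℤ) (w : List B) :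
    conv (fun u => φ u + φ' u) ψ w = conv φ ψ w + conv φ' ψ w := by
  induction w generalizing φ φ' with
  | nil => simp only [conv]; ring
  | cons a w ih => simp only [conv, ih]; ring

lemma conv_zero_left (ψ : List B → ℤ) (w : List B) : conv (fun _ => 0) ψ w = 0 := by
  induction w with
  | nil => simp only [conv]; ring
  | cons a w ih => simp only [conv, ih]; ring

lemma conv_unit_left (ψ : List B → ℤ) : conv unitSeries ψ = ψ := by
  funext w
  cases w with
  | nil => simp [conv, unitSeries]
  | cons a w =>
    have : (fun u : List B => unitSeries (a :: u)) = fun _ => 0 := rfl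
    rw [conv, this, conv_zero_left]; simp [unitSeries]

lemma conv_mulLetter (b : B) (φ ψ : List B → ℤ) :
    conv (mulLetter b φ) ψ = mulLetter b (conv φ ψ) := by
  funext w
  cases w with
  | nil => rfl
  | cons a w =>
    have : (fun u => mulLetter b φ (a :: u)) =
        fun u => φ (a :: u) + (open Classical in if a = b then φ u else 0) := rfl
    have h1 : mulLetter b (conv φ ψ) (a :: w) =
      φ [] * ψ (a :: w) + conv (fun u => φ (a :: u)) ψ w +
        (open Classical in if a = b then conv φ ψ w else 0) := rfl
    rw [h1, conv, this, conv_add_left]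
    by_cases h : a = b
    · simp only [h, if_true, mulLetter]; ring
    · simp only [h, if_false, conv_zero_left, mulLetter, add_zero]

lemma conv_divLetter (b : B) (φ ψ : List B → ℤ) :
    conv (divLetter b φ) ψ = divLetter b (conv φ ψ) := by
  have h1 : mulLetter b (divLetter b φ) = φ := (letterPerm b).right_inv φ
  have h2 := (letterPerm b).left_inv (conv (divLetter b φ) ψ)
  change divLetter b (mulLetter b (conv (divLetter b φ) ψ)) = _ at h2
  rw [← conv_mulLetter, h1] at h2
  exact h2.symm

lemma magnusAct_conv (f : FreeGroup B) (φ ψ : List B → ℤ) :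
    magnusAct f (conv φ ψ) = conv (magnusAct f φ) ψ := by
  induction f using freeGroup_induction_left with
  | one => simp
  | of_mul b f ih => rw [magnusAct_mul, magnusAct_mul, ih, magnusAct_of, magnusAct_of,
      conv_mulLetter]
  | inv_mul b f ih => rw [magnusAct_mul, magnusAct_mul, ih, magnusAct_of_inv, magnusAct_of_inv,
      conv_divLetter]

lemma magnus_mul (f g : FreeGroup B) : magnus (f * g) = conv (magnus f) (magnus g) := by
  rw [magnus, magnusAct_mul, magnus, ← magnusAct_conv, conv_unit_left]; rfl

lemma magnus_nil (f : FreeGroup B) : magnus f [] = 1 := by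
  have : ∀ φ : List B → ℤ, magnusAct f φ [] = φ [] := by
    intro φ
    induction f using freeGroup_induction_left with
    | one => simp
    | of_mul b f ih => rw [magnusAct_mul, magnusAct_of, mulLetter, ih]
    | inv_mul b f ih => rw [magnusAct_mul, magnusAct_of_inv, divLetter, ih]
  rw [magnus, this]; rfl

lemma magnus_map (π : Equiv.Perm B) (f : FreeGroup B) (w : List B) :
    magnus (FreeGroup.map π f) w = magnus f (w.map π.symm) := by
  unfold magnus
  induction f using freeGroup_induction_left generalizing w with
  | one => cases w <;> simp [unitSeries]
  | of_mul b f ih =>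
    rw [map_mul, FreeGroup.map.of, magnusAct_mul, magnusAct_mul, magnusAct_of, magnusAct_of]
    cases w with
    | nil => simpa [mulLetter] using ih []
    | cons a w =>
      simp only [List.map_cons, mulLetter]
      rw [ih, ih]
      have hiff : (π.symm a = b) = (a = π b) := propext π.symm_apply_eq
      by_cases hab : a = π b
      · rw [if_pos hab, if_pos (hiff.mpr hab), List.map_cons]
      · rw [if_neg hab, if_neg (fun h' => hab (hiff.mp h')), List.map_cons]
  | inv_mul b f ih =>
    rw [map_mul, map_inv, FreeGroup.map.of, magnusAct_mul, magnusAct_mul, magnusAct_of_inv,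
      magnusAct_of_inv]
    induction w with
    | nil => simpa [divLetter] using ih []
    | cons a w ihw =>
      simp only [List.map_cons, divLetter]
      rw [ih, ihw]
      have hiff : (π.symm a = b) = (a = π b) := propext π.symm_apply_eq
      by_cases hab : a = π b
      · rw [if_pos hab, if_pos (hiff.mpr hab), List.map_cons]
      · rw [if_neg hab, if_neg (fun h' => hab (hiff.mp h')), List.map_cons]

lemma magnus_support {D : Set B} {f : FreeGroup B}
    (hf : f ∈ Subgroup.closure (FreeGroup.of '' D)) {w : List B} (hw : magnus f w ≠ 0) :
    ∀ a ∈ w, a ∈ D := by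
  unfold magnus at hw
  induction hf using Subgroup.closure_induction_left generalizing w with
  | one =>
    cases w with
    | nil => simp
    | cons a w => simp [unitSeries] at hw
  | mul_left x hx y _ ih =>
    obtain ⟨b, hb, rfl⟩ := hx
    rw [magnusAct_mul, magnusAct_of] at hw
    cases w with
    | nil => simp
    | cons a w =>
      rw [mulLetter] at hw
      by_cases h1 : magnusAct y unitSeries (a :: w) = 0
      · by_cases h2 : a = b
        · subst h2
          rw [h1, zero_add, if_pos rfl] at hw
          rintro c hc
          rcases List.mem_cons.1 hc with rfl | hc
          · exact hb
          · exact ih hw c hc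
        · simp [h1, h2] at hw
      · exact ih h1
  | inv_mul_cancel x hx y _ ih =>
    obtain ⟨b, hb, rfl⟩ := hx
    rw [magnusAct_mul, magnusAct_of_inv] at hw
    induction w with
    | nil => simp
    | cons a w ihw =>
      rw [divLetter] at hw
      by_cases h1 : magnusAct y unitSeries (a :: w) = 0
      · by_cases h2 : a = b
        · subst h2
          rw [h1, zero_sub, if_pos rfl, neg_ne_zero] at hw
          rintro c hc
          rcases List.mem_cons.1 hc with rfl | hc
          · exact hb
          · exact ihw hw c hc
        · simp [h1, h2] at hw
      · exact ih h1

lemma conv_eq_zero_of_length_lt {φ ψ : List B → ℤ} {d : ℕ} (hψ : ∀ u, u.length < d → ψ u = 0)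
    {w : List B} (hw : w.length < d) : conv φ ψ w = 0 := by
  induction w generalizing φ with
  | nil => rw [conv, hψ _ hw, mul_zero]
  | cons a w ih =>
    rw [conv, hψ _ hw, mul_zero, zero_add]
    exact ih (by simp only [List.length_cons] at hw; omega)

lemma conv_low_right {φ ψ : List B → ℤ} {d : ℕ} (hψ : ∀ u, u.length < d → ψ u = 0)
    {w : List B} (hw : w.length ≤ d) : conv φ ψ w = φ [] * ψ w := by
  cases w with
  | nil => rfl
  | cons a w =>
    rw [conv, conv_eq_zero_of_length_lt hψ (by simp only [List.length_cons] at hw; omega), add_zero]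

lemma conv_low_left {φ ψ : List B → ℤ} {d : ℕ} (hφ : ∀ u, u.length < d → φ u = 0)
    {w : List B} (hw : w.length ≤ d) : conv φ ψ w = φ w * ψ [] := by
  induction w generalizing φ d with
  | nil => rfl
  | cons a w ih =>
    simp only [List.length_cons] at hw
    rw [conv, hφ [] (by simp; omega), zero_mul, zero_add]
    refine ih (d := d - 1) (fun u hu => hφ _ ?_) (by omega)
    simp only [List.length_cons]; omega

/-- Words with no two equal adjacent letters. -/
def Alternating (w : List B) : Prop := w.IsChain (· ≠ ·)

lemma magnus_ne_zero_of_reduced (L : List (B × Bool)) (b : B) (s : Bool)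
    (hL : FreeGroup.IsReduced ((b, s) :: L)) :
    ∃ (w : List B) (n : ℕ), Alternating (b :: w) ∧ 0 < n ∧
      magnus (FreeGroup.mk ((b, s) :: L)) w ≠ 0 ∧
      magnus (FreeGroup.mk ((b, s) :: L)) (b :: w) =
        (if s then 1 else -1) * n * magnus (FreeGroup.mk ((b, s) :: L)) w ∧
      (∀ u, Alternating u → w.length + 1 < u.length →
        magnus (FreeGroup.mk ((b, s) :: L)) u = 0) ∧
      ∀ u, Alternating u → u.length = w.length + 1 → (∀ v, u = b :: v → False) →
        magnus (FreeGroup.mk ((b, s) :: L)) u = 0 := by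
  have step : ∀ (b : B) (s : Bool) (f : FreeGroup B) (w : List B),
      (∀ v, w = b :: v → False) →
      magnus (FreeGroup.mk [(b, s)] * f) w = magnus f w ∧
      magnus (FreeGroup.mk [(b, s)] * f) (b :: w) =
        magnus f (b :: w) + (if s then 1 else -1) * magnus f w := by
    intro b s f w hw
    unfold magnus
    rw [magnusAct_mul]
    cases s with
    | true =>
      have : (FreeGroup.mk [(b, true)] : FreeGroup B) = FreeGroup.of b := rfl
      rw [this, magnusAct_of]
      constructor
      · cases w with
        | nil => rfl
        | cons a w =>
          rw [mulLetter, if_neg, add_zero]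
          rintro rfl; exact hw _ rfl
      · simp [mulLetter]
    | false =>
      have : (FreeGroup.mk [(b, false)] : FreeGroup B) = (FreeGroup.of b)⁻¹ := rfl
      rw [this, magnusAct_of_inv]
      have h1 : divLetter b (magnusAct f unitSeries) w = magnusAct f unitSeries w := by
        cases w with
        | nil => rfl
        | cons a w =>
          rw [divLetter, if_neg, sub_zero]
          rintro rfl; exact hw _ rfl
      refine ⟨h1, ?_⟩
      rw [divLetter, if_pos rfl, h1]; simp [sub_eq_add_neg]
  have far : ∀ (b : B) (s : Bool) (f : FreeGroup B) (k : ℕ),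
      (∀ u, Alternating u → k < u.length → magnus f u = 0) →
      ∀ u, Alternating u → k + 1 < u.length → magnus (FreeGroup.mk [(b, s)] * f) u = 0 := by
    intro b s f k hk u hu hlen
    by_cases h : ∃ v, u = b :: v
    · obtain ⟨v, rfl⟩ := h
      have hv : ∀ v', v = b :: v' → False := by
        rintro v' rfl
        exact (List.isChain_cons_cons.1 hu).1 rfl
      rw [(step b s f v hv).2, hk _ hu (by omega), hk v (List.IsChain.of_cons hu)
        (by simp only [List.length_cons] at hlen; omega)]
      simp
    · rw [(step b s f u (fun v hv => h ⟨v, hv⟩)).1, hk _ hu (by omega)]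
  induction L generalizing b s with
  | nil =>
    have h1 : (FreeGroup.mk [(b, s)] : FreeGroup B) = FreeGroup.mk [(b, s)] * 1 := (mul_one _).symm
    have h2 := step b s 1 [] (by simp)
    rw [← h1] at h2
    have hm : magnus (1 : FreeGroup B) = unitSeries := by simp [magnus]
    rw [hm] at h2
    refine ⟨[], 1, List.isChain_singleton _, one_pos, ?_, ?_, ?_, ?_⟩
    · rw [h2.1]; simp [unitSeries]
    · rw [h2.2, h2.1]; simp [unitSeries]
    · rw [h1]
      refine far b s 1 0 ?_
      intro u _ hu
      rw [hm]
      cases u with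
      | nil => simp at hu
      | cons => rfl
    · rintro u _ hu hub
      rw [h1, (step b s 1 u hub).1, hm]
      cases u with
      | nil => simp at hu
      | cons => rfl
  | cons c L ih =>
    obtain ⟨c, t⟩ := c
    have hL' := List.isChain_cons_cons.1 hL
    obtain ⟨w, n, hw, hn, h0, h1, h2, h5⟩ := ih c t hL'.2
    have hmul : (FreeGroup.mk ((b, s) :: (c, t) :: L) : FreeGroup B) =
        FreeGroup.mk [(b, s)] * FreeGroup.mk ((c, t) :: L) := by
      rw [FreeGroup.mul_mk]; rfl
    rw [hmul]
    by_cases hbc : b = c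
    · subst hbc
      have hst : s = t := hL'.1 rfl
      subst hst
      have hwb : ∀ v, w = b :: v → False := by
        rintro v rfl
        exact (List.isChain_cons_cons.1 hw).1 rfl
      have h3 := step b s (FreeGroup.mk ((b, s) :: L)) w hwb
      refine ⟨w, n + 1, hw, Nat.succ_pos _, ?_, ?_, ?_, ?_⟩
      · rw [h3.1]; exact h0
      · rw [h3.2, h3.1, h1]; push_cast; ring
      · intro u hu hlen
        by_cases h : ∃ v, u = b :: v
        · obtain ⟨v, rfl⟩ := h
          have hv : ∀ v', v = b :: v' → False := by
            rintro v' rfl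
            exact (List.isChain_cons_cons.1 hu).1 rfl
          rw [(step b s _ v hv).2, h2 _ hu hlen]
          have hmod : magnus (FreeGroup.mk ((b, s) :: L)) v = 0 := by
            rcases Nat.lt_or_ge (w.length + 1) v.length with h | h
            · exact h2 v (List.IsChain.of_cons hu) h
            · refine h5 v (List.IsChain.of_cons hu) ?_ hv
              simp only [List.length_cons] at hlen; omega
          rw [hmod]; simp
        · rw [(step b s _ u (fun v hv => h ⟨v, hv⟩)).1, h2 _ hu hlen]
      · intro u hu hlen hub
        rw [(step b s _ u hub).1, h5 u hu hlen hub]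
    · have hcw : ∀ v, c :: w = b :: v → False := by
        rintro v h
        exact hbc (List.cons.inj h).1.symm
      have h3 := step b s (FreeGroup.mk ((c, t) :: L)) (c :: w) hcw
      have h4 : Alternating (b :: c :: w) := List.isChain_cons_cons.2 ⟨hbc, hw⟩
      refine ⟨c :: w, 1, h4, one_pos, ?_, ?_, ?_, ?_⟩
      · rw [h3.1, h1]
        refine mul_ne_zero (mul_ne_zero ?_ (by exact_mod_cast hn.ne')) h0
        split_ifs <;> norm_num
      · rw [h3.2, h3.1, h2 _ h4 (by simp)]; simp
      · intro u hu hlen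
        exact far b s _ _ h2 u hu (by simpa using hlen)
      · intro u hu hlen hub
        rw [(step b s _ u hub).1, h2 u hu (by rw [hlen]; simp)]

lemma magnus_injective : Function.Injective (magnus : FreeGroup B → List B → ℤ) := by
  have key : ∀ f : FreeGroup B, magnus f = unitSeries → f = 1 := by
    intro f hf
    classical
    by_contra hne
    have hw : f.toWord ≠ [] := fun h => hne (FreeGroup.toWord_eq_nil_iff.1 h)
    obtain ⟨⟨b, s⟩, L, hL⟩ := List.exists_cons_of_ne_nil hw
    have hred : FreeGroup.IsReduced ((b, s) :: L) := hL ▸ FreeGroup.isReduced_toWord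
    obtain ⟨w, n, -, hn, h0, h1, -⟩ := magnus_ne_zero_of_reduced L b s hred
    rw [← hL, FreeGroup.mk_toWord, hf] at h0 h1
    have : (unitSeries (b :: w) : ℤ) = 0 := rfl
    rw [this] at h1
    refine mul_ne_zero (mul_ne_zero ?_ (by exact_mod_cast hn.ne')) h0 h1.symm
    split_ifs <;> norm_num
  intro f g hfg
  have : magnus (f⁻¹ * g) = unitSeries := by
    unfold magnus at hfg ⊢
    rw [magnusAct_mul, ← hfg, ← magnusAct_mul, inv_mul_cancel, map_one]; rfl
  exact (inv_mul_eq_one.1 (key _ this))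

/-- The twisted power `f * π f * ⋯ * π^(n-1) f`. -/
def twPow (π : Equiv.Perm B) (f : FreeGroup B) : ℕ → FreeGroup B
  | 0 => 1
  | n + 1 => f * FreeGroup.map π (twPow π f n)

lemma conv_sub_right (φ ψ ψ' : List B → ℤ) (w : List B) :
    conv φ (fun u => ψ u - ψ' u) w = conv φ ψ w - conv φ ψ' w := by
  induction w generalizing φ with
  | nil => simp only [conv]; ring
  | cons a w ih => simp only [conv, ih]; ring

lemma conv_sub_left (φ φ' ψ : List B → ℤ) (w : List B) :
    conv (fun u => φ u - φ' u) ψ w = conv φ ψ w - conv φ' ψ w := by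
  induction w generalizing φ φ' with
  | nil => simp only [conv]; ring
  | cons a w ih => simp only [conv, ih]; ring

lemma magnus_twPow_sub (π : Equiv.Perm B) (f f' : FreeGroup B) (d : ℕ)
    (hd : ∀ u, u.length < d → magnus f u = magnus f' u) (n : ℕ) (w : List B)
    (hw : w.length ≤ d) :
    magnus (twPow π f n) w - magnus (twPow π f' n) w =
      ∑ i ∈ Finset.range n,
        (magnus f (w.map (π ^ i).symm) - magnus f' (w.map (π ^ i).symm)) := by
  induction n generalizing w with
  | zero => simp [twPow]
  | succ n ih =>
    have hE : ∀ u : List B, u.length < d →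
        magnus (FreeGroup.map π (twPow π f n)) u - magnus (FreeGroup.map π (twPow π f' n)) u
          = 0 := by
      intro u hu
      rw [magnus_map, magnus_map, ih _ (by simpa using hu.le)]
      refine Finset.sum_eq_zero fun i _ => ?_
      rw [hd _ (by simpa using hu), sub_self]
    have h1 := conv_low_right (φ := magnus f) hE hw
    have h2 := conv_low_left (φ := fun u => magnus f u - magnus f' u) (d := d)
      (ψ := magnus (FreeGroup.map π (twPow π f' n)))
      (fun u hu => sub_eq_zero.2 (hd u hu)) hw
    rw [conv_sub_right, magnus_nil, one_mul] at h1
    rw [conv_sub_left, magnus_nil, mul_one] at h2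
    rw [Finset.sum_range_succ', twPow, twPow, magnus_mul, magnus_mul]
    have h3 : magnus (FreeGroup.map π (twPow π f n)) w -
        magnus (FreeGroup.map π (twPow π f' n)) w = ∑ i ∈ Finset.range n,
        (magnus f (w.map (π ^ (i + 1)).symm) - magnus f' (w.map (π ^ (i + 1)).symm)) := by
      rw [magnus_map, magnus_map, ih _ (by simpa using hw)]
      refine Finset.sum_congr rfl fun i _ => ?_
      have : (w.map π.symm).map (π ^ i).symm = w.map (π ^ (i + 1)).symm := by
        rw [List.map_map]; congr 1
      rw [this]
    rw [← h3]
    simp only [pow_zero]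
    have h4 : w.map (1 : Equiv.Perm B).symm = w := by
      have : ((1 : Equiv.Perm B).symm : B → B) = id := rfl
      rw [this, List.map_id]
    rw [h4]
    linarith

theorem twPow_injective {π : Equiv.Perm B} {D : Set B}
    (hD : ∀ b ∈ D, ∀ j : ℕ, 0 < j → (π ^ j) b = b → π b = b) {f f' : FreeGroup B}
    (hf : f ∈ Subgroup.closure (FreeGroup.of '' D))
    (hf' : f' ∈ Subgroup.closure (FreeGroup.of '' D)) {n : ℕ} (hn : 0 < n)
    (h : twPow π f n = twPow π f' n) : f = f' := by
  classical
  by_contra hne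
  -- finite letter sets
  have hfin : ∀ g : FreeGroup B, ∃ E : Finset B, ∀ w, magnus g w ≠ 0 → ∀ a ∈ w, a ∈ E := by
    intro g
    suffices ∃ E : Finset B, g ∈ Subgroup.closure (FreeGroup.of '' (E : Set B)) by
      obtain ⟨E, hE⟩ := this
      exact ⟨E, fun w hw a ha => magnus_support hE hw a ha⟩
    induction g using freeGroup_induction_left with
    | one => exact ⟨∅, one_mem _⟩
    | of_mul b f ih =>
      obtain ⟨E, hE⟩ := ih
      refine ⟨insert b E, mul_mem (Subgroup.subset_closure ⟨b, by simp, rfl⟩) ?_⟩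
      exact Subgroup.closure_mono (Set.image_mono (by simp)) hE
    | inv_mul b f ih =>
      obtain ⟨E, hE⟩ := ih
      refine ⟨insert b E, mul_mem (inv_mem (Subgroup.subset_closure ⟨b, by simp, rfl⟩)) ?_⟩
      exact Subgroup.closure_mono (Set.image_mono (by simp)) hE
  obtain ⟨E, hE⟩ := hfin f
  obtain ⟨E', hE'⟩ := hfin f'
  have hex : ∃ d : ℕ, ∃ w : List B, w.length = d ∧ magnus f w ≠ magnus f' w := by
    by_contra hcon
    push Not at hcon
    exact hne (magnus_injective (funext fun w => hcon _ w rfl))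
  obtain ⟨w, hwd, hw⟩ := Nat.find_spec hex
  set d := Nat.find hex with hd_def
  have hd : ∀ u : List B, u.length < d → magnus f u = magnus f' u := by
    intro u hu
    by_contra hcon
    exact Nat.find_min hex hu ⟨u, rfl, hcon⟩
  set δ : List B → ℤ := fun u => magnus f u - magnus f' u with hδ
  have hsupp : ∀ u, δ u ≠ 0 → ∀ a ∈ u, a ∈ D ∧ a ∈ E ∪ E' := by
    intro u hu a ha
    by_cases h1 : magnus f u = 0
    · have h2 : magnus f' u ≠ 0 := fun h2 => hu (by simp [hδ, h1, h2])
      exact ⟨magnus_support hf' h2 a ha, Finset.mem_union_right _ (hE' u h2 a ha)⟩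
    · exact ⟨magnus_support hf h1 a ha, Finset.mem_union_left _ (hE u h1 a ha)⟩
  have hsum : ∀ u : List B, u.length ≤ d →
      ∑ i ∈ Finset.range n, δ (u.map (π ^ i).symm) = 0 := by
    intro u hu
    rw [← magnus_twPow_sub π f f' d hd n u hu, h, sub_self]
  have hper : ∀ u : List B, u.length ≤ d → δ (u.map (π ^ n).symm) = δ u := by
    intro u hu
    have h1 := hsum (u.map π.symm) (by simpa using hu)
    have h2 := hsum u hu
    have h3 : ∀ i, (u.map π.symm).map (π ^ i).symm = u.map (π ^ (i + 1)).symm := by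
      intro i
      rw [List.map_map]; congr 1
    simp only [h3] at h1
    have h4 := Finset.sum_range_succ' (fun i => δ (u.map (π ^ i).symm)) n
    rw [Finset.sum_range_succ, h1, h2] at h4
    have h5 : u.map (π ^ 0).symm = u := by
      have : ((π ^ 0).symm : B → B) = id := rfl
      rw [this, List.map_id]
    rw [h5] at h4
    simpa using h4
  have hper' : ∀ k : ℕ, δ (w.map (π ^ (n * k)).symm) = δ w := by
    intro k
    induction k with
    | zero =>
      have : ((1 : Equiv.Perm B).symm : B → B) = id := rfl
      simp [this]
    | succ k ih =>
      rw [← ih, ← hper (w.map (π ^ (n * k)).symm) (by simp [hwd]), List.map_map]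
      congr 2
      funext x
      rw [Nat.mul_succ, pow_add]; rfl
  have hδw : δ w ≠ 0 := sub_ne_zero.2 hw
  have hfix : ∀ a ∈ w, π a = a := by
    intro a ha
    have hmem : ∀ k : ℕ, (π ^ (n * k)).symm a ∈ E ∪ E' := fun k =>
      (hsupp _ (by rw [hper' k]; exact hδw) _ (List.mem_map_of_mem ha)).2
    obtain ⟨i, j, hij, heq⟩ := Finite.exists_ne_map_eq_of_infinite
      (fun k : ℕ => (⟨(π ^ (n * k)).symm a, hmem k⟩ : (E ∪ E' : Finset B)))
    replace heq : (π ^ (n * i)).symm a = (π ^ (n * j)).symm a := congrArg Subtype.val heq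
    wlog hlt : i < j generalizing i j
    · exact this j i hij.symm heq.symm (by omega)
    refine hD a (hsupp w hδw a ha).1 (n * (j - i)) (Nat.mul_pos hn (by omega)) ?_
    have h5 : n * j = n * (j - i) + n * i := by rw [← Nat.mul_add]; congr 1; omega
    rw [Equiv.symm_apply_eq] at heq
    rw [h5, add_comm, pow_add] at heq
    have h6 : (π ^ (n * i) * π ^ (n * (j - i))).symm a =
      (π ^ (n * (j - i))).symm ((π ^ (n * i)).symm a) := rfl
    rw [h6] at heq
    have h7 : (π ^ (n * i)).symm a = (π ^ (n * (j - i))).symm ((π ^ (n * i)).symm a) := by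
      rw [Equiv.symm_apply_eq]; exact heq
    rw [Equiv.eq_symm_apply] at h7
    have h8 := congrArg (π ^ (n * i)) h7
    rw [← Equiv.Perm.mul_apply, ← pow_add, add_comm, pow_add, Equiv.Perm.mul_apply,
      Equiv.apply_symm_apply] at h8
    exact h8
  have hfixi : ∀ i : ℕ, w.map (π ^ i).symm = w := by
    intro i
    conv_rhs => rw [← List.map_id w]
    refine List.map_congr_left fun a ha => ?_
    rw [Equiv.symm_apply_eq]
    exact ((Function.IsFixedPt.perm_pow (hfix a ha) i)).symm
  have h9 := hsum w hwd.le
  simp only [hfixi, Finset.sum_const, Finset.card_range, nsmul_eq_mul] at h9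
  exact mul_ne_zero (by exact_mod_cast hn.ne') hδw h9

end Magnus

section UniqueRoots

variable {V : Type} {Γ : SimpleGraph V}

lemma spl_left_mem {S : Set V} {v : V} {x : RAAG Γ} (hx : x ∈ standardSub Γ (insert v S)) :
    (spl Γ v x).left ∈ Subgroup.closure (FreeGroup.of ''
      {c : LinkCoset Γ v | ∃ g ∈ standardSub Γ S, c = (g : LinkCoset Γ v)}) := by
  have hr : ∀ g ∈ standardSub Γ (insert v S), (spl Γ v g).right ∈ standardSub Γ S := by
    intro g hg
    rw [spl_right]
    refine standardSub_mono ?_ (retr_mem_inter (S := {v}ᶜ) hg)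
    rintro u ⟨h1, h2⟩
    exact h2.resolve_left h1
  refine (standardSub_induction (p := fun x => x ∈ standardSub Γ (insert v S) ∧
    (spl Γ v x).left ∈ Subgroup.closure (FreeGroup.of ''
      {c : LinkCoset Γ v | ∃ g ∈ standardSub Γ S, c = (g : LinkCoset Γ v)})) hx
    ⟨one_mem _, by simp [one_mem]⟩ ?_ ?_).2
  · rintro g u hu ⟨hg, ih⟩
    refine ⟨mul_mem hg (gen_mem_standardSub hu), ?_⟩
    rw [map_mul, SemidirectProduct.mul_left]
    by_cases h : u = v
    · subst h
      rw [spl_gen_self, SemidirectProduct.left_inl, freeAct_of]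
      exact mul_mem ih (Subgroup.subset_closure ⟨_, ⟨_, hr g hg, 
        congrArg (fun z : RAAG Γ => (z : LinkCoset Γ u)) (mul_one _)⟩, rfl⟩)
    · rw [spl_gen_of_ne h, SemidirectProduct.left_inr, map_one, mul_one]; exact ih
  · rintro g u hu ⟨hg, ih⟩
    refine ⟨mul_mem hg (inv_mem (gen_mem_standardSub hu)), ?_⟩
    rw [map_mul, SemidirectProduct.mul_left, map_inv]
    by_cases h : u = v
    · subst h
      rw [spl_gen_self, ← map_inv, SemidirectProduct.left_inl, map_inv, freeAct_of]
      exact mul_mem ih (inv_mem (Subgroup.subset_closure ⟨_, ⟨_, hr g hg, 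
        congrArg (fun z : RAAG Γ => (z : LinkCoset Γ u)) (mul_one _)⟩, rfl⟩))
    · rw [spl_gen_of_ne h, ← map_inv, SemidirectProduct.left_inr, map_one, mul_one]; exact ih

lemma left_pow (v : V) (z : FreeGroup (LinkCoset Γ v) ⋊[freeAct Γ v] RAAG Γ) (n : ℕ) :
    (z ^ n).left = twPow (cosetPerm Γ v z.right) z.left n := by
  induction n with
  | zero => rfl
  | succ n ih => rw [pow_succ', SemidirectProduct.mul_left, ih]; rfl

lemma unique_roots_aux (S : Finset V) : ∀ {x y : RAAG Γ}, x ∈ standardSub Γ (S : Set V) →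
    y ∈ standardSub Γ (S : Set V) → ∀ {n : ℕ}, 0 < n → x ^ n = y ^ n → x = y := by
  classical
  induction S using Finset.induction_on with
  | empty =>
    intro x y hx hy n _ _
    rw [Finset.coe_empty, standardSub_empty, Subgroup.mem_bot] at hx hy
    rw [hx, hy]
  | insert v S hv ih =>
    intro x y hx hy n hn hxy
    rw [Finset.coe_insert] at hx hy
    have hr : ∀ g ∈ standardSub Γ (insert v (S : Set V)),
        retr Γ {v}ᶜ g ∈ standardSub Γ (S : Set V) := by
      intro g hg
      refine standardSub_mono ?_ (retr_mem_inter (S := {v}ᶜ) hg)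
      rintro u ⟨h1, h2⟩
      exact h2.resolve_left h1
    have hright : (spl Γ v x).right = (spl Γ v y).right := by
      rw [spl_right, spl_right]
      exact ih (hr x hx) (hr y hy) hn (by rw [← map_pow, ← map_pow, hxy])
    refine spl_injective v (SemidirectProduct.ext ?_ hright)
    have hpow : (spl Γ v x ^ n).left = (spl Γ v y ^ n).left := by
      rw [← map_pow, ← map_pow, hxy]
    rw [left_pow, left_pow, ← hright] at hpow
    refine twPow_injective ?_ (spl_left_mem hx) (spl_left_mem hy) hn hpow
    rintro _ ⟨g, hg, rfl⟩ j hj hfix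
    rw [← map_pow] at hfix
    have hp := hr x hx
    rw [← spl_right] at hp
    set p := (spl Γ v x).right
    change ((p ^ j * g : RAAG Γ) : LinkCoset Γ v) = (g : LinkCoset Γ v) at hfix
    change ((p * g : RAAG Γ) : LinkCoset Γ v) = (g : LinkCoset Γ v)
    have hfix' := QuotientGroup.eq.1 hfix.symm
    refine (QuotientGroup.eq.2 ?_).symm
    have hw : g⁻¹ * (p * g) ∈ standardSub Γ (S : Set V) := mul_mem (inv_mem hg) (mul_mem hp hg)
    have hwj : (g⁻¹ * (p * g)) ^ j ∈ standardSub Γ (lk Γ v) := by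
      have : (g⁻¹ * (p * g)) ^ j = g⁻¹ * (p ^ j * g) := by
        have h := conj_pow (i := j) (a := g⁻¹) (b := p)
        rw [inv_inv] at h
        rw [← mul_assoc, ← mul_assoc]; exact h
      rw [this]; exact hfix'
    have h1 : g⁻¹ * (p * g) = retr Γ (lk Γ v) (g⁻¹ * (p * g)) := by
      refine ih hw (standardSub_mono Set.inter_subset_right (retr_mem_inter hw)) hj ?_
      rw [← map_pow, retr_of_mem hwj]
    rw [h1]; exact retr_mem _ _

variable [Finite V]

/-- Right-angled Artin groups have unique roots. -/
theorem unique_roots {x y : RAAG Γ} {n : ℕ} (hn : 0 < n) (h : x ^ n = y ^ n) : x = y := by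
  cases nonempty_fintype V
  have hu : ∀ z : RAAG Γ, z ∈ standardSub Γ ((Finset.univ : Finset V) : Set V) := fun z => by
    rw [Finset.coe_univ, standardSub_univ]; trivial
  exact unique_roots_aux Finset.univ (hu x) (hu y) hn h

lemma semiconj_of_pow {a b k : RAAG Γ} {n : ℕ} (hn : 0 < n) (h : a ^ n * k = k * b ^ n) :
    a * k = k * b := by
  have h1 : a = k * b * k⁻¹ := by
    refine unique_roots hn ?_
    rw [conj_pow, ← h, mul_inv_cancel_right]
  rw [h1, inv_mul_cancel_right]

lemma mem_standardSub_of_pow_mem {S : Set V} {x : RAAG Γ} {n : ℕ} (hn : 0 < n)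
    (h : x ^ n ∈ standardSub Γ S) : x ∈ standardSub Γ S := by
  have h1 : x = retr Γ S x := unique_roots hn (by rw [← map_pow, retr_of_mem h])
  rw [h1]; exact retr_mem _ _

/-- Elements with a finite orbit under conjugation by powers are fixed. -/
lemma commute_of_pow {a k : RAAG Γ} {n : ℕ} (hn : 0 < n) (h : Commute (a ^ n) k) : Commute a k :=
  semiconj_of_pow hn h

end UniqueRoots

section GraphInvariants

/-- The integral Heisenberg group. -/
@[ext] structure Heis where
  a : ℤ
  b : ℤ
  c : ℤ

namespace Heis

instance : Mul Heis := ⟨fun x y => ⟨x.a + y.a, x.b + y.b, x.c + y.c + x.a * y.b⟩⟩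
instance : One Heis := ⟨⟨0, 0, 0⟩⟩
instance : Inv Heis := ⟨fun x => ⟨-x.a, -x.b, -x.c + x.a * x.b⟩⟩

@[simp] lemma mul_a (x y : Heis) : (x * y).a = x.a + y.a := rfl
@[simp] lemma mul_b (x y : Heis) : (x * y).b = x.b + y.b := rfl
@[simp] lemma mul_c (x y : Heis) : (x * y).c = x.c + y.c + x.a * y.b := rfl
@[simp] lemma one_a : (1 : Heis).a = 0 := rfl
@[simp] lemma one_b : (1 : Heis).b = 0 := rfl
@[simp] lemma one_c : (1 : Heis).c = 0 := rfl
@[simp] lemma inv_a (x : Heis) : (x⁻¹).a = -x.a := rfl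
@[simp] lemma inv_b (x : Heis) : (x⁻¹).b = -x.b := rfl
@[simp] lemma inv_c (x : Heis) : (x⁻¹).c = -x.c + x.a * x.b := rfl

instance : Group Heis := Group.ofLeftAxioms
  (by intro x y z; ext <;> simp <;> ring)
  (by intro x; ext <;> simp)
  (by intro x; ext <;> simp)

lemma commute_iff {x y : Heis} : Commute x y ↔ x.a * y.b = y.a * x.b := by
  constructor
  · intro h
    have := congrArg Heis.c h.eq
    simp only [mul_c] at this
    linarith
  · intro h
    ext
    · simp [add_comm]
    · simp [add_comm]
    · simp only [mul_c]; linarith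

end Heis

variable {V W : Type} {Γ : SimpleGraph V} {Δ : SimpleGraph W}

/-- The homomorphism to the integers with prescribed weights of generators. -/
def wt (Γ : SimpleGraph V) (χ : V → ℤ) : RAAG Γ →* Multiplicative ℤ :=
  raagLift (fun v => Multiplicative.ofAdd (χ v)) fun _ _ _ => Commute.all _ _

lemma wt_gen (χ : V → ℤ) (v : V) : wt Γ χ (gen Γ v) = Multiplicative.ofAdd (χ v) := by
  simp [wt]

/-- The homomorphism to the Heisenberg group with prescribed weights of generators. -/
def heisHom (Γ : SimpleGraph V) (χ ψ : V → ℤ) (h : ∀ u v, Γ.Adj u v → χ u * ψ v = χ v * ψ u) :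
    RAAG Γ →* Heis :=
  raagLift (fun v => ⟨χ v, ψ v, 0⟩) fun u v huv => Heis.commute_iff.2 (h u v huv)

lemma heisHom_gen (χ ψ : V → ℤ) (h) (v : V) : heisHom Γ χ ψ h (gen Γ v) = ⟨χ v, ψ v, 0⟩ := by
  simp [heisHom]

lemma heisHom_a (χ ψ : V → ℤ) (h) (g : RAAG Γ) :
    (heisHom Γ χ ψ h g).a = (wt Γ χ g).toAdd := by
  induction g using raag_induction with
  | one => simp
  | mul_gen g v ih => simp [ih, heisHom_gen, wt_gen]
  | mul_gen_inv g v ih => simp [ih, heisHom_gen, wt_gen]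

lemma heisHom_b (χ ψ : V → ℤ) (h) (g : RAAG Γ) :
    (heisHom Γ χ ψ h g).b = (wt Γ ψ g).toAdd := by
  induction g using raag_induction with
  | one => simp
  | mul_gen g v ih => simp [ih, heisHom_gen, wt_gen]
  | mul_gen_inv g v ih => simp [ih, heisHom_gen, wt_gen]

lemma gen_ne_one (v : V) : gen Γ v ≠ 1 := by
  intro h
  have := wt_gen (Γ := Γ) (fun _ => 1) v
  rw [h, map_one] at this
  exact absurd (congrArg Multiplicative.toAdd this) (by simp)

open Classical in
lemma hom_expand [Fintype V] (φ : RAAG Γ →* Multiplicative ℤ) (g : RAAG Γ) :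
    (φ g).toAdd = ∑ u, (φ (gen Γ u)).toAdd * (wt Γ (Pi.single u 1) g).toAdd := by
  induction g using raag_induction with
  | one => simp
  | mul_gen g v ih =>
    simp [ih, wt_gen, mul_add, Finset.sum_add_distrib, Pi.single_apply]
  | mul_gen_inv g v ih =>
    simp [ih, wt_gen, mul_add, Finset.sum_add_distrib, Pi.single_apply]

theorem no_cone_of_equiv [Fintype V] (e : RAAG Δ ≃* RAAG Γ)
    (hΓ : ∀ v : V, ∃ u : V, u ≠ v ∧ ¬ Γ.Adj v u) (w : W) : ∃ u : W, u ≠ w ∧ ¬ Δ.Adj w u := by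
  classical
  by_contra hcon
  push Not at hcon
  have hcent : ∀ g : RAAG Δ, Commute (gen Δ w) g := by
    intro g
    have : g ∈ Subgroup.centralizer {gen Δ w} := by
      have h1 : standardSub Δ Set.univ ≤ Subgroup.centralizer {gen Δ w} := by
        refine standardSub_le_iff.2 fun u _ => ?_
        rw [Subgroup.mem_centralizer_singleton_iff]
        by_cases h : u = w
        · rw [h]
        · exact (gen_commute (hcon u h)).eq.symm
      exact h1 (by rw [standardSub_univ]; trivial)
    rw [Subgroup.mem_centralizer_singleton_iff] at this
    exact this.symm
  have hex := hom_expand ((wt Δ (Pi.single w 1)).comp e.symm.toMonoidHom) (e (gen Δ w))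
  have hl : (((wt Δ (Pi.single w 1)).comp e.symm.toMonoidHom) (e (gen Δ w))).toAdd = 1 := by
    simp [wt_gen]
  rw [hl] at hex
  obtain ⟨u, -, hu⟩ := Finset.exists_ne_zero_of_sum_ne_zero (hex ▸ one_ne_zero)
  have hu := right_ne_zero_of_mul hu
  obtain ⟨u', hne, hadj⟩ := hΓ u
  let hh := heisHom Γ (Pi.single u 1) (Pi.single u' 1) (by
    intro x y hxy
    by_cases h1 : x = u
    · subst h1
      have : y ≠ u' := by rintro rfl; exact hadj hxy
      have h2 : x ≠ u' := hne.symm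
      simp [this, h2]
    · by_cases h2 : y = u
      · subst h2
        have : x ≠ u' := by rintro rfl; exact hadj hxy.symm
        simp [this, h1]
      · simp [h1, h2])
  have hcomm : Commute (hh (e (gen Δ w))) (hh (gen Γ u')) := by
    refine Commute.map ?_ hh
    have := (hcent (e.symm (gen Γ u'))).map e
    simpa using this
  rw [Heis.commute_iff, heisHom_a, heisHom_gen] at hcomm
  simp [hne] at hcomm
  exact hu (by rw [hcomm]; rfl)

theorem connected_of_equiv [Fintype V] [Fintype W] (e : RAAG Δ ≃* RAAG Γ)
    (hΓ : Γ.Connected) (hcard : 2 ≤ Fintype.card V) : Δ.Connected := by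
  classical
  have : Nontrivial V := Fintype.one_lt_card_iff_nontrivial.1 (by omega)
  have hexp : ∀ v : V, ∃ n : W → ℤ, ∀ v' : V,
      ∑ u, n u * (wt Δ (Pi.single u 1) (e.symm (gen Γ v'))).toAdd = if v' = v then 1 else 0 := by
    intro v
    refine ⟨fun u => (wt Γ (Pi.single v 1) (e (gen Δ u))).toAdd, fun v' => ?_⟩
    have := hom_expand ((wt Γ (Pi.single v 1)).comp e.toMonoidHom) (e.symm (gen Γ v'))
    have h2 : ∀ x, ((wt Γ (Pi.single v 1)).comp e.toMonoidHom) x =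
      wt Γ (Pi.single v 1) (e x) := fun _ => rfl
    simp only [h2] at this
    rw [← this, e.apply_symm_apply, wt_gen]
    simp [Pi.single_apply]
  set x : V → W → ℤ := fun v u => (wt Δ (Pi.single u 1) (e.symm (gen Γ v))).toAdd with hx
  have hne : Nonempty W := by
    by_contra h
    rw [not_nonempty_iff] at h
    obtain ⟨v⟩ := hΓ.nonempty
    obtain ⟨n, hn⟩ := hexp v
    simpa using hn v
  have key : ∀ A : Set W, (∀ u ∈ A, ∀ w, Δ.Adj u w → w ∈ A) → A.Nonempty → A = Set.univ := by
    intro A hA hAne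
    by_contra hAu
    have hA' : ∀ u w, Δ.Adj u w → u ∉ A → w ∉ A := fun u w h hu hw => hu (hA w hw u h.symm)
    obtain ⟨w0, hw0⟩ : ∃ w, w ∉ A := by
      by_contra h; push Not at h; exact hAu (Set.eq_univ_of_forall h)
    obtain ⟨u0, hu0⟩ := hAne
    have hdet : ∀ v v', Γ.Adj v v' → ∀ u ∈ A, ∀ w ∉ A, x v u * x v' w = x v' u * x v w := by
      intro v v' hvv u hu w hw
      let hh := heisHom Δ (Pi.single u 1) (Pi.single w 1) (by
        intro y z hyz
        by_cases h1 : y = u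
        · subst h1
          have h2 : z ≠ w := by rintro rfl; exact hw (hA y hu _ hyz)
          have h3 : y ≠ w := by rintro rfl; exact hw hu
          simp [h2, h3]
        · by_cases h2 : z = u
          · subst h2
            have h3 : y ≠ w := by rintro rfl; exact hw (hA z hu _ hyz.symm)
            simp [h1, h3]
          · simp [h1, h2])
      have h := ((gen_commute hvv).map e.symm).map hh
      rw [Heis.commute_iff, heisHom_a, heisHom_b, heisHom_a, heisHom_b] at h
      exact h
    have hnotboth : ∀ v, ¬ ((∀ u ∈ A, x v u = 0) ∧ ∀ w ∉ A, x v w = 0) := by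
      rintro v ⟨h1, h2⟩
      obtain ⟨n, hn⟩ := hexp v
      have h3 := hn v
      have h4 : ∀ u, x v u = 0 := fun u => by
        by_cases hu : u ∈ A
        · exact h1 u hu
        · exact h2 u hu
      change ∑ u, n u * x v u = _ at h3
      simp [h4] at h3
    have hedge : ∀ v v', Γ.Adj v v' →
        ((∀ u ∈ A, x v u = 0) ∧ ∀ u ∈ A, x v' u = 0) ∨
        ((∀ w ∉ A, x v w = 0) ∧ ∀ w ∉ A, x v' w = 0) := by
      intro v v' hvv
      by_contra hcon
      push Not at hcon
      obtain ⟨hc1, hc2⟩ := hcon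
      have h1 : ∃ u ∈ A, ¬ (x v u = 0 ∧ x v' u = 0) := by
        by_contra h; push Not at h
        obtain ⟨u, hu, hu'⟩ := hc1 fun u hu => (h u hu).1
        exact hu' (h u hu).2
      have h2 : ∃ w, w ∉ A ∧ ¬ (x v w = 0 ∧ x v' w = 0) := by
        by_contra h; push Not at h
        obtain ⟨u, hu, hu'⟩ := hc2 fun u hu => (h u hu).1
        exact hu' (h u hu).2
      obtain ⟨u, hu, hun⟩ := h1
      obtain ⟨w, hw, hwn⟩ := h2
      have hall : ∀ t, x v t * x v' w = x v' t * x v w := by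
        intro t
        by_cases ht : t ∈ A
        · exact hdet v v' hvv t ht w hw
        · have h3 := hdet v v' hvv u hu w hw
          have h4 := hdet v v' hvv u hu t ht
          by_cases h5 : x v u = 0
          · have h6 : x v' u ≠ 0 := fun h => hun ⟨h5, h⟩
            rw [h5, zero_mul, eq_comm, mul_eq_zero, or_iff_right h6] at h3 h4
            rw [h3, h4]; ring
          · refine mul_left_cancel₀ h5 ?_
            linear_combination x v t * h3 - x v w * h4
      obtain ⟨n, hn⟩ := hexp v
      obtain ⟨m, hm⟩ := hexp v'
      have e1 := hn v
      have e2 := hn v'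
      have e3 := hm v
      have e4 := hm v'
      change ∑ u, n u * x v u = _ at e1
      change ∑ u, n u * x v' u = _ at e2
      change ∑ u, m u * x v u = _ at e3
      change ∑ u, m u * x v' u = _ at e4
      have hsum : ∀ n : W → ℤ, (∑ u, n u * x v u) * x v' w = (∑ u, n u * x v' u) * x v w := by
        intro n
        rw [Finset.sum_mul, Finset.sum_mul]
        refine Finset.sum_congr rfl fun t _ => ?_
        rw [mul_assoc, hall, mul_assoc]
      have s1 := hsum n
      have s2 := hsum m
      rw [e1, e2] at s1
      rw [e3, e4] at s2
      rw [if_pos rfl, if_neg hvv.ne'] at s1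
      rw [if_pos rfl, if_neg hvv.ne] at s2
      exact hwn ⟨by linarith, by linarith⟩
    have hvanish : ∀ u, (∀ v, x v u = 0) → False := by
      intro u h
      have : (wt Δ (Pi.single u 1)).comp e.symm.toMonoidHom = 1 :=
        raag_hom_ext fun v => by
          have := h v
          exact Multiplicative.toAdd.injective this
      have h2 := DFunLike.congr_fun this (e (gen Δ u))
      have h3 : ((wt Δ (Pi.single u 1)).comp e.symm.toMonoidHom) (e (gen Δ u)) =
          Multiplicative.ofAdd 1 := by
        simp [wt_gen]
      rw [h3] at h2
      exact absurd (congrArg Multiplicative.toAdd h2) (by simp)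
    by_cases hP : ∃ v, ∀ u ∈ A, x v u = 0
    · obtain ⟨v0, hv0⟩ := hP
      have hall : ∀ v, ∀ u ∈ A, x v u = 0 := by
        intro v
        obtain ⟨p⟩ := hΓ.preconnected v0 v
        induction p with
        | nil => exact hv0
        | @cons a b c hab p ih =>
          refine ih ?_
          rcases hedge a b hab with h | h
          · exact h.2
          · exact absurd ⟨hv0, h.1⟩ (hnotboth a)
      exact hvanish u0 fun v => hall v u0 hu0
    · push Not at hP
      refine hvanish w0 fun v => ?_
      obtain ⟨v', hv'⟩ := hΓ.preconnected.exists_adj_of_nontrivial v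
      rcases hedge v v' hv' with h | h
      · obtain ⟨u, hu, hu'⟩ := hP v
        exact absurd (h.1 u hu) hu'
      · exact h.1 w0 hw0
  refine ⟨fun a b => ?_⟩
  have := key {w | Δ.Reachable a w} (fun u hu w huw => hu.trans huw.reachable) ⟨a, .refl _⟩
  have hb : b ∈ ({w | Δ.Reachable a w} : Set W) := this ▸ Set.mem_univ b
  exact hb

end GraphInvariants

instance {V : Type} (Γ : SimpleGraph V) : MeasurableSpace (RAAG Γ) := ⊤

instance {V : Type} (Γ : SimpleGraph V) : DiscreteMeasurableSpace (RAAG Γ) := ⟨fun _ => trivial⟩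

section Selectors

lemma measurable_apply_countable {X Y Z : Type} [MeasurableSpace X] [MeasurableSpace Y]
    [MeasurableSpace Z] [DiscreteMeasurableSpace Z] [Countable Z] {f : Z → X → Y}
    (hf : ∀ z, Measurable (f z)) {φ : X → Z} (hφ : Measurable φ) :
    Measurable fun x => f (φ x) x :=
  (measurable_from_prod_countable_right (f := fun p : Z × X => f p.1 p.2) hf).comp
    (hφ.prodMk measurable_id)

lemma exists_measurable_selector {X Z : Type} [MeasurableSpace X] [MeasurableSpace Z]
    [DiscreteMeasurableSpace Z] [Countable Z] [Nonempty Z] {P : Z → X → Prop}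
    (hP : ∀ z, MeasurableSet {x | P z x}) :
    ∃ s : X → Z, Measurable s ∧ ∀ x, (∃ z, P z x) → P (s x) x := by
  classical
  obtain ⟨e, he⟩ := exists_surjective_nat Z
  have hex : ∀ x, ∃ n, P (e n) x ∨ ∀ m, ¬ P (e m) x := by
    intro x
    by_cases h : ∃ m, P (e m) x
    · exact h.imp fun m hm => Or.inl hm
    · push Not at h; exact ⟨0, Or.inr h⟩
  refine ⟨fun x => e (Nat.find (hex x)), ?_, ?_⟩
  · refine (measurable_of_countable e).comp (measurable_find hex fun k => ?_)
    have : {x | P (e k) x ∨ ∀ m, ¬ P (e m) x} = {x | P (e k) x} ∪ ⋂ m, {x | P (e m) x}ᶜ := by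
      ext x; simp
    rw [this]
    exact (hP _).union (MeasurableSet.iInter fun m => (hP _).compl)
  · rintro x ⟨z, hz⟩
    obtain ⟨m, rfl⟩ := he z
    exact (Nat.find_spec (hex x)).resolve_right fun h => h m hz

end Selectors

section Actions

variable {G : Type} [Group G] {X : Type} [MeasurableSpace X] [MulAction G X] {μ : Measure X}

lemma PmpAction.ae_smul [Countable G] (h : PmpAction G X μ) {p : X → Prop} (hp : ∀ᵐ x ∂μ, p x) :
    ∀ᵐ x ∂μ, ∀ g : G, p (g • x) :=
  ae_all_iff.2 fun g => (h g).quasiMeasurePreserving.ae hp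

lemma FreeAction.ae_free [Countable G] (h : FreeAction G X μ) :
    ∀ᵐ x ∂μ, ∀ g : G, g • x = x → g = 1 := by
  refine ae_all_iff.2 fun g => ?_
  by_cases hg : g = 1
  · simp [hg]
  · have := h g hg
    rw [ae_iff]
    simpa [hg] using this

lemma ae_injective_of_free {x : X} (h : ∀ g : G, g • x = x → g = 1) {g g' : G}
    (hg : g • x = g' • x) : g = g' := by
  have := h (g'⁻¹ * g) (by rw [mul_smul, hg, inv_smul_smul])
  exact (inv_mul_eq_one.1 this).symm

end Actions

section OrbitMaps

variable {G : Type} [Group G] [MeasurableSpace G]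
  {X : Type} [MeasurableSpace X] [MulAction G X]
  {H : Type} [Group H] [MeasurableSpace H]
  {Y : Type} [MeasurableSpace Y] [MulAction H Y]

/-- A measurable cocycle, with the cocycle identities holding almost everywhere. -/
def AECocycle (μ : Measure X) (c : G → X → H) : Prop :=
  (∀ g, Measurable (c g)) ∧ ∀ᵐ x ∂μ, ∀ g g' : G, c (g * g') x = c g (g' • x) * c g' x

/-- A nonsingular map sending orbits to orbits, with its cocycle. -/
structure OrbitMap (μ : Measure X) (ν : Measure Y) (c : G → X → H) (F : X → Y) : Prop where
  qmp : Measure.QuasiMeasurePreserving F μ ν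
  meas_coc : ∀ g, Measurable (c g)
  equivariant : ∀ᵐ x ∂μ, ∀ g : G, F (g • x) = c g x • F x

/-- A pair of orbit maps which are inverse to each other up to moving points in their orbits. -/
structure OrbitPair (μ : Measure X) (ν : Measure Y) (c : G → X → H) (F : X → Y)
    (c' : H → Y → G) (F' : Y → X) (l : X → G) (k : Y → H) : Prop where
  fwd : OrbitMap μ ν c F
  bwd : OrbitMap ν μ c' F'
  meas_left : Measurable l
  meas_right : Measurable k
  left : ∀ᵐ x ∂μ, F' (F x) = l x • x
  right : ∀ᵐ y ∂ν, F (F' y) = k y • y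

variable {μ : Measure X} {ν : Measure Y} {c : G → X → H} {F : X → Y}
  {c' : H → Y → G} {F' : Y → X} {l : X → G} {k : Y → H}

lemma OrbitPair.symm (h : OrbitPair μ ν c F c' F' l k) : OrbitPair ν μ c' F' c F k l :=
  ⟨h.bwd, h.fwd, h.meas_right, h.meas_left, h.right, h.left⟩

variable [Countable G] [Countable H]

lemma OrbitMap.ae_free (h : OrbitMap μ ν c F) (hfree : FreeAction H Y ν) :
    ∀ᵐ x ∂μ, ∀ a : H, a • F x = F x → a = 1 :=
  h.qmp.ae hfree.ae_free

lemma OrbitMap.cocycle (h : OrbitMap μ ν c F) (hpmp : PmpAction G X μ)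
    (hfree : FreeAction H Y ν) : AECocycle μ c := by
  refine ⟨h.meas_coc, ?_⟩
  filter_upwards [h.ae_free hfree, h.equivariant, hpmp.ae_smul h.equivariant] with x h1 h2 h3 g g'
  refine ae_injective_of_free h1 ?_
  rw [← h2, mul_smul, mul_smul, ← h2 g', ← h3 g' g]

/-- The two cocycles of an orbit pair are inverse up to the coboundary of `l`. -/
lemma OrbitPair.cocycle_comp (h : OrbitPair μ ν c F c' F' l k) (hpmp : PmpAction G X μ)
    (hfree : FreeAction G X μ) :
    ∀ᵐ x ∂μ, ∀ g : G, c' (c g x) (F x) = l (g • x) * g * (l x)⁻¹ := by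
  filter_upwards [hfree.ae_free, h.fwd.equivariant, h.fwd.qmp.ae h.bwd.equivariant, h.left,
    hpmp.ae_smul h.left] with x h1 h2 h3 h4 h5 g
  rw [eq_mul_inv_iff_mul_eq]
  refine ae_injective_of_free h1 ?_
  rw [mul_smul, mul_smul, ← h4, ← h3, ← h2, h5]

end OrbitMaps

section FromSOE

variable {G : Type} [Group G] [MeasurableSpace G] [DiscreteMeasurableSpace G] [Countable G]
  {X : Type} [MeasurableSpace X] [MulAction G X]
  {H : Type} [Group H] [MeasurableSpace H] [DiscreteMeasurableSpace H] [Countable H]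
  {Y : Type} [MeasurableSpace Y] [MulAction H Y]
  {μ : Measure X} {ν : Measure Y}

namespace StableOE

lemma null_preimage [IsProbabilityMeasure μ] [IsProbabilityMeasure ν]
    (f : StableOE G X H Y μ ν) {s : Set Y} (hs : ν s = 0) :
    μ (f.U ∩ f.toFun ⁻¹' s) = 0 := by
  have h1 := f.pushforward (toMeasurable ν s ∩ f.V) Set.inter_subset_right
    ((measurableSet_toMeasurable _ _).inter f.measV)
  have h2 : ν (toMeasurable ν s ∩ f.V) = 0 :=
    measure_mono_null Set.inter_subset_left (by rw [measure_toMeasurable, hs])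
  rw [h2, mul_zero, mul_eq_zero, ENNReal.inv_eq_zero] at h1
  refine measure_mono_null ?_ (h1.resolve_left (measure_ne_top _ _))
  rintro x ⟨hx, hxs⟩
  exact ⟨hx, subset_toMeasurable _ _ hxs, f.maps hx⟩

/-- The inverse stable orbit equivalence. -/
lemma exists_symm [IsProbabilityMeasure μ] [IsProbabilityMeasure ν]
    (f : StableOE G X H Y μ ν) :
    ∃ f' : StableOE H Y G X ν μ, f'.U = f.V ∧ f'.V = f.U ∧ f'.toFun = f.invFun ∧
      f'.invFun = f.toFun := by
  have hpush : ∀ A : Set X, A ⊆ f.U → MeasurableSet A →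
      (ν f.V)⁻¹ * ν (f.V ∩ f.invFun ⁻¹' A) = (μ f.U)⁻¹ * μ A := by
    intro A hA hAm
    rw [← f.pushforward (f.V ∩ f.invFun ⁻¹' A) Set.inter_subset_left
      (f.measV.inter (f.meas_invFun hAm))]
    congr 2
    ext x
    constructor
    · rintro ⟨hx, -, hx'⟩
      rw [Set.mem_preimage, f.left_inv x hx] at hx'
      exact hx'
    · intro hx
      refine ⟨hA hx, f.maps (hA hx), ?_⟩
      rw [Set.mem_preimage, f.left_inv x (hA hx)]
      exact hx
  refine ⟨⟨f.V, f.U, f.measV, f.measU, f.posV, f.posU, f.invFun, f.toFun, f.meas_invFun,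
    f.meas_toFun, f.maps_inv, f.maps, f.right_inv, f.left_inv, hpush, ?_⟩, rfl, rfl, rfl, rfl⟩
  obtain ⟨t, hts, htm, ht⟩ := exists_measurable_superset_of_null f.orbit_eq
  have h1 := hpush (t ∩ f.U) Set.inter_subset_right (htm.inter f.measU)
  rw [measure_mono_null Set.inter_subset_left ht, mul_zero, mul_eq_zero,
    ENNReal.inv_eq_zero] at h1
  have h2 := h1.resolve_left (measure_ne_top _ _)
  have h3 : ∀ᵐ y ∂ν, y ∉ f.V ∩ f.invFun ⁻¹' (t ∩ f.U) := measure_eq_zero_iff_ae_notMem.1 h2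
  filter_upwards [h3] with y hy hyV
  have hyt : f.invFun y ∉ t := fun h => hy ⟨hyV, h, f.maps_inv hyV⟩
  have horb : f.invFun y ∈ f.U → f.toFun '' (MulAction.orbit G (f.invFun y) ∩ f.U) =
      MulAction.orbit H (f.toFun (f.invFun y)) ∩ f.V := by
    by_contra h
    exact hyt (hts h)
  have horb := horb (f.maps_inv hyV)
  rw [f.right_inv y hyV] at horb
  rw [← horb]
  ext x
  constructor
  · rintro ⟨_, ⟨x', hx', rfl⟩, rfl⟩
    rw [f.left_inv _ hx'.2]; exact hx'
  · intro hx
    exact ⟨_, ⟨x, hx, rfl⟩, f.left_inv x hx.2⟩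

/-- Extension of a stable orbit equivalence to the whole space. -/
lemma exists_orbitMap [IsProbabilityMeasure μ] [IsProbabilityMeasure ν]
    [StandardBorelSpace Y]
    (f : StableOE G X H Y μ ν) (hpmp : PmpAction G X μ) (hpmp' : PmpAction H Y ν)
    (herg : ∀ᵐ x ∂μ, ∃ g : G, g • x ∈ f.U) :
    ∃ (p : X → G) (c : G → X → H), Measurable p ∧ (∀ᵐ x ∂μ, p x • x ∈ f.U) ∧
      OrbitMap μ ν c fun x => f.toFun (p x • x) := by
  obtain ⟨p, hpm, hp⟩ := exists_measurable_selector (X := X) (Z := G)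
    (P := fun g x => g • x ∈ f.U) fun g => (hpmp g).measurable f.measU
  have hpU : ∀ᵐ x ∂μ, p x • x ∈ f.U := herg.mono fun x hx => hp x hx
  have hFm : Measurable fun x => f.toFun (p x • x) :=
    f.meas_toFun.comp (measurable_apply_countable (fun g => (hpmp g).measurable) hpm)
  have hcex : ∀ g : G, ∃ s : X → H, Measurable s ∧
      ∀ x, (∃ h : H, f.toFun (p (g • x) • g • x) = h • f.toFun (p x • x)) →
        f.toFun (p (g • x) • g • x) = s x • f.toFun (p x • x) := by
    intro g
    refine exists_measurable_selector fun h => ?_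
    exact measurableSet_eq_fun (hFm.comp (hpmp g).measurable) ((hpmp' h).measurable.comp hFm)
  choose c hcm hc using hcex
  refine ⟨p, c, hpm, hpU, ⟨hFm, ?_⟩, hcm, ?_⟩
  · refine Measure.AbsolutelyContinuous.mk fun s hs hs0 => ?_
    rw [Measure.map_apply hFm hs]
    have h1 := f.null_preimage hs0
    have h2 : ∀ᵐ x ∂μ, x ∉ f.U ∩ f.toFun ⁻¹' s := measure_eq_zero_iff_ae_notMem.1 h1
    rw [measure_eq_zero_iff_ae_notMem]
    filter_upwards [hpmp.ae_smul h2, hpU] with x hx hxU hxs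
    exact hx (p x) ⟨hxU, hxs⟩
  · filter_upwards [hpU, hpmp.ae_smul hpU, hpmp.ae_smul f.orbit_eq] with x h1 h2 h3 g
    refine hc g x ?_
    have h4 := h3 (p x) h1
    have h5 : f.toFun (p (g • x) • g • x) ∈
        f.toFun '' (MulAction.orbit G (p x • x) ∩ f.U) := by
      refine ⟨_, ⟨⟨p (g • x) * g * (p x)⁻¹, ?_⟩, h2 g⟩, rfl⟩
      change (p (g • x) * g * (p x)⁻¹) • p x • x = _
      rw [mul_smul, inv_smul_smul, mul_smul]
    rw [h4] at h5
    obtain ⟨h, hh⟩ := h5.1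
    exact ⟨h, hh.symm⟩

lemma exists_orbitPair_aux [IsProbabilityMeasure μ] [IsProbabilityMeasure ν]
    [StandardBorelSpace X]
    (f : StableOE G X H Y μ ν) (hpmp : PmpAction G X μ) {p : X → G} {q : Y → H} {c : G → X → H}
    {c' : H → Y → G}
    (hp : ∀ᵐ x ∂μ, p x • x ∈ f.U) (hq : ∀ᵐ y ∂ν, q y • y ∈ f.V)
    (hF : OrbitMap μ ν c fun x => f.toFun (p x • x))
    (hF' : OrbitMap ν μ c' fun y => f.invFun (q y • y)) :
    ∃ l : X → G, Measurable l ∧ ∀ᵐ x ∂μ,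
      f.invFun (q (f.toFun (p x • x)) • f.toFun (p x • x)) = l x • x := by
  obtain ⟨l, hlm, hl⟩ := exists_measurable_selector (X := X) (Z := G)
    (P := fun g x => f.invFun (q (f.toFun (p x • x)) • f.toFun (p x • x)) = g • x) fun g => by
      exact measurableSet_eq_fun (hF'.qmp.measurable.comp hF.qmp.measurable)
        (hpmp g).measurable
  refine ⟨l, hlm, ?_⟩
  filter_upwards [hp, hF.qmp.ae hq, hpmp.ae_smul f.orbit_eq] with x h1 h2 h3
  refine hl x ?_
  have h4 : q (f.toFun (p x • x)) • f.toFun (p x • x) ∈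
      MulAction.orbit H (f.toFun (p x • x)) ∩ f.V := ⟨⟨_, rfl⟩, h2⟩
  rw [← h3 (p x) h1] at h4
  obtain ⟨u, ⟨⟨g, rfl⟩, hu⟩, hu'⟩ := h4
  refine ⟨g * p x, ?_⟩
  rw [← hu', f.left_inv _ hu, mul_smul]

theorem exists_orbitPair [IsProbabilityMeasure μ] [IsProbabilityMeasure ν]
    [StandardBorelSpace X] [StandardBorelSpace Y]
    (f : StableOE G X H Y μ ν) (hpmp : PmpAction G X μ) (hpmp' : PmpAction H Y ν)
    {g₀ : G} (herg : Ergodic (fun x : X => g₀ • x) μ)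
    {h₀ : H} (herg' : Ergodic (fun y : Y => h₀ • y) ν) :
    ∃ c F c' F' l k, OrbitPair (G := G) (H := H) μ ν c F c' F' l k := by
  have sweep : ∀ {K : Type} [Group K] [Countable K] {Z : Type} [MeasurableSpace Z] [MulAction K Z]
      {ρ : Measure Z} [IsProbabilityMeasure ρ] (_ : PmpAction K Z ρ) {k₀ : K}
      (_ : Ergodic (fun z : Z => k₀ • z) ρ) {U : Set Z} (_ : MeasurableSet U) (_ : 0 < ρ U),
      ∀ᵐ z ∂ρ, ∃ k : K, k • z ∈ U := by
    intro K _ _ Z _ _ ρ _ hK k₀ hk₀ U hU hpos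
    have hm : MeasurableSet {z | ∃ k : K, k • z ∈ U} := by
      rw [show {z : Z | ∃ k : K, k • z ∈ U} = ⋃ k : K, {z | k • z ∈ U} from by ext; simp]
      exact MeasurableSet.iUnion fun k => (hK k).measurable hU
    have hinv : (fun z : Z => k₀ • z) ⁻¹' {z | ∃ k : K, k • z ∈ U} = {z | ∃ k : K, k • z ∈ U} := by
      ext z
      constructor
      · rintro ⟨k, hk⟩
        exact ⟨k * k₀, by rwa [mul_smul]⟩
      · rintro ⟨k, hk⟩
        refine ⟨k * k₀⁻¹, ?_⟩
        change (k * k₀⁻¹) • k₀ • z ∈ U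
        rwa [mul_smul, inv_smul_smul]
    rcases hk₀.prob_eq_zero_or_one hm hinv with h | h
    · have : ρ U ≤ ρ {z | ∃ k : K, k • z ∈ U} :=
        measure_mono fun z hz => ⟨1, by rwa [one_smul]⟩
      rw [h] at this
      exact absurd hpos (not_lt.2 this)
    · rwa [← prob_compl_eq_zero_iff hm] at h
  obtain ⟨f', hU, hV, hto, hinv⟩ := f.exists_symm
  obtain ⟨p, c, hpm, hp, hF⟩ := f.exists_orbitMap hpmp hpmp' (sweep hpmp herg f.measU f.posU)
  obtain ⟨q, c', hqm, hq, hF'⟩ := f'.exists_orbitMap hpmp' hpmp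
    (sweep hpmp' herg' f'.measU f'.posU)
  rw [hU] at hq
  rw [hto] at hF'
  obtain ⟨l, hlm, hl⟩ := f.exists_orbitPair_aux hpmp hp hq hF hF'
  rw [← hU] at hq
  rw [← hto] at hF'
  rw [← hV] at hp
  rw [← hinv] at hF
  obtain ⟨k, hkm, hk⟩ := f'.exists_orbitPair_aux hpmp' hq hp hF' hF
  rw [hinv] at hF
  rw [hto] at hF'
  rw [hinv, hto] at hk
  exact ⟨c, _, c', _, l, k, hF, hF', hlm, hkm, hl, hk⟩

end StableOE

end FromSOE

section Reduction

variable {G : Type} [Group G] {X : Type} [MeasurableSpace X] [MulAction G X]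
  {H : Type} [Group H] [MeasurableSpace H]

/-- The cocycle `c`, restricted to the element `b`, is cohomologous to one with values in `K`. -/
def Reduces (μ : Measure X) (c : G → X → H) (b : G) (K : Subgroup H) : Prop :=
  ∃ φ : X → H, Measurable φ ∧ ∀ᵐ x ∂μ, (φ (b • x))⁻¹ * c b x * φ x ∈ K

lemma reduces_top (μ : Measure X) (c : G → X → H) (b : G) : Reduces μ c b ⊤ :=
  ⟨fun _ => 1, measurable_const, by simp⟩

end Reduction

section RAAGReduction

variable {V : Type} {Γ : SimpleGraph V}
  {G : Type} [Group G] {X : Type} [MeasurableSpace X] [MulAction G X]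
  {μ : Measure X} {c : G → X → RAAG Γ} {b : G}

lemma Reduces.inter [Countable V] {S T : Set V} (hS : Reduces μ c b (standardSub Γ S))
    (hT : Reduces μ c b (standardSub Γ T)) : Reduces μ c b (standardSub Γ (S ∩ T)) := by
  obtain ⟨φ, hφm, hφ⟩ := hS
  obtain ⟨ψ, hψm, hψ⟩ := hT
  refine ⟨fun x => φ x * retr Γ S ((φ x)⁻¹ * ψ x), ?_, ?_⟩
  · exact hφm.mul ((measurable_of_countable _).comp (hφm.inv.mul hψm))
  · filter_upwards [hφ, hψ] with x h1 h2
    have e1 := retr_mem_inter (S := S) h2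
    have e2 : (ψ (b • x))⁻¹ * c b x * ψ x = ((φ (b • x))⁻¹ * ψ (b • x))⁻¹ *
        ((φ (b • x))⁻¹ * c b x * φ x) * ((φ x)⁻¹ * ψ x) := by group
    rw [e2, map_mul, map_mul, retr_of_mem h1, map_inv] at e1
    convert e1 using 1
    group

/-- The set of vertices that cannot be removed from the support of `c b`. -/
def hull (μ : Measure X) (c : G → X → RAAG Γ) (b : G) : Set V :=
  {v | ¬ Reduces μ c b (standardSub Γ {v}ᶜ)}

lemma reduces_hull [Finite V] (μ : Measure X) (c : G → X → RAAG Γ) (b : G) :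
    Reduces μ c b (standardSub Γ (hull μ c b)) := by
  have key : ∀ s : Set V, s.Finite → s ⊆ (hull μ c b)ᶜ → Reduces μ c b (standardSub Γ sᶜ) := by
    intro s hs
    induction s, hs using Set.Finite.induction_on with
    | empty =>
      intro _
      rw [Set.compl_empty, standardSub_univ]
      exact reduces_top μ c b
    | insert _ _ ih =>
      intro h
      rw [Set.insert_subset_iff] at h
      rw [Set.insert_eq, Set.compl_union]
      exact Reduces.inter (not_not.1 h.1) (ih h.2)
  have := key (hull μ c b)ᶜ (Set.toFinite _) le_rfl
  rwa [compl_compl] at this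

end RAAGReduction

section Pushforward

variable {I J : Type}

open Classical in
/-- The pushforward of a function under a map, by summation over fibres. -/
noncomputable def pushSum (p : I → J) (f : I → ℝ≥0∞) (j : J) : ℝ≥0∞ :=
  ∑' i, if p i = j then f i else 0

lemma tsum_pushSum (p : I → J) (f : I → ℝ≥0∞) : ∑' j, pushSum p f j = ∑' i, f i := by
  unfold pushSum
  rw [ENNReal.tsum_comm]
  refine tsum_congr fun i => ?_
  rw [tsum_eq_single (p i)]
  · simp
  · intro j hj
    simp [Ne.symm hj]

lemma tsum_ed_pushSum_le (p : I → J) (f g : I → ℝ≥0∞) :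
    ∑' j, ed (pushSum p f j) (pushSum p g j) ≤ ∑' i, ed (f i) (g i) := by
  rw [← tsum_pushSum p fun i => ed (f i) (g i)]
  refine ENNReal.tsum_le_tsum fun j => ?_
  refine (ed_tsum_le _ _).trans_eq (tsum_congr fun i => ?_)
  split_ifs <;> simp

lemma pushSum_smul {H : Type} [Group H] [MulAction H I] [MulAction H J] {p : I → J}
    (hp : ∀ (h : H) i, p (h • i) = h • p i) (f : I → ℝ≥0∞) (h : H) (j : J) :
    pushSum p f (h • j) = pushSum p (fun i => f (h • i)) j := by
  unfold pushSum
  rw [← (MulAction.toPerm h).tsum_eq]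
  refine tsum_congr fun i => ?_
  have : p (h • i) = h • j ↔ p i = j := by rw [hp, smul_left_cancel_iff]
  by_cases hi : p i = j
  · exact (if_pos (this.2 hi)).trans (if_pos hi).symm
  · exact (if_neg fun h' => hi (this.1 h')).trans (if_neg hi).symm

lemma measurable_pushSum [Countable I] {X : Type} [MeasurableSpace X] (p : I → J)
    {f : X → I → ℝ≥0∞} (hf : ∀ i, Measurable fun x => f x i) (j : J) :
    Measurable fun x => pushSum p (f x) j := by
  unfold pushSum
  refine Measurable.tsum fun i => ?_
  split_ifs
  exacts [hf i, measurable_const]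

lemma tsum_mul_prod (f : I → ℝ≥0∞) (g : J → ℝ≥0∞) :
    ∑' q : I × J, f q.1 * g q.2 = (∑' i, f i) * ∑' j, g j := by
  rw [ENNReal.tsum_prod', ← ENNReal.tsum_mul_right]
  exact tsum_congr fun i => ENNReal.tsum_mul_left (a := f i) (f := g)

lemma tsum_ed_prod_le {f f' : I → ℝ≥0∞} {g g' : J → ℝ≥0∞} (hf' : ∑' i, f' i = 1)
    (hg : ∑' j, g j = 1) :
    ∑' q : I × J, ed (f q.1 * g q.2) (f' q.1 * g' q.2) ≤
      ∑' i, ed (f i) (f' i) + ∑' j, ed (g j) (g' j) := by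
  have hf1 : ∀ i, f' i ≠ ∞ := fun i => ne_top_of_le_ne_top (by simp [hf']) (ENNReal.le_tsum i)
  have hg1 : ∀ i, g i ≠ ∞ := fun i => ne_top_of_le_ne_top (by simp [hg]) (ENNReal.le_tsum i)
  calc ∑' q : I × J, ed (f q.1 * g q.2) (f' q.1 * g' q.2)
      ≤ ∑' q : I × J, (ed (f q.1) (f' q.1) * g q.2 + f' q.1 * ed (g q.2) (g' q.2)) := by
        refine ENNReal.tsum_le_tsum fun q => (ed_triangle _ (f' q.1 * g q.2) _).trans ?_
        rw [ed_mul_left (hf1 _), ed_mul_right (hg1 _)]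
    _ = _ := by
        rw [ENNReal.tsum_add, tsum_mul_prod (fun i => ed (f i) (f' i)) g,
          tsum_mul_prod f' (fun j => ed (g j) (g' j)), hg, hf', mul_one, one_mul]

end Pushforward

section RelativeAmenability

lemma countable_quotient {H : Type} [Group H] [Countable H] (K : Subgroup H) :
    Countable (H ⧸ K) :=
  Quotient.countable

open Filter Topology

variable {G : Type} [Group G] {X : Type} [MeasurableSpace X] [MulAction G X]
  {H : Type} [Group H]

/-- Amenability of the action of `A` on `X` relative to the coset space of `K` via `c`. -/
def AmenRel (μ : Measure X) (c : G → X → H) (A : Set G) (K : Subgroup H) : Prop :=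
  ∃ ξ : ℕ → X → H ⧸ K → ℝ≥0∞, (∀ n d, Measurable fun x => ξ n x d) ∧
    (∀ n, ∀ᵐ x ∂μ, ∑' d, ξ n x d = 1) ∧
    ∀ a ∈ A, ∀ᵐ x ∂μ, Tendsto (fun n => ∑' d, ed (ξ n (a • x) (c a x • d)) (ξ n x d))
      atTop (𝓝 0)

lemma amenRel_top (μ : Measure X) (c : G → X → H) (A : Set G) : AmenRel μ c A ⊤ := by
  refine ⟨fun _ _ _ => 1, fun _ _ => measurable_const, fun n => ?_, ?_⟩
  · have : Unique (H ⧸ (⊤ : Subgroup H)) :=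
      ⟨⟨((1 : H) : H ⧸ (⊤ : Subgroup H))⟩, fun a => by
        induction a using QuotientGroup.induction_on with
        | H a => exact QuotientGroup.eq.2 trivial⟩
    simp
  · intro a _
    simp

/-- Relative amenability pushes forward along equivariant maps from a product of coset spaces. -/
lemma AmenRel.prod_map [Countable H] {μ : Measure X} {c : G → X → H} {A : Set G}
    {K L M : Subgroup H} (hpmp : PmpAction G X μ)
    (hK : AmenRel μ c A K) (hL : AmenRel μ c A L) (p : (H ⧸ K) × (H ⧸ L) → H ⧸ M)
    (hp : ∀ (h : H) q, p (h • q) = h • p q) : AmenRel μ c A M := by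
  obtain ⟨ξ, hξm, hξ1, hξ⟩ := hK
  obtain ⟨η, hηm, hη1, hη⟩ := hL
  have := countable_quotient K
  have := countable_quotient L
  refine ⟨fun n x => pushSum p fun q => ξ n x q.1 * η n x q.2, fun n d => ?_, fun n => ?_,
    fun a ha => ?_⟩
  · exact measurable_pushSum p (fun q => (hξm n q.1).mul (hηm n q.2)) d
  · filter_upwards [hξ1 n, hη1 n] with x h1 h2
    rw [tsum_pushSum, tsum_mul_prod (ξ n x) (η n x), h1, h2, one_mul]
  · have hη1' : ∀ᵐ x ∂μ, ∀ n, ∑' d, η n (a • x) d = 1 :=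
      ae_all_iff.2 fun n => (hpmp a).quasiMeasurePreserving.ae (hη1 n)
    filter_upwards [hξ a ha, hη a ha, ae_all_iff.2 hξ1, hη1'] with x h1 h2 h3 h4
    have h5 := h1.add h2
    rw [add_zero] at h5
    refine tendsto_of_tendsto_of_tendsto_of_le_of_le tendsto_const_nhds h5
      (fun n => zero_le) fun n => ?_
    simp only [pushSum_smul hp]
    refine (tsum_ed_pushSum_le _ _ _).trans ?_
    have h4' : ∑' d, η n (a • x) (c a x • d) = 1 := by
      rw [← h4 n]
      exact (MulAction.toPerm (c a x)).tsum_eq fun d => η n (a • x) d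
    exact tsum_ed_prod_le (f := fun d => ξ n (a • x) (c a x • d)) (f' := ξ n x)
      (g := fun d => η n (a • x) (c a x • d)) (g' := η n x) (h3 n) h4'

lemma exists_coset_inter_map {V : Type} (Γ : SimpleGraph V) (S T : Set V) :
    ∃ p : (RAAG Γ ⧸ standardSub Γ S) × (RAAG Γ ⧸ standardSub Γ T) →
      RAAG Γ ⧸ standardSub Γ (S ∩ T), ∀ (h : RAAG Γ) q, p (h • q) = h • p q := by
  refine ⟨fun q => Quotient.liftOn₂' q.1 q.2
    (fun a b => ((a * retr Γ S (a⁻¹ * b) : RAAG Γ) : RAAG Γ ⧸ standardSub Γ (S ∩ T))) ?_, ?_⟩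
  · intro a b a' b' ha hb
    rw [QuotientGroup.leftRel_apply] at ha hb
    rw [QuotientGroup.eq]
    have e1 := retr_mem_inter (S := S) hb
    have e2 : b⁻¹ * b' = (a⁻¹ * b)⁻¹ * (a⁻¹ * a') * (a'⁻¹ * b') := by group
    rw [e2, map_mul, map_mul, map_inv, retr_of_mem ha] at e1
    convert e1 using 1
    group
  · rintro h ⟨i, j⟩
    induction i using QuotientGroup.induction_on with
    | H a =>
      induction j using QuotientGroup.induction_on with
      | H b =>
        change (((h * a) * retr Γ S ((h * a)⁻¹ * (h * b)) : RAAG Γ) :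
          RAAG Γ ⧸ standardSub Γ (S ∩ T)) =
          ((h * (a * retr Γ S (a⁻¹ * b)) : RAAG Γ) : RAAG Γ ⧸ standardSub Γ (S ∩ T))
        congr 1
        rw [show (h * a)⁻¹ * (h * b) = a⁻¹ * b by group, mul_assoc]

lemma AmenRel.biInter {V : Type} [Finite V] {Γ : SimpleGraph V} {μ : Measure X}
    {c : G → X → RAAG Γ} {A : Set G} (hpmp : PmpAction G X μ) (T : V → Set V) (S : Set V)
    (h : ∀ v ∈ S, AmenRel μ c A (standardSub Γ (T v))) :
    AmenRel μ c A (standardSub Γ (⋂ v ∈ S, T v)) := by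
  induction S, S.toFinite using Set.Finite.induction_on with
  | empty =>
    simp only [Set.mem_empty_iff_false, Set.iInter_of_empty, Set.iInter_univ, standardSub_univ]
    exact amenRel_top μ c A
  | @insert a s _ _ ih =>
    rw [Set.biInter_insert]
    obtain ⟨p, hp⟩ := exists_coset_inter_map Γ (T a) (⋂ v ∈ s, T v)
    exact AmenRel.prod_map hpmp (h _ (Set.mem_insert _ _))
      (ih fun v hv => h v (Set.mem_insert_of_mem _ hv)) p hp

end RelativeAmenability

section NormalizedFinsupp

variable {D : Type}

lemma coe_finsuppNorm (f : D →₀ ℤ) :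
    (finsuppNorm f : ℝ≥0∞) = ∑' d, ((f d).natAbs : ℝ≥0∞) := by
  rw [tsum_eq_sum (s := f.support)]
  · simp [finsuppNorm, Finsupp.sum]
  · intro d hd
    simp [Finsupp.notMem_support_iff.1 hd]

lemma finsuppNorm_eq_zero {f : D →₀ ℤ} : finsuppNorm f = 0 ↔ f = 0 := by
  constructor
  · intro h
    ext d
    have h1 : (finsuppNorm f : ℝ≥0∞) = 0 := by simp [h]
    rw [coe_finsuppNorm, ENNReal.tsum_eq_zero] at h1
    simpa using h1 d
  · rintro rfl
    simp [finsuppNorm]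

lemma finsuppNorm_add_le (f g : D →₀ ℤ) :
    finsuppNorm (f + g) ≤ finsuppNorm f + finsuppNorm g := by
  have : (finsuppNorm (f + g) : ℝ≥0∞) ≤ finsuppNorm f + finsuppNorm g := by
    rw [coe_finsuppNorm, coe_finsuppNorm, coe_finsuppNorm, ← ENNReal.tsum_add]
    refine ENNReal.tsum_le_tsum fun d => ?_
    exact_mod_cast Int.natAbs_add_le (f d) (g d)
  exact_mod_cast this

lemma finsuppNorm_neg (f : D →₀ ℤ) : finsuppNorm (-f) = finsuppNorm f := by
  have : (finsuppNorm (-f) : ℝ≥0∞) = finsuppNorm f := by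
    rw [coe_finsuppNorm, coe_finsuppNorm]
    simp
  exact_mod_cast this

open Classical in
/-- The absolute value of a finitely supported function, normalised to a probability. -/
noncomputable def finsuppProb (d₀ : D) (f : D →₀ ℤ) (d : D) : ℝ≥0∞ :=
  if f = 0 then (if d = d₀ then 1 else 0) else ((f d).natAbs : ℝ≥0∞) * (finsuppNorm f : ℝ≥0∞)⁻¹

lemma tsum_finsuppProb (d₀ : D) (f : D →₀ ℤ) : ∑' d, finsuppProb d₀ f d = 1 := by
  unfold finsuppProb
  split_ifs with h
  · rw [tsum_eq_single d₀ fun d hd => if_neg hd, if_pos rfl]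
  · rw [ENNReal.tsum_mul_right, ← coe_finsuppNorm]
    refine ENNReal.mul_inv_cancel ?_ (ENNReal.natCast_ne_top _)
    exact_mod_cast fun h' => h (finsuppNorm_eq_zero.1 h')

lemma ed_natAbs_le (a b : ℤ) :
    ed ((a.natAbs : ℕ) : ℝ≥0∞) ((b.natAbs : ℕ) : ℝ≥0∞) ≤ ((a - b).natAbs : ℝ≥0∞) := by
  unfold ed
  rw [← ENNReal.natCast_sub, ← ENNReal.natCast_sub]
  exact_mod_cast (by omega : a.natAbs - b.natAbs + (b.natAbs - a.natAbs) ≤ (a - b).natAbs)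

lemma tsum_ed_finsuppProb_le (d₀ d₁ : D) {f g : D →₀ ℤ} (hf : f ≠ 0) (hg : g ≠ 0) :
    ∑' d, ed (finsuppProb d₀ f d) (finsuppProb d₁ g d) ≤
      2 * finsuppNorm (f - g) * (finsuppNorm g : ℝ≥0∞)⁻¹ := by
  have hF : (finsuppNorm f : ℝ≥0∞) ≠ 0 := by
    exact_mod_cast fun h' => hf (finsuppNorm_eq_zero.1 h')
  have hG : (finsuppNorm g : ℝ≥0∞) ≠ 0 := by
    exact_mod_cast fun h' => hg (finsuppNorm_eq_zero.1 h')
  have hGi : (finsuppNorm g : ℝ≥0∞)⁻¹ ≠ ∞ := ENNReal.inv_ne_top.2 hG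
  have hsub : ∑' d, ed ((f d).natAbs : ℝ≥0∞) ((g d).natAbs : ℝ≥0∞) ≤ finsuppNorm (f - g) := by
    rw [coe_finsuppNorm]
    exact ENNReal.tsum_le_tsum fun d => ed_natAbs_le _ _
  calc ∑' d, ed (finsuppProb d₀ f d) (finsuppProb d₁ g d)
      ≤ ∑' d, (((f d).natAbs : ℝ≥0∞) * ed (finsuppNorm f : ℝ≥0∞)⁻¹ (finsuppNorm g : ℝ≥0∞)⁻¹ +
          ed ((f d).natAbs : ℝ≥0∞) ((g d).natAbs : ℝ≥0∞) * (finsuppNorm g : ℝ≥0∞)⁻¹) := by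
        refine ENNReal.tsum_le_tsum fun d => ?_
        rw [finsuppProb, finsuppProb, if_neg hf, if_neg hg]
        refine (ed_triangle _ (((f d).natAbs : ℝ≥0∞) * (finsuppNorm g : ℝ≥0∞)⁻¹) _).trans ?_
        rw [ed_mul_left (ENNReal.natCast_ne_top _), ed_mul_right hGi]
    _ = finsuppNorm f * ed (finsuppNorm f : ℝ≥0∞)⁻¹ (finsuppNorm g : ℝ≥0∞)⁻¹ +
          (∑' d, ed ((f d).natAbs : ℝ≥0∞) ((g d).natAbs : ℝ≥0∞)) * (finsuppNorm g : ℝ≥0∞)⁻¹ := by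
        rw [ENNReal.tsum_add, ENNReal.tsum_mul_right, ENNReal.tsum_mul_right, ← coe_finsuppNorm]
    _ ≤ finsuppNorm (f - g) * (finsuppNorm g : ℝ≥0∞)⁻¹ +
          finsuppNorm (f - g) * (finsuppNorm g : ℝ≥0∞)⁻¹ := by
        refine add_le_add ?_ (by gcongr)
        rw [← ed_mul_left (ENNReal.natCast_ne_top _), ENNReal.mul_inv_cancel hF
          (ENNReal.natCast_ne_top _), ← ENNReal.mul_inv_cancel hG (ENNReal.natCast_ne_top _),
          ed_mul_right hGi]
        gcongr
        refine le_trans ?_ hsub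
        rw [coe_finsuppNorm, coe_finsuppNorm, ed_comm]
        exact ed_tsum_le _ _
    _ = 2 * finsuppNorm (f - g) * (finsuppNorm g : ℝ≥0∞)⁻¹ := by ring

variable {V : Type} {Γ : SimpleGraph V}

lemma finsuppNorm_finsuppAct (v : V) (g : RAAG Γ) (f : LinkCoset Γ v →₀ ℤ) :
    finsuppNorm (finsuppAct Γ v g f) = finsuppNorm f := by
  have : (finsuppNorm (finsuppAct Γ v g f) : ℝ≥0∞) = finsuppNorm f := by
    rw [coe_finsuppNorm, coe_finsuppNorm, ← (MulAction.toPerm g).tsum_eq]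
    refine tsum_congr fun d => ?_
    have := finsuppAct_apply_smul v g f d
    exact congrArg (fun z : ℤ => ((z.natAbs : ℕ) : ℝ≥0∞)) this
  exact_mod_cast this

lemma finsuppNorm_linkCocycle_inv (v : V) (g : RAAG Γ) :
    finsuppNorm (linkCocycle Γ v g⁻¹) = finsuppNorm (linkCocycle Γ v g) := by
  rw [linkCocycle_inv, finsuppNorm_neg, finsuppNorm_finsuppAct]

lemma finsuppProb_smul (v : V) (d₀ : LinkCoset Γ v) {f : LinkCoset Γ v →₀ ℤ} (hf : f ≠ 0)
    (g : RAAG Γ) (d : LinkCoset Γ v) :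
    finsuppProb d₀ f (g • d) = finsuppProb d₀ (finsuppAct Γ v g⁻¹ f) d := by
  have h1 : finsuppAct Γ v g⁻¹ f ≠ 0 := by
    rw [Ne, ← finsuppNorm_eq_zero, finsuppNorm_finsuppAct, finsuppNorm_eq_zero]; exact hf
  rw [finsuppProb, finsuppProb, if_neg hf, if_neg h1, finsuppNorm_finsuppAct, finsuppAct_apply,
    inv_inv]

/-- The normalised link cocycle is almost invariant under bounded perturbation of long elements. -/
lemma tsum_ed_linkProb_le (v : V) (d₀ : LinkCoset Γ v) (a h a' : RAAG Γ) {R k : ℕ} (hk : 1 ≤ k)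
    (ha : finsuppNorm (linkCocycle Γ v a) ≤ R) (ha' : finsuppNorm (linkCocycle Γ v a') ≤ R)
    (hh : 2 ^ k * R < vlen Γ v h) :
    ∑' d, ed (finsuppProb d₀ (linkCocycle Γ v (a * h * a'⁻¹)) (a • d))
      (finsuppProb d₀ (linkCocycle Γ v h) d) ≤ 4 * (2⁻¹ : ℝ≥0∞) ^ k := by
  have hnorm := hh.trans_le (vlen_le_finsuppNorm v h)
  have hk2 : 2 * R ≤ 2 ^ k * R := by
    gcongr
    calc 2 = 2 ^ 1 := rfl
      _ ≤ 2 ^ k := Nat.pow_le_pow_right (by norm_num) hk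
  set g := linkCocycle Γ v h
  set f := linkCocycle Γ v (a * h * a'⁻¹) with hf
  have hg0 : g ≠ 0 := by rw [Ne, ← finsuppNorm_eq_zero]; omega
  have hfg : finsuppNorm (finsuppAct Γ v a⁻¹ f - g) ≤ 2 * R := by
    have e1 : finsuppAct Γ v a⁻¹ f - g = finsuppAct Γ v a⁻¹ (linkCocycle Γ v a) +
        finsuppAct Γ v h (linkCocycle Γ v a'⁻¹) := by
      rw [hf, mul_assoc, linkCocycle_mul, map_add, ← finsuppAct_mul, inv_mul_cancel,
        finsuppAct_one, linkCocycle_mul]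
      abel
    rw [e1]
    refine (finsuppNorm_add_le _ _).trans ?_
    rw [finsuppNorm_finsuppAct, finsuppNorm_finsuppAct, finsuppNorm_linkCocycle_inv]
    omega
  have hf1 : finsuppAct Γ v a⁻¹ f ≠ 0 := by
    intro h0
    rw [h0, zero_sub, finsuppNorm_neg] at hfg
    omega
  have hf0 : f ≠ 0 := by
    rintro h0
    rw [h0, map_zero] at hf1
    exact hf1 rfl
  simp only [finsuppProb_smul v d₀ hf0]
  refine (tsum_ed_finsuppProb_le d₀ d₀ hf1 hg0).trans ?_
  have hG : (finsuppNorm g : ℝ≥0∞) ≠ 0 := by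
    exact_mod_cast fun h' => hg0 (finsuppNorm_eq_zero.1 h')
  rw [← div_eq_mul_inv]
  refine ENNReal.div_le_of_le_mul ?_
  have h2 : (2 * (finsuppNorm (finsuppAct Γ v a⁻¹ f - g) : ℝ≥0∞)) ≤ 4 * R := by
    exact_mod_cast (by omega : 2 * finsuppNorm (finsuppAct Γ v a⁻¹ f - g) ≤ 4 * R)
  have h3 : (2 : ℝ≥0∞) ^ k * R ≤ finsuppNorm g := by exact_mod_cast hnorm.le
  calc (2 * (finsuppNorm (finsuppAct Γ v a⁻¹ f - g) : ℝ≥0∞)) ≤ 4 * R := h2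
    _ = 4 * 2⁻¹ ^ k * (2 ^ k * R) := by
      rw [mul_assoc, ← mul_assoc (2⁻¹ ^ k), ← mul_pow, ENNReal.inv_mul_cancel (by norm_num)
        (by norm_num), one_pow, one_mul]
    _ ≤ 4 * 2⁻¹ ^ k * finsuppNorm g := by gcongr

end NormalizedFinsupp

section Escape

open Filter Topology

lemma exists_nat_measure_lt {X : Type} [MeasurableSpace X] {μ : Measure X} [IsFiniteMeasure μ]
    {f : X → ℕ} (hf : Measurable f) {ε : ℝ≥0∞} (hε : 0 < ε) : ∃ R : ℕ, μ {x | R < f x} < ε := by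
  have h := tendsto_measure_iInter_atTop (μ := μ) (s := fun R : ℕ => {x | R < f x})
    (fun R => (measurableSet_lt measurable_const hf).nullMeasurableSet)
    (fun R S hRS x hx => lt_of_le_of_lt hRS hx) ⟨0, measure_ne_top _ _⟩
  have h0 : (⋂ R : ℕ, {x | R < f x}) = ∅ := by
    ext x
    simp only [Set.mem_iInter, Set.mem_ofPred_eq, Set.mem_empty_iff_false, iff_false]
    exact fun hx => lt_irrefl _ (hx (f x))
  rw [h0, measure_empty] at h
  exact (h.eventually (gt_mem_nhds hε)).exists

variable {V : Type} [Countable V] {Γ : SimpleGraph V}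
  {G : Type} [Group G] [Countable G] {X : Type} [MeasurableSpace X] [MulAction G X]
  {μ : Measure X} [IsProbabilityMeasure μ] {c : G → X → RAAG Γ}

lemma amenRel_of_escape (hpmp : PmpAction G X μ) (hc : AECocycle μ c) {b : G} {v : V}
    (hesc : ∀ k : ℕ, ∀ ε : ℝ≥0∞, 0 < ε → ∃ n : ℕ, μ {x | vlen Γ v (c (b ^ n) x) ≤ k} < ε) :
    AmenRel μ c {a | Commute a b} (standardSub Γ (lk Γ v)) := by
  obtain ⟨e, he⟩ := exists_surjective_nat G
  have hN : ∀ g, Measurable fun x => finsuppNorm (linkCocycle Γ v (c g x)) := fun g =>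
    (measurable_of_countable fun h : RAAG Γ => finsuppNorm (linkCocycle Γ v h)).comp (hc.1 g)
  have hM : ∀ k : ℕ, Measurable fun x =>
      ∑ i ∈ Finset.range k, finsuppNorm (linkCocycle Γ v (c (e i) x)) := fun k =>
    Finset.measurable_sum _ fun i _ => hN (e i)
  have hpos : ∀ k : ℕ, (0 : ℝ≥0∞) < 2⁻¹ ^ k := fun k => ENNReal.pow_pos (by simp) k
  choose R hR using fun k : ℕ => exists_nat_measure_lt (μ := μ) (hM k) (hpos k)
  choose n hn using fun k : ℕ => hesc (2 ^ k * R k) _ (hpos k)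
  set d₀ : LinkCoset Γ v := ((1 : RAAG Γ) : LinkCoset Γ v)
  refine ⟨fun k x d => finsuppProb d₀ (linkCocycle Γ v (c (b ^ n k) x)⁻¹) d, fun k d => ?_,
    fun k => ae_of_all _ fun x => tsum_finsuppProb _ _, ?_⟩
  · exact (measurable_of_countable fun h : RAAG Γ => finsuppProb d₀ (linkCocycle Γ v h⁻¹) d).comp
      (hc.1 _)
  intro a ha
  obtain ⟨i, rfl⟩ := he a
  set B : ℕ → Set X := fun k =>
    {x | R k < ∑ i ∈ Finset.range k, finsuppNorm (linkCocycle Γ v (c (e i) x))} ∪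
    ((fun x => b ^ n k • x) ⁻¹'
      {x | R k < ∑ i ∈ Finset.range k, finsuppNorm (linkCocycle Γ v (c (e i) x))} ∪
    {x | vlen Γ v (c (b ^ n k) x) ≤ 2 ^ k * R k}) with hB
  have hBk : ∀ k, μ (B k) ≤ 3 * 2⁻¹ ^ k := by
    intro k
    refine (measure_union_le _ _).trans ?_
    have h1 := (hpmp (b ^ n k)).measure_preimage
      (measurableSet_lt measurable_const (hM k)).nullMeasurableSet (s := {x | R k <
        ∑ i ∈ Finset.range k, finsuppNorm (linkCocycle Γ v (c (e i) x))})
    calc _ ≤ (2⁻¹ : ℝ≥0∞) ^ k + (2⁻¹ ^ k + 2⁻¹ ^ k) := by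
          refine add_le_add (hR k).le ((measure_union_le _ _).trans (add_le_add ?_ (hn k).le))
          rw [h1]; exact (hR k).le
      _ = 3 * 2⁻¹ ^ k := by ring
  have hsum : ∑' k, μ (B k) ≠ ∞ := by
    refine ne_top_of_le_ne_top ?_ (ENNReal.tsum_le_tsum hBk)
    rw [ENNReal.tsum_mul_left, ENNReal.tsum_geometric]
    simp [ENNReal.mul_eq_top]
  filter_upwards [ae_eventually_notMem hsum, hc.2, hpmp.ae_smul hc.2] with x h1 h2 _
  have hlim : Tendsto (fun k : ℕ => 4 * (2⁻¹ : ℝ≥0∞) ^ k) atTop (𝓝 0) := by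
    have := ENNReal.Tendsto.const_mul (a := 4)
      (ENNReal.tendsto_pow_atTop_nhds_zero_of_lt_one (r := 2⁻¹) (by simp))
      (Or.inr (by norm_num))
    rwa [mul_zero] at this
  refine tendsto_of_tendsto_of_tendsto_of_le_of_le' tendsto_const_nhds hlim
    (Eventually.of_forall fun k => zero_le) ?_
  filter_upwards [h1, eventually_gt_atTop i, eventually_ge_atTop 1] with k hk hik hk1
  simp only [hB, Set.mem_union, Set.mem_ofPred_eq, Set.mem_preimage, not_or, not_lt, not_le] at hk
  obtain ⟨hk2, hk3, hk4⟩ := hk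
  have hle : ∀ y, finsuppNorm (linkCocycle Γ v (c (e i) y)) ≤
      ∑ i ∈ Finset.range k, finsuppNorm (linkCocycle Γ v (c (e i) y)) := fun y =>
    Finset.single_le_sum (f := fun i => finsuppNorm (linkCocycle Γ v (c (e i) y)))
      (fun _ _ => Nat.zero_le _) (Finset.mem_range.2 hik)
  have heq : (c (b ^ n k) (e i • x))⁻¹ =
      c (e i) x * (c (b ^ n k) x)⁻¹ * (c (e i) (b ^ n k • x))⁻¹ := by
    have h3 := h2 (b ^ n k) (e i)
    rw [← (show Commute (e i) b from ha).pow_right (n k) |>.eq, h2] at h3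
    rw [← eq_mul_inv_iff_mul_eq] at h3
    rw [inv_eq_iff_eq_inv, ← inv_inj, inv_inv]
    have h4 : c (b ^ n k) (e i • x) = c (e i) (b ^ n k • x) * c (b ^ n k) x * (c (e i) x)⁻¹ := by
      rw [h3]; group
    rw [h4]; group
  rw [heq]
  exact tsum_ed_linkProb_le v d₀ _ _ _ hk1 ((hle _).trans hk2) ((hle _).trans hk3)
    (by rwa [vlen_inv])

end Escape

section UltraMean

open Filter Topology

/-- Cesàro averages. -/
noncomputable def cesaro (a : ℕ → ℝ≥0∞) (N : ℕ) : ℝ≥0∞ :=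
  (∑ i ∈ Finset.range (N + 1), a i) * ((N + 1 : ℕ) : ℝ≥0∞)⁻¹

/-- A shift-invariant mean: the limit of Cesàro averages along a nonprincipal ultrafilter. -/
noncomputable def ultraMean (a : ℕ → ℝ≥0∞) : ℝ≥0∞ :=
  (Ultrafilter.map (cesaro a) (hyperfilter ℕ)).lim

lemma tendsto_ultraMean (a : ℕ → ℝ≥0∞) :
    Tendsto (cesaro a) (hyperfilter ℕ : Filter ℕ) (𝓝 (ultraMean a)) :=
  (Ultrafilter.map (cesaro a) (hyperfilter ℕ)).le_nhds_lim

lemma ultraMean_add (a a' : ℕ → ℝ≥0∞) :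
    ultraMean (fun n => a n + a' n) = ultraMean a + ultraMean a' := by
  refine tendsto_nhds_unique (tendsto_ultraMean _)
    (((tendsto_ultraMean a).add (tendsto_ultraMean a')).congr fun N => ?_)
  simp only [cesaro]
  rw [Finset.sum_add_distrib, add_mul]

lemma ultraMean_mono {a a' : ℕ → ℝ≥0∞} (h : ∀ n, a n ≤ a' n) : ultraMean a ≤ ultraMean a' := by
  refine le_of_tendsto_of_tendsto' (tendsto_ultraMean a) (tendsto_ultraMean a') fun N => ?_
  unfold cesaro
  gcongr with i
  exact h i

lemma ultraMean_const (z : ℝ≥0∞) : ultraMean (fun _ => z) = z := by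
  refine tendsto_nhds_unique (tendsto_ultraMean _) (tendsto_const_nhds.congr fun N => ?_)
  simp only [cesaro, Finset.sum_const, Finset.card_range, nsmul_eq_mul]
  rw [mul_comm, ← mul_assoc, ENNReal.inv_mul_cancel (by simp) (ENNReal.natCast_ne_top _), one_mul]

lemma ultraMean_shift {a : ℕ → ℝ≥0∞} (ha : ∀ n, a n ≤ 1) :
    ultraMean (fun n => a (n + 1)) = ultraMean a := by
  have hz : Tendsto (fun N : ℕ => ((N + 1 : ℕ) : ℝ≥0∞)⁻¹) (hyperfilter ℕ : Filter ℕ) (𝓝 0) :=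
    (ENNReal.tendsto_inv_nat_nhds_zero.comp (tendsto_add_atTop_nat 1)).mono_left
      Nat.hyperfilter_le_atTop
  have hs : ∀ N, ∑ i ∈ Finset.range (N + 1), a (i + 1) + a 0 =
      ∑ i ∈ Finset.range (N + 1), a i + a (N + 1) := fun N => by
    exact (Finset.sum_range_succ' a (N + 1)).symm.trans (Finset.sum_range_succ a (N + 1))
  refine le_antisymm ?_ ?_
  · have h := (tendsto_ultraMean a).add hz
    rw [add_zero] at h
    refine le_of_tendsto_of_tendsto' (tendsto_ultraMean _) h fun N => ?_
    unfold cesaro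
    calc _ ≤ (∑ i ∈ Finset.range (N + 1), a i + 1) * ((N + 1 : ℕ) : ℝ≥0∞)⁻¹ := by
          gcongr
          refine le_trans le_self_add ((hs N).le.trans ?_)
          gcongr; exact ha _
      _ = _ := by rw [add_mul, one_mul]
  · have h := (tendsto_ultraMean fun n => a (n + 1)).add hz
    rw [add_zero] at h
    refine le_of_tendsto_of_tendsto' (tendsto_ultraMean _) h fun N => ?_
    unfold cesaro
    calc _ ≤ (∑ i ∈ Finset.range (N + 1), a (i + 1) + 1) * ((N + 1 : ℕ) : ℝ≥0∞)⁻¹ := by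
          gcongr
          refine le_trans le_self_add ((hs N).ge.trans ?_)
          gcongr; exact ha _
      _ = _ := by rw [add_mul, one_mul]

variable {X : Type} [MeasurableSpace X]

/-- A countably additive limit of the restrictions of a finite measure to a sequence of sets. -/
lemma exists_meanMeasure (μ : Measure X) [IsFiniteMeasure μ] (S : ℕ → Set X)
    (hS : ∀ n, MeasurableSet (S n)) :
    ∃ m : Measure X, ∀ A, MeasurableSet A → m A = ultraMean fun n => μ (A ∩ S n) := by
  have hzero : ultraMean (fun _ => (0 : ℝ≥0∞)) = 0 := ultraMean_const 0
  refine ⟨Measure.ofMeasurable (fun A _ => ultraMean fun n => μ (A ∩ S n)) ?_ ?_,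
    fun A hA => Measure.ofMeasurable_apply A hA⟩
  · simpa using hzero
  · intro f hf hd
    have hmono : ∀ A B : Set X, A ⊆ B →
        (ultraMean fun n => μ (A ∩ S n)) ≤ ultraMean fun n => μ (B ∩ S n) := fun A B h =>
      ultraMean_mono fun n => measure_mono (Set.inter_subset_inter_left _ h)
    have hfin : ∀ k : ℕ, ∑ i ∈ Finset.range k, (ultraMean fun n => μ (f i ∩ S n)) =
        ultraMean fun n => μ ((⋃ i ∈ Finset.range k, f i) ∩ S n) := by
      intro k
      induction k with
      | zero => simpa using hzero.symm
      | succ k ih =>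
        rw [Finset.sum_range_succ, ih, ← ultraMean_add]
        congr 1
        ext n
        rw [Finset.range_add_one, Finset.set_biUnion_insert, Set.union_comm,
          Set.union_inter_distrib_right,
          measure_union _ ((hf k).inter (hS n))]
        refine Disjoint.mono Set.inter_subset_left Set.inter_subset_left ?_
        rw [Set.disjoint_iUnion₂_left]
        intro i hi
        exact hd (Finset.mem_range.1 hi).ne
    refine le_antisymm ?_ ?_
    · have htail := ENNReal.tendsto_sum_nat_add (fun i => μ (f i)) (by
        rw [← measure_iUnion hd hf]; exact measure_ne_top _ _)
      have h2 := htail.const_add (∑' i, ultraMean fun n => μ (f i ∩ S n))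
      rw [add_zero] at h2
      refine ge_of_tendsto' h2 fun k => ?_
      calc (ultraMean fun n => μ ((⋃ i, f i) ∩ S n))
          ≤ ultraMean fun n => μ ((⋃ i ∈ Finset.range k, f i) ∩ S n) +
              ∑' i, μ (f (i + k)) := by
            refine ultraMean_mono fun n => ?_
            have hsub : (⋃ i, f i) ∩ S n ⊆
                ((⋃ i ∈ Finset.range k, f i) ∩ S n) ∪ ⋃ i, f (i + k) := by
              rintro x ⟨hx, hxn⟩
              obtain ⟨i, hi⟩ := Set.mem_iUnion.1 hx
              rcases lt_or_ge i k with h | h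
              · exact Or.inl ⟨Set.mem_iUnion₂.2 ⟨i, Finset.mem_range.2 h, hi⟩, hxn⟩
              · refine Or.inr (Set.mem_iUnion.2 ⟨i - k, ?_⟩)
                rwa [Nat.sub_add_cancel h]
            refine (measure_mono hsub).trans ((measure_union_le _ _).trans ?_)
            gcongr
            exact measure_iUnion_le _
        _ = ∑ i ∈ Finset.range k, (ultraMean fun n => μ (f i ∩ S n)) + ∑' i, μ (f (i + k)) := by
            rw [ultraMean_add, ultraMean_const, hfin]
        _ ≤ _ := by
            gcongr
            exact ENNReal.sum_le_tsum _
    · refine ENNReal.tsum_le_of_sum_range_le fun k => ?_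
      rw [hfin]
      exact hmono _ _ (Set.iUnion₂_subset fun i _ => Set.subset_iUnion f i)

end UltraMean

section ErgodicHelpers

variable {G : Type} [Group G] {X : Type} [MeasurableSpace X] [MulAction G X] {μ : Measure X}
  {H : Type} [Group H] [Countable H] [MeasurableSpace H] [DiscreteMeasurableSpace H]

lemma ae_of_ergodic {b : G} (hb : Ergodic (fun x : X => b • x) μ) {p : X → Prop}
    (hm : MeasurableSet {x | p x}) (hinv : ∀ᵐ x ∂μ, p (b • x) ↔ p x)
    (hpos : μ {x | p x} ≠ 0) : ∀ᵐ x ∂μ, p x := by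
  have h1 : (fun x : X => b • x) ⁻¹' {x | p x} =ᵐ[μ] {x | p x} := by
    filter_upwards [hinv] with x hx
    exact propext hx
  rcases hb.quasiErgodic.ae_empty_or_univ₀ hm.nullMeasurableSet h1 with h | h
  · exact absurd (measure_congr h) (by simpa using hpos)
  · filter_upwards [h] with x hx
    have : x ∈ (Set.univ : Set X) := trivial
    exact hx.mpr this

/-- An equivariant map to a countable set reduces the cocycle to a stabilizer. -/
lemma reduces_stabilizer [NeZero μ] {c : G → X → H} {b : G}
    (hb : Ergodic (fun x : X => b • x) μ)
    {Z : Type} [Countable Z] [MulAction H Z] {ψ : X → Z} (hψm : ∀ z, MeasurableSet {x | ψ x = z})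
    (hψ : ∀ᵐ x ∂μ, ψ (b • x) = c b x • ψ x) {p : Z → Prop} (hp : ∀ᵐ x ∂μ, p (ψ x)) :
    ∃ z, p z ∧ Reduces μ c b (MulAction.stabilizer H z) := by
  have hz : ∃ z, p z ∧ μ {x | ψ x = z} ≠ 0 := by
    by_contra! hcon
    have h1 : ∀ᵐ x ∂μ, ∀ z, p z → ψ x ≠ z := by
      rw [ae_all_iff]
      intro z
      by_cases h : p z
      · filter_upwards [measure_eq_zero_iff_ae_notMem.1 (hcon z h)] with x hx _
        exact hx
      · simp [h]
    have h2 : ∀ᵐ x ∂μ, False := by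
      filter_upwards [h1, hp] with x hx hpx
      exact hx _ hpx rfl
    have : μ Set.univ = 0 := by simpa [ae_iff] using h2
    exact NeZero.ne μ (Measure.measure_univ_eq_zero.1 this)
  obtain ⟨z, hpz, hz⟩ := hz
  obtain ⟨φ, hφm, hφ⟩ := exists_measurable_selector (X := X) (Z := H)
    (P := fun h x => ψ x = h • z) fun h => hψm _
  have hm : MeasurableSet {x | ∃ h : H, ψ x = h • z} := by
    rw [show {x | ∃ h : H, ψ x = h • z} = ⋃ h : H, {x | ψ x = h • z} from by ext; simp]
    exact MeasurableSet.iUnion fun h => hψm _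
  have hall : ∀ᵐ x ∂μ, ∃ h : H, ψ x = h • z := by
    refine ae_of_ergodic hb hm ?_ ?_
    · filter_upwards [hψ] with x hx
      rw [hx]
      constructor
      · rintro ⟨h, hh⟩
        exact ⟨(c b x)⁻¹ * h, by rw [mul_smul, ← hh, inv_smul_smul]⟩
      · rintro ⟨h, hh⟩
        exact ⟨c b x * h, by rw [mul_smul, ← hh]⟩
    · refine fun h0 => hz (measure_mono_null ?_ h0)
      rintro x hx
      exact ⟨1, by rw [one_smul]; exact hx⟩
  refine ⟨z, hpz, φ, hφm, ?_⟩
  have hall' := hb.quasiMeasurePreserving.ae hall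
  filter_upwards [hall, hall', hψ] with x h1 h2 h3
  rw [MulAction.mem_stabilizer_iff, mul_smul, mul_smul, ← hφ x h1, ← h3, inv_smul_eq_iff]
  exact hφ _ h2

/-- The stabilizer of a finite set of cosets of a root-closed subgroup is conjugate into it. -/
lemma stabilizer_finset_le {P : Subgroup H} (hP : ∀ (n : ℕ) (h : H), 0 < n → h ^ n ∈ P → h ∈ P)
    [DecidableEq (H ⧸ P)] {z : Finset (H ⧸ P)} (hz : z.Nonempty) :
    ∃ t : H, ∀ g ∈ MulAction.stabilizer H z, t⁻¹ * g * t ∈ P := by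
  obtain ⟨d, hd⟩ := hz
  induction d using QuotientGroup.induction_on with
  | H t =>
  refine ⟨t, fun g hg => ?_⟩
  have hmem : ∀ n : ℕ, g ^ n • (t : H ⧸ P) ∈ z := by
    intro n
    have h1 : g ^ n ∈ MulAction.stabilizer H z := Subgroup.pow_mem _ hg n
    rw [MulAction.mem_stabilizer_iff] at h1
    rw [← h1]
    exact Finset.smul_mem_smul_finset hd
  obtain ⟨i, j, hij, he⟩ : ∃ i j : ℕ, i < j ∧ g ^ i • (t : H ⧸ P) = g ^ j • (t : H ⧸ P) := by
    have : ¬ Function.Injective fun n : ℕ => (⟨_, hmem n⟩ : z) :=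
      not_injective_infinite_finite _
    simp only [Function.Injective, Subtype.mk.injEq, not_forall] at this
    obtain ⟨i, j, he, hne⟩ := this
    rcases Nat.lt_or_gt_of_ne hne with h | h
    · exact ⟨i, j, h, he⟩
    · exact ⟨j, i, h, he.symm⟩
  refine hP (j - i) _ (Nat.sub_pos_of_lt hij) ?_
  have h2 : (t : H ⧸ P) = g ^ (j - i) • (t : H ⧸ P) := by
    have h3 : g ^ j = g ^ i * g ^ (j - i) := by rw [← pow_add, Nat.add_sub_cancel' hij.le]
    rw [h3, mul_smul] at he
    exact MulAction.injective _ he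
  have h4 : (t : H ⧸ P) = ((g ^ (j - i) * t : H) : H ⧸ P) := h2
  rw [QuotientGroup.eq] at h4
  have h5 : (t⁻¹ * g * t) ^ (j - i) = t⁻¹ * (g ^ (j - i) * t) := by
    have := conj_pow (i := j - i) (a := t⁻¹) (b := g)
    rw [inv_inv] at this
    rw [this, mul_assoc]
  rwa [h5]

lemma Reduces.mono {μ : Measure X} {c : G → X → H} {b : G} {K L : Subgroup H}
    (h : Reduces μ c b K) (t : H) (hKL : ∀ g ∈ K, t⁻¹ * g * t ∈ L) : Reduces μ c b L := by
  obtain ⟨φ, hφm, hφ⟩ := h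
  refine ⟨fun x => φ x * t, hφm.mul measurable_const, ?_⟩
  filter_upwards [hφ] with x hx
  convert hKL _ hx using 1
  group

end ErgodicHelpers

section Densities

variable {G : Type} [Group G] {X : Type} [MeasurableSpace X] [MulAction G X] {μ : Measure X}
  {H : Type} [Group H] [Countable H] [MeasurableSpace H] [DiscreteMeasurableSpace H]

/-- A family of densities permuted by the cocycle reduces it to a stabilizer of a coset. -/
lemma reduces_of_densities [IsProbabilityMeasure μ] {c : G → X → H} {b : G}
    (hb : Ergodic (fun x : X => b • x) μ) {P : Subgroup H}
    (hP : ∀ (n : ℕ) (h : H), 0 < n → h ^ n ∈ P → h ∈ P) (p : H ⧸ P → X → ℝ≥0∞)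
    (hpm : ∀ d, Measurable (p d)) (hsum : ∀ᵐ x ∂μ, ∑' d, p d x ≤ 1)
    (hne : ¬ ∀ᵐ x ∂μ, ∀ d, p d x = 0)
    (hshift : ∀ᵐ x ∂μ, ∀ d, p (c b x • d) (b • x) = p d x) : Reduces μ c b P := by
  classical
  have : Countable (H ⧸ P) := countable_quotient P
  have hEm : ∀ q : ℝ≥0∞, MeasurableSet {x | ∃ d, q < p d x} := fun q => by
    rw [show {x | ∃ d, q < p d x} = ⋃ d, {x | q < p d x} from by ext; simp]
    exact MeasurableSet.iUnion fun d => measurableSet_lt measurable_const (hpm d)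
  obtain ⟨n, hn⟩ : ∃ n : ℕ, μ {x | ∃ d, (n : ℝ≥0∞)⁻¹ < p d x} ≠ 0 := by
    by_contra! hcon
    apply hne
    have h1 : ∀ᵐ x ∂μ, ∀ n : ℕ, x ∉ {x | ∃ d, (n : ℝ≥0∞)⁻¹ < p d x} :=
      ae_all_iff.2 fun n => measure_eq_zero_iff_ae_notMem.1 (hcon n)
    filter_upwards [h1] with x hx d
    by_contra h0
    obtain ⟨n, hn⟩ := ENNReal.exists_inv_nat_lt h0
    exact hx n ⟨d, hn⟩
  set q : ℝ≥0∞ := (n : ℝ≥0∞)⁻¹ with hq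
  have hq0 : q ≠ 0 := ENNReal.inv_ne_zero.2 (ENNReal.natCast_ne_top n)
  have hall : ∀ᵐ x ∂μ, ∃ d, q < p d x := by
    refine ae_of_ergodic hb (hEm q) ?_ hn
    filter_upwards [hshift] with x hx
    constructor
    · rintro ⟨d, hd⟩
      refine ⟨(c b x)⁻¹ • d, ?_⟩
      rwa [← hx, smul_inv_smul]
    · rintro ⟨d, hd⟩
      exact ⟨c b x • d, by rwa [hx]⟩
  have hfin : ∀ᵐ x ∂μ, {d | q < p d x}.Finite := by
    filter_upwards [hsum] with x hx
    refine (ENNReal.finite_const_le_of_tsum_ne_top (ne_top_of_le_ne_top ENNReal.one_ne_top hx)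
      hq0).subset fun d (hd : q < p d x) => (hd.le : q ≤ p d x)
  set ψ : X → Finset (H ⧸ P) := fun x =>
    if h : {d | q < p d x}.Finite then h.toFinset else ∅ with hψ
  have hψ1 : ∀ x, {d | q < p d x}.Finite → ∀ d, d ∈ ψ x ↔ q < p d x := by
    intro x hx d
    simp only [hψ, dif_pos hx, Set.Finite.mem_toFinset]
    rfl
  have hF : ∀ z : Finset (H ⧸ P), MeasurableSet {x | ∀ d, d ∈ z ↔ q < p d x} := by
    intro z
    rw [show {x | ∀ d, d ∈ z ↔ q < p d x} = ⋂ d, {x | d ∈ z ↔ q < p d x} from by ext; simp]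
    refine MeasurableSet.iInter fun d => ?_
    by_cases hd : d ∈ z
    · simpa [hd] using measurableSet_lt measurable_const (hpm d)
    · simpa [hd] using measurableSet_le (hpm d) measurable_const
  have hψF : ∀ x (z : Finset (H ⧸ P)), (∀ d, d ∈ z ↔ q < p d x) → ψ x = z := by
    intro x z hz
    have : {d | q < p d x}.Finite := z.finite_toSet.subset fun d hd => (hz d).2 hd
    ext d
    rw [hψ1 x this, hz]
  have hFψ : ∀ x (z : Finset (H ⧸ P)), z.Nonempty → ψ x = z → ∀ d, d ∈ z ↔ q < p d x := by
    intro x z hne hz d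
    by_cases h : {d | q < p d x}.Finite
    · rw [← hz, hψ1 x h]
    · simp only [hψ, dif_neg h] at hz
      rw [← hz] at hne
      simp at hne
  have hψm1 : ∀ z : Finset (H ⧸ P), z.Nonempty → MeasurableSet {x | ψ x = z} := by
    intro z hz
    convert hF z using 1
    ext x
    exact ⟨hFψ x z hz, hψF x z⟩
  have hψm : ∀ z, MeasurableSet {x | ψ x = z} := by
    intro z
    rcases z.eq_empty_or_nonempty with rfl | hz
    · have : {x | ψ x = ∅} = (⋃ z : {z : Finset (H ⧸ P) // z.Nonempty}, {x | ψ x = z})ᶜ := by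
        ext x
        simp only [Set.mem_ofPred_eq, Set.mem_compl_iff, Set.mem_iUnion, Subtype.exists, not_exists,
          exists_prop, not_and]
        constructor
        · rintro h z hz rfl
          simp [h] at hz
        · intro h
          by_contra h0
          exact h _ (Finset.nonempty_iff_ne_empty.2 h0) rfl
      rw [this]
      exact (MeasurableSet.iUnion fun z => hψm1 _ z.2).compl
    · exact hψm1 z hz
  have hfin' := hb.quasiMeasurePreserving.ae hfin
  have hψe : ∀ᵐ x ∂μ, ψ (b • x) = c b x • ψ x := by
    filter_upwards [hfin, hfin', hshift] with x h1 h2 h3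
    ext d
    rw [hψ1 _ h2, ← Finset.inv_smul_mem_iff, hψ1 _ h1, ← h3, smul_inv_smul]
  have hψn : ∀ᵐ x ∂μ, (ψ x).Nonempty := by
    filter_upwards [hfin, hall] with x h1 ⟨d, hd⟩
    exact ⟨d, (hψ1 x h1 d).2 hd⟩
  obtain ⟨z, hz, hr⟩ := reduces_stabilizer hb hψm hψe (p := Finset.Nonempty) hψn
  obtain ⟨t, ht⟩ := stabilizer_finset_le hP hz
  exact hr.mono t ht

lemma reduces_of_measures [IsProbabilityMeasure μ] {c : G → X → H} {b : G}
    (hpmp : PmpAction G X μ) (hc : Measurable (c b))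
    (hb : Ergodic (fun x : X => b • x) μ) {P : Subgroup H}
    (hP : ∀ (n : ℕ) (h : H), 0 < n → h ^ n ∈ P → h ∈ P) (m : H ⧸ P → Measure X)
    (hsum : ∀ A, MeasurableSet A → ∑' d, m d A ≤ μ A) (hne : ∃ d, m d ≠ 0)
    (hshift : ∀ h d A, MeasurableSet A → (∀ x ∈ A, c b x = h) →
      m (h • d) ((fun x : X => b⁻¹ • x) ⁻¹' A) = m d A) : Reduces μ c b P := by
  have : Countable (H ⧸ P) := countable_quotient P
  have hle : ∀ d, m d ≤ μ := fun d => Measure.le_iff.2 fun A hA =>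
    (ENNReal.le_tsum d).trans (hsum A hA)
  have : ∀ d, IsFiniteMeasure (m d) := fun d => ⟨(hle d _).trans_lt (measure_lt_top _ _)⟩
  have hd : ∀ d, μ.withDensity ((m d).rnDeriv μ) = m d := fun d =>
    Measure.withDensity_rnDeriv_eq _ _ (Measure.absolutelyContinuous_of_le (hle d))
  have hdA : ∀ d A, MeasurableSet A → ∫⁻ x in A, (m d).rnDeriv μ x ∂μ = m d A := fun d A hA => by
    rw [← withDensity_apply _ hA, hd]
  refine reduces_of_densities hb hP (fun d => (m d).rnDeriv μ)
    (fun d => Measure.measurable_rnDeriv _ _) ?_ ?_ ?_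
  · refine ae_le_of_forall_setLIntegral_le_of_sigmaFinite
      (Measurable.tsum fun d => Measure.measurable_rnDeriv _ _) fun A hA _ => ?_
    rw [lintegral_tsum fun d => (Measure.measurable_rnDeriv _ _).aemeasurable]
    simp only [hdA _ _ hA, lintegral_one, Measure.restrict_apply_univ]
    exact hsum A hA
  · intro h
    obtain ⟨d, hd0⟩ := hne
    apply hd0
    rw [← hd, withDensity_congr_ae (g := 0), withDensity_zero]
    filter_upwards [h] with x hx using hx d
  · rw [ae_all_iff]
    intro d
    have key : ∀ h : H, ∀ᵐ x ∂μ, c b x = h →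
        (m (h • d)).rnDeriv μ (b • x) = (m d).rnDeriv μ x := by
      intro h
      have hE : MeasurableSet {x | c b x = h} := hc (measurableSet_singleton h)
      have hbm : Measurable fun x : X => b • x := (hpmp b).measurable
      refine (ae_restrict_iff' hE).1 ?_
      refine ae_eq_of_forall_setLIntegral_eq_of_sigmaFinite
        ((Measure.measurable_rnDeriv _ _).comp hbm) (Measure.measurable_rnDeriv _ _)
        fun A hA _ => ?_
      have hAE := hA.inter hE
      rw [Measure.restrict_restrict hA, hdA d _ hAE, ← hshift h d _ hAE fun x hx => hx.2]
      have hpre : A ∩ {x | c b x = h} = (fun x : X => b • x) ⁻¹'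
          ((fun x : X => b⁻¹ • x) ⁻¹' (A ∩ {x | c b x = h})) := by
        ext x; simp
      have hm2 : MeasurableSet ((fun x : X => b⁻¹ • x) ⁻¹' (A ∩ {x | c b x = h})) :=
        (hpmp b⁻¹).measurable hAE
      rw [← hdA _ _ hm2]
      nth_rewrite 1 [hpre]
      exact (hpmp b).setLIntegral_comp_preimage hm2 (Measure.measurable_rnDeriv _ _)
    have h2 := ae_all_iff.2 key
    filter_upwards [h2] with x hx
    exact hx _ rfl

end Densities

section Dichotomy

variable {V : Type} [Finite V] {Γ : SimpleGraph V}
  {G : Type} [Group G] [Countable G] {X : Type} [MeasurableSpace X] [MulAction G X]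
  {μ : Measure X} [IsProbabilityMeasure μ] {c : G → X → RAAG Γ}

lemma reduces_of_not_escape (hpmp : PmpAction G X μ) (hc : AECocycle μ c) {b : G} {v : V}
    (hb : Ergodic (fun x : X => b • x) μ)
    {k : ℕ} {ε : ℝ≥0∞} (hε : 0 < ε) (hrec : ∀ n : ℕ, ε ≤ μ {x | vlen Γ v (c (b ^ n) x) ≤ k}) :
    Reduces μ c b (standardSub Γ {v}ᶜ) := by
  classical
  set P := standardSub Γ ({v}ᶜ : Set V) with hPdef
  set τ : ℕ → X → RAAG Γ := fun n x => c (b ^ n) ((b ^ n)⁻¹ • x) with hτ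
  have hτm : ∀ n, Measurable (τ n) := fun n => (hc.1 _).comp (hpmp _).measurable
  have hτs : ∀ n, ∀ᵐ x ∂μ, τ (n + 1) (b • x) = c b x * τ n x := by
    intro n
    filter_upwards [hpmp.ae_smul hc.2] with x hx
    have h1 := hx (b ^ n)⁻¹ b (b ^ n)
    rw [smul_inv_smul] at h1
    rw [hτ]
    simp only
    rw [← h1, ← pow_succ', smul_smul]
    congr 2
    rw [pow_succ']; group
  have hex : ∀ Q : Set (RAAG Γ), ∃ m : Measure X, ∀ A, MeasurableSet A →
      m A = ultraMean fun n => μ (A ∩ τ n ⁻¹' Q) := fun Q =>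
    exists_meanMeasure μ _ fun n => hτm n (DiscreteMeasurableSpace.forall_measurableSet Q)
  choose m hm using hex
  have hmono : ∀ Q Q', Q ⊆ Q' → ∀ A, MeasurableSet A → m Q A ≤ m Q' A := by
    intro Q Q' h A hA
    rw [hm _ _ hA, hm _ _ hA]
    exact ultraMean_mono fun n => measure_mono
      (Set.inter_subset_inter_right _ (Set.preimage_mono h))
  have hunion : ∀ Q Q', ∀ A, MeasurableSet A → m Q A + m Q' A = m (Q ∪ Q') A + m (Q ∩ Q') A := by
    intro Q Q' A hA
    simp only [hm _ _ hA]
    rw [← ultraMean_add, ← ultraMean_add]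
    congr 1
    ext n
    have hmeas : MeasurableSet (A ∩ τ n ⁻¹' Q') :=
      hA.inter (hτm n (DiscreteMeasurableSpace.forall_measurableSet Q'))
    rw [← measure_union_add_inter _ hmeas, ← Set.inter_union_distrib_left,
      ← Set.inter_inter_distrib_left]
    rfl
  have hleμ : ∀ Q A, MeasurableSet A → m Q A ≤ μ A := by
    intro Q A hA
    rw [hm _ _ hA]
    exact (ultraMean_mono fun n => measure_mono Set.inter_subset_left).trans
      (ultraMean_const _).le
  set B : RAAG Γ → ℕ → Set (RAAG Γ) := fun t R => {h | vlen Γ v (t⁻¹ * h) ≤ R} with hB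
  have hBp : ∀ t p R, p ∈ P → B (t * p) R = B t R := by
    intro t p R hp
    ext h
    simp only [hB, Set.mem_ofPred_eq]
    rw [mul_inv_rev, mul_assoc, vlen_mul_left (inv_mem hp)]
  have hexR : ∃ R, ∃ t, m (B t R) ≠ 0 := by
    refine ⟨k, 1, fun h0 => ?_⟩
    have h1 : m (B 1 k) Set.univ = 0 := by rw [h0]; rfl
    rw [hm _ _ MeasurableSet.univ] at h1
    have h2 : ε ≤ ultraMean fun n => μ (Set.univ ∩ τ n ⁻¹' B 1 k) := by
      rw [← ultraMean_const ε]
      refine ultraMean_mono fun n => (hrec n).trans_eq ?_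
      rw [Set.univ_inter, ← (hpmp (b ^ n)).measure_preimage
        (hτm n (DiscreteMeasurableSpace.forall_measurableSet _)).nullMeasurableSet]
      congr 1
      ext x
      simp [hB, hτ]
    rw [h1] at h2
    exact absurd hε (not_lt.2 h2)
  set R := Nat.find hexR with hR
  obtain ⟨t₀, ht₀⟩ := Nat.find_spec hexR
  have hmin : ∀ t R', R' < R → m (B t R') Set.univ = 0 := by
    intro t R' h
    have := Nat.find_min hexR h
    push Not at this
    rw [this t]; rfl
  have hlt : ∀ t, m {h | vlen Γ v (t⁻¹ * h) < R} Set.univ = 0 := by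
    intro t
    rcases Nat.eq_zero_or_pos R with h0 | h0
    · rw [hm _ _ MeasurableSet.univ]
      simp only [h0, Nat.not_lt_zero]
      simpa using ultraMean_const 0
    · refine le_antisymm ((hmono _ (B t (R - 1)) ?_ _ MeasurableSet.univ).trans
        (hmin t (R - 1) (by omega)).le) zero_le
      intro h hh
      simp only [hB, Set.mem_ofPred_eq] at hh ⊢
      omega
  have hover : ∀ t t' : RAAG Γ, t⁻¹ * t' ∉ P → m (B t R ∩ B t' R) Set.univ = 0 := by
    intro t t' htt
    obtain ⟨s, hs⟩ := vlen_ball_separation htt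
    have hsub : B t R ∩ B t' R ⊆ {h | vlen Γ v (t⁻¹ * h) < R} ∪
        {h | vlen Γ v ((t * s)⁻¹ * h) < R} := by
      rintro h ⟨h1, h2⟩
      have h3 := hs (t⁻¹ * h) R h1 (by
        have e : (t⁻¹ * t')⁻¹ * (t⁻¹ * h) = t'⁻¹ * h := by group
        rw [e]; exact h2)
      have e : s⁻¹ * (t⁻¹ * h) = (t * s)⁻¹ * h := by group
      rwa [e] at h3
    refine le_antisymm ((hmono _ _ hsub _ MeasurableSet.univ).trans ?_) zero_le
    calc _ ≤ _ := le_self_add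
      _ = _ := (hunion _ _ _ MeasurableSet.univ).symm
      _ = 0 := by rw [hlt, hlt, add_zero]
  have hzero : ∀ Q, m Q Set.univ = 0 → ∀ A, m Q A = 0 := fun Q h A =>
    measure_mono_null (Set.subset_univ A) h
  set D : RAAG Γ ⧸ P → Set (RAAG Γ) := fun d => B d.out R with hD
  have hDmk : ∀ t : RAAG Γ, D (t : RAAG Γ ⧸ P) = B t R := by
    intro t
    obtain ⟨p, hp⟩ := QuotientGroup.mk_out_eq_mul P t
    rw [hD]
    simp only
    rw [hp, hBp _ _ _ p.2]
  have hsmul : ∀ g h (d : RAAG Γ ⧸ P), g * h ∈ D (g • d) ↔ h ∈ D d := by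
    intro g h d
    induction d using QuotientGroup.induction_on with
    | H t =>
    have e : g • (t : RAAG Γ ⧸ P) = ((g * t : RAAG Γ) : RAAG Γ ⧸ P) := rfl
    rw [e, hDmk, hDmk]
    simp only [hB, Set.mem_ofPred_eq]
    rw [mul_inv_rev, mul_assoc, inv_mul_cancel_left]
  refine reduces_of_measures hpmp (hc.1 b) hb
    (fun n h hn hh => mem_standardSub_of_pow_mem hn hh) (fun d => m (D d)) ?_ ?_ ?_
  · intro A hA
    rw [ENNReal.tsum_eq_iSup_sum]
    refine iSup_le fun s => ?_
    have key : ∑ d ∈ s, m (D d) A = m (⋃ d ∈ s, D d) A := by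
      induction s using Finset.induction_on with
      | empty =>
        simp only [Finset.sum_empty, Finset.notMem_empty, Set.iUnion_of_empty, Set.iUnion_empty]
        rw [hm _ _ hA]
        simpa using (ultraMean_const 0).symm
      | insert d s hd ih =>
        rw [Finset.sum_insert hd, ih, hunion _ _ _ hA, Finset.set_biUnion_insert]
        have h0 : m (D d ∩ ⋃ d' ∈ s, D d') A = 0 := by
          apply hzero
          clear ih
          induction s using Finset.induction_on with
          | empty =>
            rw [hm _ _ MeasurableSet.univ]
            simpa using ultraMean_const 0
          | insert d' s hd' ih' =>
            rw [Finset.set_biUnion_insert, Set.inter_union_distrib_left]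
            rw [Finset.mem_insert, not_or] at hd
            refine le_antisymm ?_ zero_le
            calc _ ≤ _ := le_self_add
              _ = _ := (hunion _ _ _ MeasurableSet.univ).symm
              _ = 0 := by
                rw [ih' hd.2, add_zero]
                apply hover
                rw [← QuotientGroup.eq]
                simpa using hd.1
        rw [h0, add_zero]
    rw [key]
    exact hleμ _ _ hA
  · exact ⟨(t₀ : RAAG Γ ⧸ P), by rw [hDmk]; exact ht₀⟩
  · intro h d A hA hAc
    have hA' : MeasurableSet ((fun x : X => b⁻¹ • x) ⁻¹' A) := (hpmp b⁻¹).measurable hA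
    rw [hm _ _ hA', hm _ _ hA, ← ultraMean_shift fun n => prob_le_one]
    congr 1
    ext n
    rw [← (hpmp b).measure_preimage (hA'.inter
      (hτm _ (DiscreteMeasurableSpace.forall_measurableSet _))).nullMeasurableSet]
    refine measure_congr ?_
    filter_upwards [hτs n] with x hx
    refine propext ?_
    change (b⁻¹ • b • x ∈ A ∧ τ (n + 1) (b • x) ∈ D (h • d)) ↔ (x ∈ A ∧ τ n x ∈ D d)
    rw [inv_smul_smul, hx]
    refine and_congr_right fun hxA => ?_
    rw [hAc x hxA, hsmul]

/-- The centralizer of `b` is amenable relative to the common link of the hull of `b`. -/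
theorem amenRel_hull (hpmp : PmpAction G X μ) (hc : AECocycle μ c) {b : G}
    (hb : Ergodic (fun x : X => b • x) μ) :
    AmenRel μ c {a | Commute a b} (standardSub Γ (⋂ v ∈ hull μ c b, lk Γ v)) := by
  refine AmenRel.biInter hpmp _ _ fun v hv => amenRel_of_escape hpmp hc fun k ε hε => ?_
  by_contra! h
  exact hv (reduces_of_not_escape hpmp hc hb hε h)

end Dichotomy

section Atomless

lemma measure_singleton_of_free {G : Type} [Group G] [Countable G] [Infinite G] {X : Type}
    [MeasurableSpace X] [MeasurableSingletonClass X] [MulAction G X] {μ : Measure X}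
    [IsFiniteMeasure μ] (hpmp : PmpAction G X μ) (hfree : FreeAction G X μ) (x : X) :
    μ {x} = 0 := by
  by_contra h0
  have hx : ∀ g : G, g • x = x → g = 1 := by
    by_contra hcon
    exact h0 (measure_mono_null (Set.singleton_subset_iff.2 hcon) (ae_iff.1 hfree.ae_free))
  have hinj : Function.Injective fun g : G => g • x := fun g g' h => ae_injective_of_free hx h
  have hmass : ∀ g : G, μ {g • x} = μ {x} := by
    intro g
    rw [← (hpmp g).measure_preimage (MeasurableSet.singleton _).nullMeasurableSet]
    congr 1
    ext y
    simp
  have h1 : μ (⋃ g : G, {g • x}) = ∑' g : G, μ {g • x} := by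
    refine measure_iUnion (fun g g' hg => ?_) fun g => MeasurableSet.singleton _
    rw [Function.onFun, Set.disjoint_singleton]
    exact fun h => hg (hinj h)
  simp only [hmass] at h1
  rw [ENNReal.tsum_const_eq_top_of_ne_zero h0] at h1
  exact measure_ne_top _ _ h1

lemma infinite_raag {V : Type} [Finite V] (Γ : SimpleGraph V) (v : V) : Infinite (RAAG Γ) := by
  refine Infinite.of_injective (fun n : ℕ => gen Γ v ^ n) ?_
  have hno : ∀ n : ℕ, 0 < n → gen Γ v ^ n ≠ 1 := fun n hn h =>
    gen_ne_one v (unique_roots hn (h.trans (one_pow n).symm))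
  intro i j hij
  simp only at hij
  rcases lt_trichotomy i j with h | h | h
  · refine absurd ?_ (hno (j - i) (by omega))
    rw [← Nat.add_sub_cancel' h.le, pow_add] at hij
    simpa using hij.symm
  · exact h
  · refine absurd ?_ (hno (i - j) (by omega))
    rw [← Nat.add_sub_cancel' h.le, pow_add] at hij
    simpa using hij

end Atomless

section HullNonempty

variable {G : Type} [Group G] [MeasurableSpace G] [DiscreteMeasurableSpace G] [Countable G]
  {X : Type} [MeasurableSpace X] [StandardBorelSpace X] [MulAction G X]
  {H : Type} [Group H] [MeasurableSpace H] [DiscreteMeasurableSpace H] [Countable H]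
  {Y : Type} [MeasurableSpace Y] [StandardBorelSpace Y] [MulAction H Y]
  {μ : Measure X} {ν : Measure Y} [IsProbabilityMeasure μ]
  {c : G → X → H} {F : X → Y}
  {c' : H → Y → G} {F' : Y → X} {l : X → G} {k : Y → H}

lemma OrbitPair.not_reduces_bot [Infinite G] (h : OrbitPair μ ν c F c' F' l k)
    (hpmp : PmpAction G X μ)
    (hfree : FreeAction G X μ) (hpmp' : PmpAction H Y ν) {b : G}
    (hb : Ergodic (fun x : X => b • x) μ) : ¬ Reduces μ c b ⊥ := by
  rintro ⟨φ, hφm, hφ⟩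
  have hinv : (fun x => (φ x)⁻¹ • F x) ∘ (fun x : X => b • x) =ᵐ[μ] fun x => (φ x)⁻¹ • F x := by
    filter_upwards [hφ, h.fwd.equivariant] with x h1 h2
    rw [Subgroup.mem_bot] at h1
    have h3 : (φ (b • x))⁻¹ * c b x = (φ x)⁻¹ := mul_eq_one_iff_eq_inv.1 h1
    simp only [Function.comp]
    rw [h2, ← mul_smul, h3]
  have hm : Measurable fun x => (φ x)⁻¹ • F x :=
    measurable_apply_countable (f := fun (a : H) x => a • F x)
      (fun a => (hpmp' a).measurable.comp h.fwd.qmp.measurable) hφm.inv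
  have hne : Nonempty Y := ⟨F hφ.exists.choose⟩
  obtain ⟨y₀, hy₀⟩ := hb.quasiErgodic.ae_eq_const_of_ae_eq_comp₀
    (hm.nullMeasurable (μ := μ)) hinv
  have hall : ∀ᵐ x ∂μ, x ∈ Set.range fun p : G × H => p.1 • F' (p.2 • y₀) := by
    filter_upwards [hy₀, h.left] with x h1 h2
    refine ⟨((l x)⁻¹, φ x), ?_⟩
    simp only [Function.const_apply] at h1
    simp only
    rw [← h1, smul_inv_smul, h2, inv_smul_smul]
  have : NullSingletonClass μ := ⟨fun x => measure_singleton_of_free hpmp hfree x⟩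
  have h0 : μ (Set.range fun p : G × H => p.1 • F' (p.2 • y₀)) = 0 :=
    (Set.countable_range _).measure_zero μ
  have h1 : ∀ᵐ x ∂μ, False := by
    filter_upwards [hall, measure_eq_zero_iff_ae_notMem.1 h0] with x h2 h3 using h3 h2
  simp at h1
  exact (NeZero.ne μ) h1

end HullNonempty

section Composition

open Filter Topology

variable {G : Type} [Group G] [MeasurableSpace G] [DiscreteMeasurableSpace G] [Countable G]
  {X : Type} [MeasurableSpace X] [MulAction G X]
  {H : Type} [Group H] [MeasurableSpace H] [DiscreteMeasurableSpace H] [Countable H]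
  {Y : Type} [MeasurableSpace Y] [MulAction H Y]
  {μ : Measure X} {ν : Measure Y} [IsProbabilityMeasure μ]
  {c : G → X → H} {F : X → Y}
  {c' : H → Y → G} {F' : Y → X} {l : X → G} {k : Y → H}

lemma tendsto_tsum_of_dominated {ι : Type} [Countable ι] {f : ℕ → ι → ℝ≥0∞} {g : ι → ℝ≥0∞}
    (hfg : ∀ n i, f n i ≤ g i) (hg : ∑' i, g i ≠ ∞)
    (hf : ∀ i, Tendsto (fun n => f n i) atTop (𝓝 0)) :
    Tendsto (fun n => ∑' i, f n i) atTop (𝓝 0) := by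
  let _ : MeasurableSpace ι := ⊤
  have : DiscreteMeasurableSpace ι := ⟨fun _ => trivial⟩
  have h := tendsto_lintegral_of_dominated_convergence (μ := Measure.count) (F := f) (f := 0) g
    (fun n => Measurable.of_discrete) (fun n => ae_of_all _ (hfg n)) (by rwa [lintegral_count])
    (ae_of_all _ hf)
  simpa [lintegral_count] using h

/-- Almost invariant vectors obtained by composing relative amenability along an orbit pair. -/
theorem OrbitPair.exists_almost_invariant (h : OrbitPair μ ν c F c' F' l k)
    (hpmp : PmpAction G X μ) (hfree : FreeAction G X μ) (hpmp' : PmpAction H Y ν)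
    {A : Set G} {B : Set H} {K : Subgroup H} {L : Subgroup G}
    (h1 : AmenRel μ c A K) (h2 : AmenRel ν c' B L) (hKB : ∀ p ∈ K, p ∈ B)
    (S : Finset G) (hS : ∀ a ∈ S, a ∈ A) {ε : ℝ≥0∞} (hε : 0 < ε) :
    ∃ Z : G ⧸ L → ℝ≥0∞, ∑' d, Z d = 1 ∧ ∀ a ∈ S, ∑' d, ed (Z (a • d)) (Z d) ≤ ε := by
  have := countable_quotient K
  have := countable_quotient L
  obtain ⟨ξ, hξm, hξ1, hξ⟩ := h1
  obtain ⟨η, hηm, hη1, hη⟩ := h2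
  have hc' := h.symm.fwd.cocycle hpmp' hfree
  -- the translated vectors over a point `x` and a representative `s`
  set Θ : ℕ → X → H → G ⧸ L → ℝ≥0∞ := fun n x s d =>
    η n (s⁻¹ • F x) ((c' s (s⁻¹ • F x))⁻¹ • l x • d) with hΘ
  have hΘm : ∀ n s d, Measurable fun x => Θ n x s d := by
    intro n s d
    have hFs : Measurable fun x => s⁻¹ • F x := (hpmp' s⁻¹).measurable.comp h.fwd.qmp.measurable
    have hg : Measurable fun x => (c' s (s⁻¹ • F x))⁻¹ * l x :=
      ((hc'.1 s).comp hFs).inv.mul h.meas_left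
    have := measurable_apply_countable (f := fun (g : G) x => η n (s⁻¹ • F x) (g • d))
      (fun g => (hηm n _).comp hFs) hg
    simpa only [hΘ, mul_smul] using this
  have hsumη : ∀ᵐ x ∂μ, ∀ n (s : H), ∑' d, η n (s • F x) d = 1 :=
    h.fwd.qmp.ae (p := fun y => ∀ n (s : H), ∑' d, η n (s • y) d = 1) (by
      filter_upwards [hpmp'.ae_smul (ae_all_iff.2 hη1)] with y hy n s using hy s n)
  have hconvη : ∀ᵐ x ∂μ, ∀ s p : H, p ∈ B →
      Tendsto (fun n => ∑' d, ed (η n (p • s • F x) (c' p (s • F x) • d)) (η n (s • F x) d))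
        atTop (𝓝 0) := by
    refine h.fwd.qmp.ae (p := fun y => ∀ s p : H, p ∈ B →
      Tendsto (fun n => ∑' d, ed (η n (p • s • y) (c' p (s • y) • d)) (η n (s • y) d))
        atTop (𝓝 0)) ?_
    have h3 : ∀ᵐ y ∂ν, ∀ p : H, p ∈ B →
        Tendsto (fun n => ∑' d, ed (η n (p • y) (c' p y • d)) (η n y d)) atTop (𝓝 0) := by
      rw [ae_all_iff]
      intro p
      by_cases hp : p ∈ B
      · filter_upwards [hη p hp] with y hy _ using hy
      · simp [hp]
    filter_upwards [hpmp'.ae_smul h3] with y hy s p hp using hy s p hp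
  have hcoc : ∀ᵐ x ∂μ, ∀ s g g' : H,
      c' (g * g') (s • F x) = c' g (g' • s • F x) * c' g' (s • F x) :=
    h.fwd.qmp.ae (hpmp'.ae_smul hc'.2)
  have hΘsum : ∀ᵐ x ∂μ, ∀ n s, ∑' d, Θ n x s d = 1 := by
    filter_upwards [hsumη] with x hx n s
    rw [← hx n s⁻¹, ← (MulAction.toPerm ((c' s (s⁻¹ • F x))⁻¹ * l x)).tsum_eq
      (η n (s⁻¹ • F x))]
    simp only [hΘ, MulAction.toPerm_apply, mul_smul]
  -- equivariance
  have hΘeq : ∀ᵐ x ∂μ, ∀ n (a : G) s d, Θ n (a • x) (c a x * s) (a • d) = Θ n x s d := by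
    filter_upwards [h.fwd.equivariant, h.cocycle_comp hpmp hfree, hcoc] with x e1 e2 e3 n a s d
    have e4 : (c a x * s)⁻¹ • F (a • x) = s⁻¹ • F x := by
      rw [e1, mul_inv_rev, mul_smul, inv_smul_smul]
    have e5 := e3 s⁻¹ (c a x) s
    rw [smul_inv_smul, e2] at e5
    simp only [hΘ]
    rw [e4, e5]
    congr 1
    simp only [smul_smul]
    congr 1
    group
  -- change of representative
  have hΘp : ∀ᵐ x ∂μ, ∀ (s p : H), p ∈ B →
      Tendsto (fun n => ∑' d, ed (Θ n x (s * p) d) (Θ n x s d)) atTop (𝓝 0) := by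
    filter_upwards [hconvη, hcoc] with x e1 e2 s p hp
    have e3 := e1 (p⁻¹ * s⁻¹) p hp
    refine e3.congr fun n => ?_
    have e4 := e2 (p⁻¹ * s⁻¹) s p
    set y := (p⁻¹ * s⁻¹) • F x with hy
    have e5 : p • y = s⁻¹ • F x := by rw [hy, mul_smul, smul_inv_smul]
    rw [e5] at e4 ⊢
    rw [← (MulAction.toPerm ((c' (s * p) y)⁻¹ * l x)).tsum_eq]
    refine tsum_congr fun d => ?_
    simp only [hΘ, MulAction.toPerm_apply]
    rw [ed_comm, mul_inv_rev, ← hy, mul_smul, e4]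
    congr 2
    simp only [smul_smul]
    congr 1
    group
  -- the averaged vectors
  set ζ : ℕ → ℕ → X → G ⧸ L → ℝ≥0∞ := fun n m x d => ∑' j : H ⧸ K, ξ n x j * Θ m x j.out d with hζ
  have hζm : ∀ n m d, Measurable fun x => ζ n m x d := fun n m d =>
    Measurable.tsum fun j => (hξm n j).mul (hΘm m _ d)
  have hζ1 : ∀ n m, ∀ᵐ x ∂μ, ∑' d, ζ n m x d = 1 := by
    intro n m
    filter_upwards [hξ1 n, hΘsum] with x e1 e2
    simp only [hζ]
    rw [ENNReal.tsum_comm, ← e1]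
    refine tsum_congr fun j => ?_
    rw [ENNReal.tsum_mul_left, e2, mul_one]
  set E : G → ℕ → X → ℝ≥0∞ := fun a n x => ∑' j, ed (ξ n (a • x) (c a x • j)) (ξ n x j) with hE
  set R : G → ℕ → ℕ → X → ℝ≥0∞ := fun a n m x => ∑' j : H ⧸ K, ξ n x j *
    ∑' d, ed (Θ m x ((c a x)⁻¹ * (c a x • j).out) d) (Θ m x j.out d) with hR
  have hmain : ∀ a n m, ∀ᵐ x ∂μ,
      ∑' d, ed (ζ n m (a • x) (a • d)) (ζ n m x d) ≤ E a n x + R a n m x := by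
    intro a n m
    filter_upwards [hΘeq, hΘsum, hξ1 n] with x e1 e2 e3
    have hfin : ∀ j, ξ n x j ≠ ∞ := fun j =>
      ne_top_of_le_ne_top (by simp [e3]) (ENNReal.le_tsum (f := ξ n x) j)
    have hΘfin : ∀ s d, Θ m x s d ≠ ∞ := fun s d =>
      ne_top_of_le_ne_top (by simp [e2 m s]) (ENNReal.le_tsum (f := Θ m x s) d)
    have e4 : ∀ d, ζ n m (a • x) (a • d) = ∑' j : H ⧸ K, ξ n (a • x) (c a x • j) *
        Θ m x ((c a x)⁻¹ * (c a x • j).out) d := by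
      intro d
      simp only [hζ]
      rw [← (MulAction.toPerm (c a x)).tsum_eq]
      refine tsum_congr fun j => ?_
      rw [MulAction.toPerm_apply, ← e1 m a _ d, mul_inv_cancel_left]
    calc ∑' d, ed (ζ n m (a • x) (a • d)) (ζ n m x d)
        ≤ ∑' d, ∑' j : H ⧸ K, (ed (ξ n (a • x) (c a x • j)) (ξ n x j) *
            Θ m x ((c a x)⁻¹ * (c a x • j).out) d +
            ξ n x j * ed (Θ m x ((c a x)⁻¹ * (c a x • j).out) d) (Θ m x j.out d)) := by
          refine ENNReal.tsum_le_tsum fun d => ?_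
          rw [e4]
          refine (ed_tsum_le _ _).trans (ENNReal.tsum_le_tsum fun j => ?_)
          refine (ed_triangle _ (ξ n x j * Θ m x ((c a x)⁻¹ * (c a x • j).out) d) _).trans ?_
          rw [ed_mul_left (hfin j), ed_mul_right (hΘfin _ _)]
      _ = E a n x + R a n m x := by
          rw [ENNReal.tsum_comm]
          simp only [hE, hR]
          rw [← ENNReal.tsum_add]
          refine tsum_congr fun j => ?_
          rw [ENNReal.tsum_add, ENNReal.tsum_mul_left, ENNReal.tsum_mul_left, e2, mul_one]
  have hEm : ∀ a n, Measurable (E a n) := by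
    intro a n
    refine Measurable.tsum fun j => Measurable.ed ?_ (hξm n j)
    exact measurable_apply_countable (f := fun (s : H) x => ξ n (a • x) (s • j))
      (fun s => (hξm n _).comp (hpmp a).measurable) (h.fwd.meas_coc a)
  have hRm : ∀ a n m, Measurable (R a n m) := by
    intro a n m
    refine Measurable.tsum fun j => (hξm n j).mul (Measurable.tsum fun d =>
      Measurable.ed ?_ (hΘm m _ d))
    exact measurable_apply_countable (f := fun (s : H) x => Θ m x (s⁻¹ * (s • j).out) d)
      (fun s => hΘm m _ d) (h.fwd.meas_coc a)
  have hElim : ∀ a ∈ A, Tendsto (fun n => ∫⁻ x, E a n x ∂μ) atTop (𝓝 0) := by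
    intro a ha
    have := tendsto_lintegral_of_dominated_convergence (μ := μ) (F := E a) (f := fun _ => 0)
      (fun _ => 2) (hEm a) (fun n => ?_) (by simp) (hξ a ha)
    · simpa using this
    · filter_upwards [hξ1 n, (hpmp a).quasiMeasurePreserving.ae (hξ1 n)] with x e1 e2
      calc E a n x ≤ ∑' j, (ξ n (a • x) (c a x • j) + ξ n x j) :=
            ENNReal.tsum_le_tsum fun j => ed_le_add _ _
        _ = 2 := by
            rw [ENNReal.tsum_add, e1]
            have := (MulAction.toPerm (c a x)).tsum_eq (ξ n (a • x))
            simp only [MulAction.toPerm_apply] at this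
            rw [this, e2, one_add_one_eq_two]
  have hRlim : ∀ a n, Tendsto (fun m => ∫⁻ x, R a n m x ∂μ) atTop (𝓝 0) := by
    intro a n
    have hb : ∀ᵐ x ∂μ, ∀ m s s',
        ∑' d, ed (Θ m x s d) (Θ m x s' d) ≤ 2 := by
      filter_upwards [hΘsum] with x e2 m s s'
      calc _ ≤ ∑' d, (Θ m x s d + Θ m x s' d) := ENNReal.tsum_le_tsum fun d => ed_le_add _ _
        _ = 2 := by rw [ENNReal.tsum_add, e2, e2, one_add_one_eq_two]
    have := tendsto_lintegral_of_dominated_convergence (μ := μ) (F := R a n) (f := fun _ => 0)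
      (fun _ => 2) (hRm a n) (fun m => ?_) (by simp) ?_
    · simpa using this
    · filter_upwards [hb, hξ1 n] with x e1 e2
      calc R a n m x ≤ ∑' j, ξ n x j * 2 := ENNReal.tsum_le_tsum fun j => by
            gcongr
            exact e1 _ _ _
        _ = 2 := by rw [ENNReal.tsum_mul_right, e2, one_mul]
    · filter_upwards [hb, hξ1 n, hΘp] with x e1 e2 e3
      refine tendsto_tsum_of_dominated (g := fun j => ξ n x j * 2)
        (fun m j => by gcongr; exact e1 _ _ _) ?_ fun j => ?_
      · rw [ENNReal.tsum_mul_right, e2]; simp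
      · have hfin : ξ n x j ≠ ∞ :=
          ne_top_of_le_ne_top (by simp [e2]) (ENNReal.le_tsum (f := ξ n x) j)
        have hmem : j.out⁻¹ * ((c a x)⁻¹ * (c a x • j).out) ∈ K := by
          rw [← QuotientGroup.eq, QuotientGroup.out_eq']
          have h5 : (((c a x)⁻¹ * (c a x • j).out : H) : H ⧸ K) =
              (c a x)⁻¹ • (((c a x • j).out : H) : H ⧸ K) := rfl
          rw [h5, QuotientGroup.out_eq', inv_smul_smul]
        have h6 := e3 j.out _ (hKB _ hmem)
        rw [mul_inv_cancel_left] at h6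
        simpa using ENNReal.Tendsto.const_mul h6 (Or.inr hfin)
  have hε2 : 0 < ε / 2 := ENNReal.half_pos hε.ne'
  obtain ⟨n, hn⟩ := ((Filter.eventually_all_finset S).2 fun a ha =>
    (hElim a (hS a ha)).eventually_le_const hε2).exists
  obtain ⟨m, hm⟩ := ((Filter.eventually_all_finset S).2 fun a _ =>
    (hRlim a n).eventually_le_const hε2).exists
  refine ⟨fun d => ∫⁻ x, ζ n m x d ∂μ, ?_, fun a ha => ?_⟩
  · rw [← lintegral_tsum fun d => (hζm n m d).aemeasurable, lintegral_congr_ae (hζ1 n m)]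
    simp
  · have hζa : ∀ d, Measurable fun x => ζ n m (a • x) (a • d) := fun d =>
      (hζm n m _).comp (hpmp a).measurable
    calc ∑' d, ed (∫⁻ x, ζ n m x (a • d) ∂μ) (∫⁻ x, ζ n m x d ∂μ)
        = ∑' d, ed (∫⁻ x, ζ n m (a • x) (a • d) ∂μ) (∫⁻ x, ζ n m x d ∂μ) := by
          refine tsum_congr fun d => ?_
          rw [(hpmp a).lintegral_comp (f := fun x => ζ n m x (a • d)) (hζm n m _)]
      _ ≤ ∑' d, ∫⁻ x, ed (ζ n m (a • x) (a • d)) (ζ n m x d) ∂μ :=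
          ENNReal.tsum_le_tsum fun d => ed_lintegral_le (hζa d) (hζm n m d)
      _ = ∫⁻ x, ∑' d, ed (ζ n m (a • x) (a • d)) (ζ n m x d) ∂μ :=
          (lintegral_tsum fun d => ((hζa d).ed (hζm n m d)).aemeasurable).symm
      _ ≤ ∫⁻ x, (E a n x + R a n m x) ∂μ := lintegral_mono_ae (hmain a n m)
      _ = ∫⁻ x, E a n x ∂μ + ∫⁻ x, R a n m x ∂μ := lintegral_add_left (hEm a n) _
      _ ≤ ε / 2 + ε / 2 := add_le_add (hn a ha) (hm a ha)
      _ = ε := ENNReal.add_halves ε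

end Composition

section DisjointHulls

variable {V W : Type} [Finite V] [Finite W] {Γ : SimpleGraph V} {Λ : SimpleGraph W}

/-- The link of `b` with its cone vertices removed. -/
def reducedLk (Γ : SimpleGraph V) (b : V) : Set V :=
  {v | v ∈ lk Γ b ∧ ∃ v' ∈ lk Γ b, v' ≠ v ∧ ¬ Γ.Adj v v'}

lemma reducedLk_subset {b b' : V} (h : reducedLk Γ b ⊆ lk Γ b') :
    reducedLk Γ b ⊆ reducedLk Γ b' := by
  rintro v ⟨hv, v', hv', hne, hadj⟩
  exact ⟨h ⟨hv, v', hv', hne, hadj⟩, v',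
    h ⟨hv', v, hv, hne.symm, fun h => hadj h.symm⟩, hne, hadj⟩

lemma exists_path_two (hconn : Γ.Connected) (hcone : ∀ v, ∃ u, u ≠ v ∧ ¬ Γ.Adj v u) (b : V) :
    ∃ c d, Γ.Adj b c ∧ Γ.Adj c d ∧ d ≠ b ∧ ¬ Γ.Adj b d := by
  by_contra! hcon
  obtain ⟨u, hu, hbu⟩ := hcone b
  have key : ∀ {x y : V}, Γ.Walk x y → (x = b ∨ Γ.Adj b x) → (y = b ∨ Γ.Adj b y) := by
    intro x y p
    induction p with
    | nil => exact id
    | @cons u' v' w' hadj _ ih =>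
      intro hx
      apply ih
      rcases hx with rfl | hx
      · exact Or.inr hadj
      · by_cases h : v' = b
        · exact Or.inl h
        · exact Or.inr (hcon _ _ hx hadj h)
  obtain ⟨p⟩ := hconn.preconnected b u
  rcases key p (Or.inl rfl) with h | h
  · exact hu h
  · exact hbu h

variable {X : Type} [MeasurableSpace X] [StandardBorelSpace X] [MulAction (RAAG Γ) X]
  {Y : Type} [MeasurableSpace Y] [StandardBorelSpace Y] [MulAction (RAAG Λ) Y]
  {μ : Measure X} {ν : Measure Y} [IsProbabilityMeasure μ] [IsProbabilityMeasure ν]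
  {c : RAAG Γ → X → RAAG Λ} {F : X → Y}
  {c' : RAAG Λ → Y → RAAG Γ} {F' : Y → X} {l : X → RAAG Γ} {k : Y → RAAG Λ}

lemma OrbitPair.hull_nonempty (h : OrbitPair μ ν c F c' F' l k)
    (hpmp : PmpAction (RAAG Γ) X μ) (hfree : FreeAction (RAAG Γ) X μ)
    (hpmp' : PmpAction (RAAG Λ) Y ν)
    {v : V} (hb : Ergodic (fun x : X => gen Γ v • x) μ) : (hull μ c (gen Γ v)).Nonempty := by
  have := infinite_raag Γ v
  rw [Set.nonempty_iff_ne_empty]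
  intro h0
  have h1 := reduces_hull μ c (gen Γ v)
  rw [h0, standardSub_empty] at h1
  exact h.not_reduces_bot hpmp hfree hpmp' hb h1

lemma OrbitPair.reducedLk_subset_lk (h : OrbitPair μ ν c F c' F' l k)
    (hpmp : PmpAction (RAAG Γ) X μ) (hfree : FreeAction (RAAG Γ) X μ)
    (hpmp' : PmpAction (RAAG Λ) Y ν) (hfree' : FreeAction (RAAG Λ) Y ν)
    {b b' : V} {z : W} (hb : Ergodic (fun x : X => gen Γ b • x) μ)
    (hz : Ergodic (fun y : Y => gen Λ z • y) ν)
    (hzb : z ∈ hull μ c (gen Γ b)) (hbz : b' ∈ hull ν c' (gen Λ z)) :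
    reducedLk Γ b ⊆ lk Γ b' := by
  classical
  rintro v ⟨hv, v', hv', hne, hadj⟩
  by_contra hvb
  have h1 := amenRel_hull hpmp (h.fwd.cocycle hpmp hfree') hb
  have h2 := amenRel_hull hpmp' (h.symm.fwd.cocycle hpmp' hfree) hz
  obtain ⟨Z, hZ, hZS⟩ := h.exists_almost_invariant hpmp hfree hpmp' h1 h2
    (fun p hp => (commute_gen_of_mem_lk (standardSub_mono (Set.biInter_subset_of_mem hzb) hp)).symm)
    {gen Γ v, gen Γ v'} (by
      intro a ha
      simp only [Finset.mem_insert, Finset.mem_singleton] at ha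
      rcases ha with rfl | rfl
      · exact gen_commute (SimpleGraph.Adj.symm hv)
      · exact gen_commute (SimpleGraph.Adj.symm hv'))
    (ε := ENNReal.ofReal (1 / 10)) (by simp)
  exact no_almost_invariant hne hadj
    (fun hU => hvb (Set.mem_iInter₂.1 hU b' hbz)) Z hZ (hZS _ (by simp)) (hZS _ (by simp))

/-- Some adjacent pair of generators has disjoint hulls. -/
theorem OrbitPair.exists_disjoint_hull (h : OrbitPair μ ν c F c' F' l k)
    (hpmp : PmpAction (RAAG Γ) X μ) (hfree : FreeAction (RAAG Γ) X μ)
    (hpmp' : PmpAction (RAAG Λ) Y ν) (hfree' : FreeAction (RAAG Λ) Y ν)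
    (hconn : Γ.Connected) (hcone : ∀ v, ∃ u, u ≠ v ∧ ¬ Γ.Adj v u)
    (herg : ∀ v, Ergodic (fun x : X => gen Γ v • x) μ)
    (herg' : ∀ w, Ergodic (fun y : Y => gen Λ w • y) ν) :
    ∃ b e, Γ.Adj b e ∧ hull μ c (gen Γ b) ∩ hull μ c (gen Γ e) = ∅ := by
  have := hconn.nonempty
  obtain ⟨b, hb⟩ := Finite.exists_max fun b : V => (reducedLk Γ b).ncard
  obtain ⟨e, d, hbe, hed, hdb, hbd⟩ := exists_path_two hconn hcone b
  refine ⟨b, e, hbe, ?_⟩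
  by_contra hne
  obtain ⟨z, hzb, hze⟩ := Set.nonempty_iff_ne_empty.2 hne
  obtain ⟨b', hb'⟩ := h.symm.hull_nonempty hpmp' hfree' hpmp (herg' z)
  have h1 := reducedLk_subset
    (h.reducedLk_subset_lk hpmp hfree hpmp' hfree' (herg b) (herg' z) hzb hb')
  have h2 := reducedLk_subset
    (h.reducedLk_subset_lk hpmp hfree hpmp' hfree' (herg e) (herg' z) hze hb')
  have h3 := Set.eq_of_subset_of_ncard_le h1 (hb b') (Set.toFinite _)
  have h4 : b ∈ reducedLk Γ e := ⟨hbe.symm, d, hed, hdb, hbd⟩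
  have h5 := h2 h4
  rw [← h3] at h5
  exact Γ.loopless.irrefl b h5.1

end DisjointHulls

section Straightening

open Filter

variable {G : Type} [Group G] [Countable G] {X : Type} [MeasurableSpace X] [MulAction G X]
  {μ : Measure X}

lemma exists_return [IsFiniteMeasure μ] (hpmp : PmpAction G X μ) (a : G) {s : Set X}
    (hs : MeasurableSet s)
    (hs0 : μ s ≠ 0) {p : X → Prop} (hp : ∀ᵐ x ∂μ, p x) :
    ∃ n : ℕ, 0 < n ∧ ∃ x, p x ∧ x ∈ s ∧ a ^ n • x ∈ s := by
  have h1 := (hpmp a).conservative.ae_mem_imp_frequently_image_mem hs.nullMeasurableSet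
  by_contra! hcon
  refine hs0 (measure_eq_zero_iff_ae_notMem.2 ?_)
  filter_upwards [h1, hp] with x hx hpx hxs
  obtain ⟨n, hn, hxn⟩ := (frequently_atTop.1 (hx hxs)) 1
  rw [smul_iterate] at hxn
  exact hcon n hn x hpx hxs hxn

variable {V : Type} [Finite V] {Γ : SimpleGraph V} {c : G → X → RAAG Γ}

/-- A cocycle twisted by a measurable map. -/
def twist (κ : X → RAAG Γ) (c : G → X → RAAG Γ) (g : G) (x : X) : RAAG Γ :=
  (κ (g • x))⁻¹ * c g x * κ x

lemma AECocycle.twist (hpmp : PmpAction G X μ) (hc : AECocycle μ c) {κ : X → RAAG Γ}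
    (hκ : Measurable κ) : AECocycle μ (OEPaper.twist κ c) := by
  refine ⟨fun g => ((hκ.comp (hpmp g).measurable).inv.mul (hc.1 g)).mul hκ, ?_⟩
  filter_upwards [hc.2] with x hx g g'
  simp only [OEPaper.twist]
  rw [hx, mul_smul]
  group

lemma exists_ae_value [NeZero μ] {Z : Type} [Countable Z] (f : X → Z) :
    ∃ z, μ {x | f x = z} ≠ 0 := by
  by_contra! hcon
  have h1 : ∀ᵐ x ∂μ, ∀ z, f x ≠ z :=
    ae_all_iff.2 fun z => measure_eq_zero_iff_ae_notMem.1 (hcon z)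
  obtain ⟨x, hx⟩ := h1.exists
  exact hx _ rfl

/-- If `c a` is constant and `a` is ergodic then `c` is constant on the centralizer of `a`. -/
lemma AECocycle.const_of_commute [IsProbabilityMeasure μ] (hpmp : PmpAction G X μ)
    (hc : AECocycle μ c) {a g : G} (ha : Ergodic (fun x : X => a • x) μ) (hga : Commute g a)
    {ρ : RAAG Γ} (hρ : ∀ᵐ x ∂μ, c a x = ρ) : ∃ σ, ∀ᵐ x ∂μ, c g x = σ := by
  have h1 : ∀ᵐ x ∂μ, c g (a • x) = ρ * c g x * ρ⁻¹ := by
    filter_upwards [hc.2, hρ, (hpmp g).quasiMeasurePreserving.ae hρ] with x e1 e2 e3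
    have e4 := e1 g a
    rw [hga.eq, e1 a g, e2, e3] at e4
    rw [e4, mul_inv_cancel_right]
  have h2 : ∀ᵐ x ∂μ, ∀ n : ℕ, c g (a ^ n • x) = ρ ^ n * c g x * (ρ ^ n)⁻¹ := by
    filter_upwards [hpmp.ae_smul h1] with x hx n
    induction n with
    | zero => simp
    | succ n ih =>
      rw [pow_succ', mul_smul, hx, ih, pow_succ']
      group
  obtain ⟨σ, hσ⟩ := exists_ae_value (μ := μ) (c g)
  have hm : MeasurableSet {x | c g x = σ} := hc.1 g (measurableSet_singleton σ)
  obtain ⟨n, hn, x, hx, hxs, hxn⟩ := exists_return hpmp a hm hσ h2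
  have h3 : Commute ρ σ := by
    refine commute_of_pow hn ?_
    have h4 := hx n
    rw [show c g (a ^ n • x) = σ from hxn, show c g x = σ from hxs] at h4
    exact (eq_mul_inv_iff_mul_eq.1 h4).symm
  refine ⟨σ, ae_of_ergodic ha hm ?_ hσ⟩
  filter_upwards [h1] with x hx
  rw [hx, mul_inv_eq_iff_eq_mul, ← h3.eq, mul_right_inj]

/-- If two commuting elements have disjoint hulls then `c` can be made constant on one of them. -/
lemma AECocycle.const_of_disjoint_hull [IsProbabilityMeasure μ] (hpmp : PmpAction G X μ)
    (hc : AECocycle μ c) {b e : G} (he : Ergodic (fun x : X => e • x) μ) (hbe : Commute b e)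
    (hdisj : hull μ c b ∩ hull μ c e = ∅) :
    ∃ κ : X → RAAG Γ, Measurable κ ∧ ∃ ρ, ∀ᵐ x ∂μ, OEPaper.twist κ c b x = ρ := by
  obtain ⟨φ, hφm, hφ⟩ := reduces_hull μ c b
  obtain ⟨ψ, hψm, hψ⟩ := reduces_hull μ c e
  set S := hull μ c b with hS
  set κ : X → RAAG Γ := fun x => φ x * retr Γ S ((φ x)⁻¹ * ψ x) with hκ
  have hκm : Measurable κ :=
    hφm.mul ((measurable_of_countable (retr Γ S)).comp (hφm.inv.mul hψm))
  have hr : ∀ g, retr Γ S (retr Γ S g) = retr Γ S g := fun g => retr_of_mem (retr_mem S g)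
  have h1 : ∀ᵐ x ∂μ, retr Γ S (OEPaper.twist κ c e x) = 1 := by
    filter_upwards [hψ] with x hx
    have h2 := retr_mem_inter (S := S) hx
    rw [hdisj, standardSub_empty, Subgroup.mem_bot] at h2
    simp only [OEPaper.twist, hκ, map_mul, map_inv, hr]
    simp only [map_mul, map_inv] at h2
    rw [← h2]
    group
  have h2 : ∀ᵐ x ∂μ, OEPaper.twist κ c b x ∈ standardSub Γ S := by
    filter_upwards [hφ] with x hx
    simp only [OEPaper.twist, hκ]
    have h3 := mul_mem (mul_mem (inv_mem (retr_mem S ((φ (b • x))⁻¹ * ψ (b • x)))) hx)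
      (retr_mem S ((φ x)⁻¹ * ψ x))
    convert h3 using 1
    group
  have hc2 := hc.twist hpmp hκm
  refine ⟨κ, hκm, ?_⟩
  have h3 : OEPaper.twist κ c b ∘ (fun x => e • x) =ᵐ[μ] OEPaper.twist κ c b := by
    filter_upwards [hc2.2, h1, (hpmp b).quasiMeasurePreserving.ae h1, h2,
      (hpmp e).quasiMeasurePreserving.ae h2] with x e1 e2 e3 e4 e5
    have e6 := e1 b e
    rw [hbe.eq, e1 e b] at e6
    have e7 := congrArg (retr Γ S) e6
    rw [map_mul, map_mul, e2, e3, retr_of_mem e4, retr_of_mem e5, one_mul, mul_one] at e7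
    exact e7.symm
  obtain ⟨ρ, hρ⟩ := he.quasiErgodic.ae_eq_const_of_ae_eq_comp₀
    ((hc2.1 b).nullMeasurable (μ := μ)) h3
  exact ⟨ρ, hρ⟩

end Straightening

section Homomorphism

variable {V W : Type} [Finite V] [Finite W] {Γ : SimpleGraph V} {Λ : SimpleGraph W}
  {X : Type} [MeasurableSpace X] [MulAction (RAAG Γ) X] {μ : Measure X} [IsProbabilityMeasure μ]
  {c : RAAG Γ → X → RAAG Λ}

/-- Over a connected graph, a cocycle which is constant on one generator is a homomorphism. -/
lemma AECocycle.exists_hom (hpmp : PmpAction (RAAG Γ) X μ) (hc : AECocycle μ c)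
    (hconn : Γ.Connected) (herg : ∀ v, Ergodic (fun x : X => gen Γ v • x) μ) {b : V}
    (hb : ∃ ρ, ∀ᵐ x ∂μ, c (gen Γ b) x = ρ) :
    ∃ α : RAAG Γ →* RAAG Λ, ∀ᵐ x ∂μ, ∀ g, c g x = α g := by
  have key : ∀ {x y : V}, Γ.Walk x y → (∃ ρ, ∀ᵐ t ∂μ, c (gen Γ x) t = ρ) →
      ∃ ρ, ∀ᵐ t ∂μ, c (gen Γ y) t = ρ := by
    intro x y p
    induction p with
    | nil => exact id
    | cons hadj _ ih =>
      rintro ⟨ρ, hρ⟩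
      exact ih (hc.const_of_commute hpmp (herg _) (gen_commute hadj.symm) hρ)
  have hgen : ∀ v, ∃ ρ, ∀ᵐ t ∂μ, c (gen Γ v) t = ρ := fun v => by
    obtain ⟨p⟩ := hconn.preconnected b v
    exact key p hb
  have hone : ∀ᵐ x ∂μ, c 1 x = 1 := by
    filter_upwards [hc.2] with x hx
    simpa using hx 1 1
  have hmul : ∀ g g' ρ ρ', (∀ᵐ x ∂μ, c g x = ρ) → (∀ᵐ x ∂μ, c g' x = ρ') →
      ∀ᵐ x ∂μ, c (g * g') x = ρ * ρ' := by
    intro g g' ρ ρ' h1 h2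
    filter_upwards [hc.2, (hpmp g').quasiMeasurePreserving.ae h1, h2] with x e1 e2 e3
    rw [e1, e2, e3]
  have hinv : ∀ g ρ, (∀ᵐ x ∂μ, c g x = ρ) → ∀ᵐ x ∂μ, c g⁻¹ x = ρ⁻¹ := by
    intro g ρ h1
    filter_upwards [hc.2, (hpmp g⁻¹).quasiMeasurePreserving.ae h1, hone] with x e1 e2 e3
    have e4 := e1 g g⁻¹
    rw [mul_inv_cancel, e2, e3] at e4
    exact (inv_eq_of_mul_eq_one_right e4.symm).symm
  have hall : ∀ g, ∃ ρ, ∀ᵐ t ∂μ, c g t = ρ := by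
    intro g
    induction g using raag_induction with
    | one => exact ⟨1, hone⟩
    | mul_gen g v ih =>
      obtain ⟨ρ, hρ⟩ := ih
      obtain ⟨σ, hσ⟩ := hgen v
      exact ⟨_, hmul _ _ _ _ hρ hσ⟩
    | mul_gen_inv g v ih =>
      obtain ⟨ρ, hρ⟩ := ih
      obtain ⟨σ, hσ⟩ := hgen v
      exact ⟨_, hmul _ _ _ _ hρ (hinv _ _ hσ)⟩
  choose α hα using hall
  refine ⟨MonoidHom.mk' α fun g g' => ?_, ae_all_iff.2 hα⟩
  obtain ⟨x, h1, h2⟩ := ((hα (g * g')).and (hmul g g' _ _ (hα g) (hα g'))).exists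
  rw [← h1, h2]

variable [StandardBorelSpace X]
  {Y : Type} [MeasurableSpace Y] [StandardBorelSpace Y] [MulAction (RAAG Λ) Y]
  {ν : Measure Y} [IsProbabilityMeasure ν] {F : X → Y}
  {c' : RAAG Λ → Y → RAAG Γ} {F' : Y → X} {l : X → RAAG Γ} {k : Y → RAAG Λ}

theorem OrbitPair.exists_equivariant (h : OrbitPair μ ν c F c' F' l k)
    (hpmp : PmpAction (RAAG Γ) X μ) (hfree : FreeAction (RAAG Γ) X μ)
    (hpmp' : PmpAction (RAAG Λ) Y ν) (hfree' : FreeAction (RAAG Λ) Y ν)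
    (hconn : Γ.Connected) (hcone : ∀ v, ∃ u, u ≠ v ∧ ¬ Γ.Adj v u)
    (herg : ∀ v, Ergodic (fun x : X => gen Γ v • x) μ)
    (herg' : ∀ w, Ergodic (fun y : Y => gen Λ w • y) ν) :
    ∃ (κ : X → RAAG Λ) (α : RAAG Γ →* RAAG Λ), Measurable κ ∧
      ∀ᵐ x ∂μ, ∀ g : RAAG Γ, κ (g • x) • F (g • x) = α g • κ x • F x := by
  have hc := h.fwd.cocycle hpmp hfree'
  obtain ⟨b, e, hbe, hdisj⟩ :=
    h.exists_disjoint_hull hpmp hfree hpmp' hfree' hconn hcone herg herg'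
  obtain ⟨κ, hκm, hκ⟩ := hc.const_of_disjoint_hull hpmp (herg e) (gen_commute hbe) hdisj
  obtain ⟨α, hα⟩ := (hc.twist hpmp hκm).exists_hom hpmp hconn herg hκ
  refine ⟨fun x => (κ x)⁻¹, α, hκm.inv, ?_⟩
  filter_upwards [hα, h.fwd.equivariant] with x h1 h2 g
  rw [h2, ← h1, smul_smul, smul_smul, twist, mul_inv_cancel_right]

end Homomorphism

section Conjugacy

lemma quasiMeasurePreserving_smul {X Y H : Type} [MeasurableSpace X] [MeasurableSpace Y]
    [Group H] [Countable H] [MeasurableSpace H] [DiscreteMeasurableSpace H] [MulAction H Y]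
    {μ : Measure X} {ν : Measure Y} (hpmp : PmpAction H Y ν) {F : X → Y}
    (hF : Measure.QuasiMeasurePreserving F μ ν) {κ : X → H} (hκ : Measurable κ) :
    Measure.QuasiMeasurePreserving (fun x => κ x • F x) μ ν := by
  have hm : Measurable fun x => κ x • F x :=
    measurable_apply_countable (f := fun (z : H) x => z • F x)
      (fun z => (hpmp z).measurable.comp hF.measurable) hκ
  refine ⟨hm, Measure.AbsolutelyContinuous.mk fun s hs h0 => ?_⟩
  rw [Measure.map_apply hm hs]
  refine measure_eq_zero_iff_ae_notMem.2 ?_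
  filter_upwards [hF.ae (hpmp.ae_smul (measure_eq_zero_iff_ae_notMem.1 h0))] with x hx
  exact hx _

variable {V : Type} [Finite V] {Γ : SimpleGraph V}
  {X : Type} [MeasurableSpace X] [MulAction (RAAG Γ) X] {μ : Measure X} [IsProbabilityMeasure μ]

/-- An equivariant map which moves points inside their orbits is a translation. -/
lemma const_of_equivariant (hpmp : PmpAction (RAAG Γ) X μ) (hfree : FreeAction (RAAG Γ) X μ)
    (v : V) (herg : ∀ v, Ergodic (fun x : X => gen Γ v • x) μ) {θ : X → RAAG Γ}
    (hθ : Measurable θ) {σ : RAAG Γ →* RAAG Γ}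
    (h : ∀ᵐ x ∂μ, ∀ g : RAAG Γ, θ (g • x) • g • x = σ g • θ x • x) :
    ∃ k, (∀ᵐ x ∂μ, θ x = k) ∧ ∀ g, σ g = k * g * k⁻¹ := by
  have h1 : ∀ᵐ x ∂μ, ∀ g : RAAG Γ, θ (g • x) * g = σ g * θ x := by
    filter_upwards [h, hfree.ae_free] with x h1 h2 g
    refine ae_injective_of_free h2 ?_
    rw [mul_smul, mul_smul, h1]
  obtain ⟨k, hk⟩ := exists_ae_value (μ := μ) θ
  have hm : MeasurableSet {x | θ x = k} := hθ (measurableSet_singleton k)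
  obtain ⟨n, hn, x, hx, hxs, hxn⟩ := exists_return hpmp (gen Γ v) hm hk h1
  have h2 : σ (gen Γ v) * k = k * gen Γ v := by
    refine semiconj_of_pow hn ?_
    have h3 := hx (gen Γ v ^ n)
    rw [show θ (gen Γ v ^ n • x) = k from hxn, show θ x = k from hxs, map_pow] at h3
    exact h3.symm
  have h3 : ∀ᵐ x ∂μ, θ x = k := by
    refine ae_of_ergodic (herg v) hm ?_ hk
    filter_upwards [h1] with x hx
    have h4 := hx (gen Γ v)
    constructor
    · intro h5
      rw [h5, ← h2, mul_right_inj] at h4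
      exact h4.symm
    · intro h5
      rw [h5, h2, mul_left_inj] at h4
      exact h4
  refine ⟨k, h3, fun g => ?_⟩
  obtain ⟨x, h4, h5⟩ := (h1.and (hpmp.ae_smul h3)).exists
  have h6 := h4 g
  rw [h5 g, show θ x = k by simpa using h5 1] at h6
  rw [h6, mul_inv_cancel_right]

variable [StandardBorelSpace X] {W : Type} [Finite W] {Λ : SimpleGraph W}
  {Y : Type} [MeasurableSpace Y] [StandardBorelSpace Y] [MulAction (RAAG Λ) Y]
  {ν : Measure Y} [IsProbabilityMeasure ν] {c : RAAG Γ → X → RAAG Λ} {F : X → Y}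
  {c' : RAAG Λ → Y → RAAG Γ} {F' : Y → X} {l : X → RAAG Γ} {k : Y → RAAG Λ}

lemma OrbitPair.comp_eq_translation (h : OrbitPair μ ν c F c' F' l k)
    (hpmp : PmpAction (RAAG Γ) X μ) (hfree : FreeAction (RAAG Γ) X μ)
    (hpmp' : PmpAction (RAAG Λ) Y ν) (v : V)
    (herg : ∀ v, Ergodic (fun x : X => gen Γ v • x) μ)
    {κ : X → RAAG Λ} {α : RAAG Γ →* RAAG Λ} (hκ : Measurable κ)
    (hα : ∀ᵐ x ∂μ, ∀ g : RAAG Γ, κ (g • x) • F (g • x) = α g • κ x • F x)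
    {κ' : Y → RAAG Γ} {β : RAAG Λ →* RAAG Γ} (hκ' : Measurable κ')
    (hβ : ∀ᵐ y ∂ν, ∀ g : RAAG Λ, κ' (g • y) • F' (g • y) = β g • κ' y • F' y) :
    ∃ t, (∀ᵐ x ∂μ, κ' (κ x • F x) • F' (κ x • F x) = t • x) ∧
      ∀ g, β (α g) = t * g * t⁻¹ := by
  have hΦ := quasiMeasurePreserving_smul hpmp' h.fwd.qmp hκ
  set θ : X → RAAG Γ := fun x => κ' (κ x • F x) * c' (κ x) (F x) * l x with hθ
  have hθm : Measurable θ :=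
    ((hκ'.comp hΦ.measurable).mul (measurable_apply_countable (f := fun z x => c' z (F x))
      (fun z => (h.bwd.meas_coc z).comp h.fwd.qmp.measurable) hκ)).mul h.meas_left
  have hθx : ∀ᵐ x ∂μ, κ' (κ x • F x) • F' (κ x • F x) = θ x • x := by
    filter_upwards [h.fwd.qmp.ae h.bwd.equivariant, h.left] with x h1 h2
    rw [h1, h2, hθ, mul_smul, mul_smul]
  obtain ⟨t, ht, hσ⟩ := const_of_equivariant hpmp hfree v herg hθm (σ := β.comp α) (by
    filter_upwards [hθx, hpmp.ae_smul hθx, hα, hΦ.ae hβ] with x h1 h2 h3 h4 g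
    rw [← h1, ← h2, h3, h4]
    rfl)
  refine ⟨t, ?_, hσ⟩
  filter_upwards [hθx, ht] with x h1 h2
  rw [h1, h2]

theorem OrbitPair.conjugateActions (h : OrbitPair μ ν c F c' F' l k)
    (hpmp : PmpAction (RAAG Γ) X μ) (hfree : FreeAction (RAAG Γ) X μ)
    (hpmp' : PmpAction (RAAG Λ) Y ν) (hfree' : FreeAction (RAAG Λ) Y ν)
    (hconn : Γ.Connected) (hcone : ∀ v, ∃ u, u ≠ v ∧ ¬ Γ.Adj v u)
    (hconn' : Λ.Connected) (hcone' : ∀ v, ∃ u, u ≠ v ∧ ¬ Λ.Adj v u)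
    (herg : ∀ v, Ergodic (fun x : X => gen Γ v • x) μ)
    (herg' : ∀ w, Ergodic (fun y : Y => gen Λ w • y) ν) :
    ConjugateActions (RAAG Γ) X (RAAG Λ) Y μ ν := by
  obtain ⟨v⟩ := hconn.nonempty
  obtain ⟨w⟩ := hconn'.nonempty
  obtain ⟨κ, α, hκ, hα⟩ :=
    h.exists_equivariant hpmp hfree hpmp' hfree' hconn hcone herg herg'
  obtain ⟨κ', β, hκ', hβ⟩ :=
    h.symm.exists_equivariant hpmp' hfree' hpmp hfree hconn' hcone' herg' herg
  obtain ⟨t, ht, hβα⟩ := h.comp_eq_translation hpmp hfree hpmp' v herg hκ hα hκ' hβ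
  obtain ⟨s, hs, hαβ⟩ := h.symm.comp_eq_translation hpmp' hfree' hpmp w herg' hκ' hβ hκ hα
  have hΦ := quasiMeasurePreserving_smul hpmp' h.fwd.qmp hκ
  have hΨ := quasiMeasurePreserving_smul hpmp h.bwd.qmp hκ'
  have hbij : Function.Bijective α := by
    constructor
    · intro g g' hg
      have h1 := hβα g
      rw [hg, hβα g', mul_left_inj, mul_right_inj] at h1
      exact h1.symm
    · intro g
      refine ⟨β (s⁻¹ * g * s), ?_⟩
      rw [hαβ]
      group
  have hts : α t = s := by
    obtain ⟨x, h1, h2, h3, h4⟩ := (ht.and (hα.and ((hΦ.ae hs).and (hΦ.ae hfree'.ae_free)))).exists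
    refine ae_injective_of_free h4 ?_
    rw [← h2, ← h1, h3]
  set Φ : X → Y := fun x => κ x • F x with hΦdef
  have hmp : MeasurePreserving Φ μ ν := by
    refine ⟨hΦ.measurable, ?_⟩
    have := Measure.isProbabilityMeasure_map (μ := μ) hΦ.measurable.aemeasurable
    refine (herg' w).eq_of_absolutelyContinuous ?_ hΦ.absolutelyContinuous
    obtain ⟨g, hg⟩ := hbij.2 (gen Λ w)
    refine ⟨(hpmp' _).measurable, ?_⟩
    rw [Measure.map_map (hpmp' _).measurable hΦ.measurable]
    have h1 : (fun y : Y => gen Λ w • y) ∘ Φ =ᵐ[μ] Φ ∘ fun x => g • x := by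
      filter_upwards [hα] with x hx
      simp only [Function.comp, hΦdef]
      rw [hx, hg]
    rw [Measure.map_congr h1, ← Measure.map_map hΦ.measurable (hpmp g).measurable, (hpmp g).map_eq]
  refine ⟨MulEquiv.ofBijective α hbij, Φ, ⟨hΦ.measurable, hmp,
    fun y => t⁻¹ • κ' y • F' y, (hpmp t⁻¹).measurable.comp hΨ.measurable, ?_, ?_⟩,
    fun g => ?_⟩
  · filter_upwards [ht] with x hx
    rw [hx, inv_smul_smul]
  · filter_upwards [hs, hΨ.ae hα] with y h1 h2
    simp only [hΦdef]
    rw [h2, h1, map_inv, hts, inv_smul_smul]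
  · filter_upwards [hα] with x hx
    exact hx g

end Conjugacy

section Transport

variable {G G' X : Type} [Group G] [Group G'] [MulAction G X] [MulAction G' X] {e : G' ≃* G}

lemma orbit_eq_of_mulEquiv (h : ∀ (g : G') (x : X), g • x = e g • x) (x : X) :
    MulAction.orbit G' x = MulAction.orbit G x := by
  ext y
  constructor
  · rintro ⟨g, rfl⟩
    exact ⟨e g, (h g x).symm⟩
  · rintro ⟨g, rfl⟩
    exact ⟨e.symm g, by simp [h]⟩

variable [MeasurableSpace X] {μ : Measure X}

lemma PmpAction.of_mulEquiv (h : ∀ (g : G') (x : X), g • x = e g • x) (hG : PmpAction G X μ) :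
    PmpAction G' X μ := fun g => by
  simpa only [h] using hG (e g)

lemma FreeAction.of_mulEquiv (h : ∀ (g : G') (x : X), g • x = e g • x) (hG : FreeAction G X μ) :
    FreeAction G' X μ := fun g hg => by
  simpa only [h] using hG (e g) (by simpa using hg)

variable {H H' Y : Type} [Group H] [Group H'] [MulAction H Y] [MulAction H' Y] {e' : H' ≃* H}
  [MeasurableSpace Y] {ν : Measure Y}

/-- A stable orbit equivalence only depends on the orbits. -/
def StableOE.ofMulEquiv (h : ∀ (g : G') (x : X), g • x = e g • x)
    (h' : ∀ (g : H') (y : Y), g • y = e' g • y) (f : StableOE G X H Y μ ν) :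
    StableOE G' X H' Y μ ν :=
  { f with orbit_eq := by simpa only [orbit_eq_of_mulEquiv h, orbit_eq_of_mulEquiv h']
      using f.orbit_eq }

lemma ConjugateActions.of_mulEquiv (h : ∀ (g : G') (x : X), g • x = e g • x)
    (h' : ∀ (g : H') (y : Y), g • y = e' g • y) (hc : ConjugateActions G' X H' Y μ ν) :
    ConjugateActions G X H Y μ ν := by
  obtain ⟨α, F, hF, hα⟩ := hc
  refine ⟨(e.symm.trans α).trans e', F, hF, fun g => ?_⟩
  filter_upwards [hα (e.symm g)] with x hx
  simpa [h, h'] using hx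

end Transport

/-- Stably orbit equivalent free irreducible pmp actions of one-ended
centerless right-angled Artin groups are conjugate. -/
theorem stmt0
    {V W : Type} [Fintype V] [Fintype W]
    (Γ : SimpleGraph V) (Λ : SimpleGraph W)
    (hΓconn : Γ.Connected) (hΓcard : 2 ≤ Fintype.card V)
    (hΓcenterless : ∀ v : V, ∃ u : V, u ≠ v ∧ ¬ Γ.Adj v u)
    (hΛconn : Λ.Connected) (hΛcard : 2 ≤ Fintype.card W)
    (hΛcenterless : ∀ w : W, ∃ u : W, u ≠ w ∧ ¬ Λ.Adj w u)
    (X Y : Type) [MeasurableSpace X] [MeasurableSpace Y]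
    [StandardBorelSpace X] [StandardBorelSpace Y]
    (μ : Measure X) (ν : Measure Y) [IsProbabilityMeasure μ] [IsProbabilityMeasure ν]
    [MulAction (RAAG Γ) X] [MulAction (RAAG Λ) Y]
    (hXpmp : PmpAction (RAAG Γ) X μ) (hXfree : FreeAction (RAAG Γ) X μ)
    (hXirr : IrreducibleAction (RAAG Γ) X μ)
    (hYpmp : PmpAction (RAAG Λ) Y ν) (hYfree : FreeAction (RAAG Λ) Y ν)
    (hYirr : IrreducibleAction (RAAG Λ) Y ν)
    (hSOE : Nonempty (StableOE (RAAG Γ) X (RAAG Λ) Y μ ν)) :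
    ConjugateActions (RAAG Γ) X (RAAG Λ) Y μ ν := by
  obtain ⟨f⟩ := hSOE
  obtain ⟨n, Δ, e, he⟩ := hXirr
  obtain ⟨m, Δ', e', he'⟩ := hYirr
  let _ : MulAction (RAAG Δ) X := MulAction.compHom X e.toMonoidHom
  let _ : MulAction (RAAG Δ') Y := MulAction.compHom Y e'.toMonoidHom
  have hX : ∀ (g : RAAG Δ) (x : X), g • x = e g • x := fun _ _ => rfl
  have hY : ∀ (g : RAAG Δ') (y : Y), g • y = e' g • y := fun _ _ => rfl
  have hconn := connected_of_equiv e hΓconn hΓcard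
  have hconn' := connected_of_equiv e' hΛconn hΛcard
  obtain ⟨v⟩ := hconn.nonempty
  obtain ⟨w⟩ := hconn'.nonempty
  have hpmp := hXpmp.of_mulEquiv hX
  have hpmp' := hYpmp.of_mulEquiv hY
  obtain ⟨c, F, c', F', l, k, h⟩ :=
    (f.ofMulEquiv hX hY).exists_orbitPair hpmp hpmp' (he v) (he' w)
  exact (h.conjugateActions hpmp (hXfree.of_mulEquiv hX) hpmp' (hYfree.of_mulEquiv hY) hconn
    (no_cone_of_equiv e hΓcenterless) hconn' (no_cone_of_equiv e' hΛcenterless) he he').of_mulEquiv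
    hX hY

end OEPaper
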